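/- arXiv:2301.09752 — 3 statements merged into one kernel-verified Lean document; each statement's English description precedes it below -/
import Mathlib

section
/- There is a computable function F : ℚ × ℚ × ℚ × ℚ × ℚ × ℚ × ℚ → Bool such that for all rationals a1, b1, a2, b2, c, x0, t: if the two-interval PAM f defined by these parameters maps [0,1) ∩ ℚ into [0,1) ∩ ℚ, is injective on [0,1) ∩ ℚ, and x0, t ∈ [0,1) ∩ ℚ, then F (a1, b1, a2, b2, c, x0, t) = true if and only if there exists n : ℕ with f^[n] x0 = t. (Decidability of the reachability problem for injective piecewise affine maps with two intervals.) -/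
/-- The two-interval piecewise affine map on `[0,1) ∩ ℚ` given by rationals
`a1, b1, a2, b2, c`. -/
def pam2 (a1 b1 a2 b2 c : ℚ) (x : ℚ) : ℚ :=
  if 0 ≤ x ∧ x < c then a1 * x + b1
  else if c ≤ x ∧ x < 1 then a2 * x + b2
  else 0


/-- Eventual periodicity of a predicate on the naturals. -/
def EvPer (P : ℕ → Prop) : Prop := ∃ N q, 0 < q ∧ ∀ n ≥ N, (P (n + q) ↔ P n)

theorem evPer_of_residues (P : ℕ → Prop) (q : ℕ) (hq : 0 < q)
    (h : ∀ r < q, ∃ M, ∀ m ≥ M, (P (r + q * (m + 1)) ↔ P (r + q * m))) : EvPer P := by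
  choose! M hM using h
  refine ⟨q * (∑ r ∈ Finset.range q, M r), q, hq, fun n hn => ?_⟩
  have hr : n % q < q := Nat.mod_lt _ hq
  have h1 : M (n % q) ≤ ∑ r ∈ Finset.range q, M r :=
    Finset.single_le_sum (f := M) (fun _ _ => Nat.zero_le _) (Finset.mem_range.2 hr)
  have h2 : (∑ r ∈ Finset.range q, M r) ≤ n / q := by
    rw [Nat.le_div_iff_mul_le hq]; linarith [mul_comm q (∑ r ∈ Finset.range q, M r)]
  have := hM (n % q) hr (n / q) (h1.trans h2)
  rw [mul_add, mul_one, ← add_assoc, Nat.mod_add_div] at this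
  exact this

theorem mono_bdd_const (h : ℕ → ℤ) (hm : ∀ n, h n ≤ h (n + 1)) (B : ℤ) (hB : ∀ n, h n ≤ B) :
    ∃ M, ∀ m ≥ M, h (m + 1) = h m := by
  classical
  have hmono : Monotone h := monotone_nat_of_le_succ hm
  obtain ⟨M, hM⟩ : ∃ M, ∀ m, (B - h M).toNat ≤ (B - h m).toNat := by
    have := Nat.find_spec (⟨_, ⟨0, rfl⟩⟩ : ∃ k, ∃ n, (B - h n).toNat = k)
    obtain ⟨M, hM⟩ := this
    refine ⟨M, fun m => ?_⟩
    rw [hM]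
    exact Nat.find_min' _ ⟨m, rfl⟩
  refine ⟨M, fun m hm' => ?_⟩
  have h1 := hmono hm'
  have h2 := hM (m + 1)
  have h3 := hm m
  have h4 := hB (m + 1)
  have h5 := hB M
  omega

theorem antitone_bdd_const (h : ℕ → ℤ) (hm : ∀ n, h (n + 1) ≤ h n) (B : ℤ) (hB : ∀ n, B ≤ h n) :
    ∃ M, ∀ m ≥ M, h (m + 1) = h m := by
  obtain ⟨M, hM⟩ := mono_bdd_const (fun n => - h n) (fun n => by simpa using hm n) (-B)
    (fun n => by simpa using hB n)
  exact ⟨M, fun m hm => by simpa using hM m hm⟩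

/-- Case where the images are ordered as the pieces are. -/
theorem evPer_lt {α : Type*} [LinearOrder α] (x : ℕ → α) (P : ℕ → Prop)
    (h1 : ∀ n m, P n → ¬ P m → x n < x m)
    (h2 : ∀ n m, P n → ¬ P m → x (n + 1) < x (m + 1)) : EvPer P := by
  by_cases h : ∃ n, P n ∧ ¬ P (n + 1)
  · obtain ⟨n, hn, hn'⟩ := h
    have key : ∀ k, ¬ P (n + 1 + k) := by
      intro k
      induction k with
      | zero => exact hn'
      | succ k ih =>
        intro hP
        have a := h2 n _ hn ih
        have b := h1 _ _ hP hn'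
        exact lt_asymm a b
    refine ⟨n + 1, 1, one_pos, fun m hm => ?_⟩
    obtain ⟨k, rfl⟩ := Nat.exists_eq_add_of_le hm
    exact iff_of_false (key (k + 1)) (key k)
  · push Not at h
    by_cases h' : ∃ n, P n
    · obtain ⟨n, hn⟩ := h'
      have key : ∀ k, P (n + k) := by
        intro k
        induction k with
        | zero => exact hn
        | succ k ih => exact h _ ih
      refine ⟨n, 1, one_pos, fun m hm => ?_⟩
      obtain ⟨k, rfl⟩ := Nat.exists_eq_add_of_le hm
      exact iff_of_true (key (k + 1)) (key k)
    · push Not at h'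
      exact ⟨0, 1, one_pos, fun m _ => iff_of_false (h' _) (h' _)⟩

/-- Case where the map is decreasing. -/
theorem evPer_anti {α : Type*} [LinearOrder α] (x : ℕ → α) (P : ℕ → Prop)
    (h1 : ∀ n m, P n → ¬ P m → x n < x m)
    (h2 : ∀ n m, x n < x m → x (m + 1) < x (n + 1))
    (h3 : ∀ n m, x n = x m → x (m + 1) = x (n + 1)) : EvPer P := by
  classical
  have hsq : ∀ n m, x n ≤ x m → x (n + 2) ≤ x (m + 2) := by
    intro n m h
    rcases h.lt_or_eq with h | h
    · exact (h2 _ _ (h2 _ _ h)).le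
    · exact (h3 _ _ (h3 _ _ h)).le
  apply evPer_of_residues P 2 two_pos
  intro r _
  let h : ℕ → ℤ := fun m => if P (r + 2 * m) then 0 else 1
  have hP : ∀ n m, x n ≤ x m → P m → P n := by
    intro n m hnm hm
    by_contra hn
    exact absurd (h1 _ _ hm hn) (not_lt.2 hnm)
  have hfin : (∃ M, ∀ m ≥ M, h (m + 1) = h m) → ∃ M, ∀ m ≥ M,
      (P (r + 2 * (m + 1)) ↔ P (r + 2 * m)) := by
    rintro ⟨M, hM⟩
    refine ⟨M, fun m hm => ?_⟩
    have := hM m hm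
    simp only [h] at this
    split_ifs at this <;> simp_all
  apply hfin
  rcases le_total (x r) (x (r + 2)) with hr | hr
  · have hmono : ∀ m, x (r + 2 * m) ≤ x (r + 2 * (m + 1)) := by
      intro m
      induction m with
      | zero => simpa using hr
      | succ m ih => exact hsq _ _ ih
    apply mono_bdd_const h _ 1
    · intro n; simp only [h]; split_ifs <;> norm_num
    · intro n; simp only [h]
      have := hP _ _ (hmono n)
      split_ifs <;> first | (exfalso; tauto) | norm_num
  · have hmono : ∀ m, x (r + 2 * (m + 1)) ≤ x (r + 2 * m) := by
      intro m
      induction m with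
      | zero => simpa using hr
      | succ m ih => exact hsq _ _ ih
    apply antitone_bdd_const h _ 0
    · intro n; simp only [h]; split_ifs <;> norm_num
    · intro n; simp only [h]
      have := hP _ _ (hmono n)
      split_ifs <;> first | (exfalso; tauto) | norm_num

/-- Case with one increasing (lower) and one decreasing (upper) piece, images reversed. -/
theorem evPer_flip {α : Type*} [LinearOrder α] (x : ℕ → α) (P : ℕ → Prop)
    (h1 : ∀ n m, P n → ¬ P m → x n < x m)
    (h2 : ∀ n m, P n → P m → x n < x m → x (n + 1) < x (m + 1))
    (h3 : ∀ n m, ¬ P n → ¬ P m → x n < x m → x (m + 1) < x (n + 1))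
    (h4 : ∀ n m, P n → ¬ P m → x (m + 1) < x (n + 1)) : EvPer P := by
  classical
  by_cases hfin : ∃ n, ∀ k, P (n + k)
  · obtain ⟨n, hn⟩ := hfin
    refine ⟨n, 1, one_pos, fun m hm => ?_⟩
    obtain ⟨k, rfl⟩ := Nat.exists_eq_add_of_le hm
    exact iff_of_true (hn (k + 1)) (hn k)
  push Not at hfin
  have hk : ∀ n, ∃ k, ¬ P (n + 1 + k) ∧ ∀ j < k, P (n + 1 + j) := by
    intro n
    refine ⟨Nat.find (hfin (n + 1)), Nat.find_spec (hfin (n + 1)), fun j hj => ?_⟩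
    have := Nat.find_min _ hj
    exact not_not.1 this
  choose k hk1 hk2 using hk
  have ha : ∀ n m, ¬ P n → ¬ P m → x n < x m → k n ≤ k m := by
    intro n m hn hm hnm
    by_contra hlt
    push Not at hlt
    have key : ∀ j ≤ k m, x (m + 1 + j) < x (n + 1 + j) := by
      intro j
      induction j with
      | zero => intro _; exact h3 _ _ hn hm hnm
      | succ j ih =>
        intro hj
        exact h2 _ _ (hk2 m j (by omega)) (hk2 n j (by omega)) (ih (by omega))
    have := key (k m) le_rfl
    exact lt_asymm this (h1 _ _ (hk2 n _ hlt) (hk1 m))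
  have hb : ∀ n m, ¬ P n → k n < k m → k m = k n + 1 ∧ x (n + 1 + k n) < x (m + 1 + k m) := by
    intro n m hn hlt
    have key : ∀ j ≤ k n, x (n + 1 + j) < x (m + 1 + (j + 1)) := by
      intro j
      induction j with
      | zero =>
        intro _
        have : P (m + 1 + 0) := hk2 m 0 (by omega)
        exact h4 _ _ this hn
      | succ j ih =>
        intro hj
        exact h2 _ _ (hk2 n j (by omega)) (hk2 m (j + 1) (by omega)) (ih (by omega))
    have h5 := key (k n) le_rfl
    have h6 : k m = k n + 1 := by
      by_contra hne
      have : P (m + 1 + (k n + 1)) := hk2 m _ (by omega)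
      exact lt_asymm h5 (h1 _ _ this (hk1 n))
    refine ⟨h6, ?_⟩
    rw [h6]; exact h5
  obtain ⟨r0, hr0⟩ := hfin 0
  let r : ℕ → ℕ := fun i => Nat.rec r0 (fun _ s => s + 1 + k s) i
  have hrs : ∀ i, r (i + 1) = r i + 1 + k (r i) := fun i => rfl
  have hr : ∀ i, ¬ P (r i) := by
    intro i
    cases i with
    | zero => simpa [r] using hr0
    | succ i => rw [hrs]; exact hk1 _
  obtain ⟨I, K, hI⟩ : ∃ I K, ∀ i, k (r (I + i)) = K := by
    by_cases hinc : ∃ i, k (r i) < k (r (i + 1))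
    · obtain ⟨i, hi⟩ := hinc
      refine ⟨i + 1, k (r i) + 1, fun l => ?_⟩
      induction l with
      | zero => exact (hb _ _ (hr i) hi).1
      | succ l ih =>
        have h5 := (hb (r i) (r (i + 1 + l)) (hr i) (by omega)).2
        rw [← hrs, ← hrs] at h5
        have h6 := ha (r (i + 1)) (r (i + 1 + l + 1)) (hr (i + 1)) (hr (i + 1 + l + 1)) h5
        have h7 : k (r i) < k (r (i + 1 + l + 1)) := by omega
        exact (hb _ _ (hr i) h7).1
    · push Not at hinc
      obtain ⟨M, hM⟩ := antitone_bdd_const (fun i => (k (r i) : ℤ))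
        (fun n => by exact_mod_cast hinc n) 0 (fun n => by positivity)
      refine ⟨M, k (r M), fun i => ?_⟩
      induction i with
      | zero => rfl
      | succ i ih =>
        have := hM (M + i) (by omega)
        rw [← ih]; exact_mod_cast this
  have hrI : ∀ i, r (I + i) = r I + (K + 1) * i := by
    intro i
    induction i with
    | zero => rfl
    | succ i ih =>
      rw [← add_assoc, hrs, hI, ih]; ring
  have hP : ∀ i s, s ≤ K → (P (r I + (K + 1) * i + s) ↔ s ≠ 0) := by
    intro i s hs
    rw [← hrI]
    cases s with
    | zero => simpa using hr _
    | succ s =>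
      refine iff_of_true ?_ (by simp)
      have := hk2 (r (I + i)) s (by rw [hI]; omega)
      rwa [add_assoc, add_comm 1 s] at this
  refine ⟨r I, K + 1, by omega, fun n hn => ?_⟩
  obtain ⟨m, rfl⟩ := Nat.exists_eq_add_of_le hn
  have hmod := Nat.mod_lt m (show 0 < K + 1 by omega)
  have hd := Nat.div_add_mod m (K + 1)
  have e1 := hP (m / (K + 1)) (m % (K + 1)) (by omega)
  have e2 := hP (m / (K + 1) + 1) (m % (K + 1)) (by omega)
  rw [add_assoc, hd] at e1
  have : r I + (K + 1) * (m / (K + 1) + 1) + m % (K + 1) = r I + m + (K + 1) := by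
    conv_rhs => rw [← hd]
    ring
  rw [this] at e2
  rw [e1, e2]

open Classical in
/-- Indicator of the upper piece. -/
noncomputable def chi (P : ℕ → Prop) (n : ℕ) : ℤ := if P n then 0 else 1

/-- Number of visits to the upper piece during `n` steps starting at time `s`. -/
noncomputable def cnt (P : ℕ → Prop) (s : ℕ) : ℕ → ℤ
  | 0 => 0
  | n + 1 => cnt P s n + chi P (s + n)

theorem cnt_add (P : ℕ → Prop) (s a b : ℕ) : cnt P s (a + b) = cnt P s a + cnt P (s + a) b := by
  induction b with
  | zero => simp [cnt]
  | succ b ih => rw [← add_assoc, cnt, ih, cnt, add_assoc s a b]; ring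

/-- Orbit of an order preserving circle map. -/
structure CircleOrbit (x : ℕ → ℚ) (P : ℕ → Prop) : Prop where
  nonneg : ∀ n, 0 ≤ x n
  lt_one : ∀ n, x n < 1
  h1 : ∀ n m, P n → ¬ P m → x n < x m
  inc : ∀ n m, (P n ↔ P m) → x n < x m → x (n + 1) < x (m + 1)
  h4 : ∀ n m, P n → ¬ P m → x (m + 1) < x (n + 1)
  heq : ∀ n m, x n = x m → x (n + 1) = x (m + 1)

namespace CircleOrbit

variable {x : ℕ → ℚ} {P : ℕ → Prop}

theorem chi_cases (P : ℕ → Prop) (n : ℕ) : (P n ∧ chi P n = 0) ∨ (¬ P n ∧ chi P n = 1) := by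
  unfold chi; by_cases h : P n <;> simp [h]

theorem diff_nonneg (C : CircleOrbit x P) {n m : ℕ} {d : ℤ} (h : x n ≤ x m + d) : 0 ≤ d := by
  have h1 := C.nonneg n
  have h2 := C.lt_one m
  have : (-1 : ℚ) < d := by linarith
  have : (-1 : ℤ) < d := by exact_mod_cast this
  omega

theorem step (C : CircleOrbit x P) (n m : ℕ) (d : ℤ) (h : x n ≤ x m + d) :
    x (n + 1) + chi P n ≤ x (m + 1) + chi P m + d := by
  have hd := C.diff_nonneg h
  have a1 := C.nonneg (n + 1)
  have a2 := C.lt_one (n + 1)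
  have a3 := C.nonneg (m + 1)
  have a4 := C.lt_one (m + 1)
  rcases eq_or_lt_of_le hd with rfl | hd
  · simp only [Int.cast_zero, add_zero] at h ⊢
    rcases h.lt_or_eq with h | h
    · rcases chi_cases P n with ⟨hn, e1⟩ | ⟨hn, e1⟩ <;> rcases chi_cases P m with ⟨hm, e2⟩ | ⟨hm, e2⟩ <;>
        rw [e1, e2] <;> push_cast
      · linarith [C.inc n m (by tauto) h]
      · linarith
      · linarith [C.h1 _ _ hm hn]
      · linarith [C.inc n m (by tauto) h]
    · have h' := C.heq _ _ h
      have : P n ↔ P m := by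
        by_contra hne
        rcases (show (P n ∧ ¬ P m) ∨ (P m ∧ ¬ P n) by tauto) with hh | hh
        · linarith [C.h1 _ _ hh.1 hh.2]
        · linarith [C.h1 _ _ hh.1 hh.2]
      have : chi P n = chi P m := by
        unfold chi; by_cases hn : P n
        · rw [if_pos hn, if_pos (this.1 hn)]
        · rw [if_neg hn, if_neg (fun h => hn (this.2 h))]
      rw [h', this]
  · have hd' : (1 : ℚ) ≤ d := by exact_mod_cast hd
    rcases chi_cases P n with ⟨hn, e1⟩ | ⟨hn, e1⟩ <;> rcases chi_cases P m with ⟨hm, e2⟩ | ⟨hm, e2⟩ <;>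
        rw [e1, e2] <;> push_cast
    · linarith
    · linarith
    · linarith [C.h4 _ _ hm hn]
    · linarith

theorem iter (C : CircleOrbit x P) (s s' : ℕ) (d : ℤ) (h : x s ≤ x s' + d) (n : ℕ) :
    x (s + n) ≤ x (s' + n) + (cnt P s' n - cnt P s n + d : ℤ) := by
  induction n with
  | zero => simpa [cnt] using h
  | succ n ih =>
    have := C.step _ _ _ ih
    simp only [cnt]
    push_cast at this ⊢
    rw [← add_assoc s, ← add_assoc s']
    linarith

theorem cnt_le (C : CircleOrbit x P) (s s' n : ℕ) : cnt P s n ≤ cnt P s' n + 1 := by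
  have h := C.iter s s' 1 (by push_cast; linarith [C.lt_one s, C.nonneg s']) n
  have := C.diff_nonneg h
  linarith

theorem evPer (C : CircleOrbit x P) (q : ℕ) (hq : 0 < q) (p : ℤ)
    (h : ∀ n : ℕ, |cnt P 0 (q * n) - p * n| ≤ 1) : EvPer P := by
  apply evPer_of_residues P q hq
  intro r _
  let e : ℕ → ℤ := fun m => cnt P r (q * m) - p * m
  let g : ℕ → ℤ := fun m => 2 * e m + chi P (r + q * m)
  have he : ∀ m, e (m + 1) = e m + cnt P (r + q * m) q - p := by
    intro m
    simp only [e]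
    rw [mul_add, mul_one, cnt_add]; push_cast; ring
  have hchi : ∀ n, 0 ≤ chi P n ∧ chi P n ≤ 1 := by
    intro n; rcases chi_cases P n with h | h <;> omega
  have heb : ∀ m, -2 ≤ e m ∧ e m ≤ 2 := by
    intro m
    have a1 := C.cnt_le r 0 (q * m)
    have a2 := C.cnt_le 0 r (q * m)
    have a3 := abs_le.1 (h m)
    simp only [e]
    constructor <;> linarith [a3.1, a3.2]
  have hmono : ∀ n m (d : ℤ), x n ≤ x m + d → chi P n ≤ chi P m + 2 * d := by
    intro n m d hd
    have h0 := C.diff_nonneg hd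
    rcases eq_or_lt_of_le h0 with rfl | h0
    · simp only [Int.cast_zero, add_zero] at hd
      rcases chi_cases P n with ⟨hn, e1⟩ | ⟨hn, e1⟩ <;>
        rcases chi_cases P m with ⟨hm, e2⟩ | ⟨hm, e2⟩ <;> rw [e1, e2] <;> norm_num
      linarith [C.h1 _ _ hm hn]
    · have := hchi n; have := hchi m; omega
  have hfin : (∃ M, ∀ m ≥ M, g (m + 1) = g m) → ∃ M, ∀ m ≥ M,
      (P (r + q * (m + 1)) ↔ P (r + q * m)) := by
    rintro ⟨M, hM⟩
    refine ⟨M, fun m hm => ?_⟩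
    have := hM m hm
    simp only [g] at this
    rcases chi_cases P (r + q * (m + 1)) with ⟨hn, e1⟩ | ⟨hn, e1⟩ <;>
      rcases chi_cases P (r + q * m) with ⟨hm, e2⟩ | ⟨hm, e2⟩ <;>
      first | tauto | (exfalso; omega)
  apply hfin
  rcases le_total (x r) (x (r + q) + (cnt P r q - p : ℤ)) with hr | hr
  · have key : ∀ m, x (r + q * m) ≤ x (r + q * (m + 1)) + (cnt P (r + q * m) q - p : ℤ) := by
      intro m
      induction m with
      | zero => simpa using hr
      | succ m ih =>
        have := C.iter _ _ _ ih q
        rw [add_assoc, add_assoc r] at this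
        rw [show q * (m + 1 + 1) = q * (m + 1) + q by ring]
        rw [show q * (m + 1) = q * m + q by ring] at this ⊢
        push_cast at this ⊢
        linarith
    apply mono_bdd_const g _ 5
    · intro m; have := heb m; have := hchi (r + q * m); simp only [g]; omega
    · intro m
      have a1 := hmono _ _ _ (key m)
      have a2 := he m
      simp only [g]; omega
  · have key : ∀ m, x (r + q * (m + 1)) ≤ x (r + q * m) + (p - cnt P (r + q * m) q : ℤ) := by
      intro m
      induction m with
      | zero => simp at hr ⊢; linarith
      | succ m ih =>
        have := C.iter _ _ _ ih q
        rw [add_assoc, add_assoc r] at this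
        rw [show q * (m + 1 + 1) = q * (m + 1) + q by ring]
        rw [show q * (m + 1) = q * m + q by ring] at this ⊢
        push_cast at this ⊢
        linarith
    apply antitone_bdd_const g _ (-4)
    · intro m; have := heb m; have := hchi (r + q * m); simp only [g]; omega
    · intro m
      have a1 := hmono _ _ _ (key m)
      have a2 := he m
      simp only [g]; omega

end CircleOrbit

/-- Orbit of a two piece affine map. -/
structure PamOrbit (a1 b1 a2 b2 c : ℚ) (x : ℕ → ℚ) : Prop where
  nonneg : ∀ n, 0 ≤ x n
  lt_one : ∀ n, x n < 1
  ha1 : a1 ≠ 0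
  ha2 : a2 ≠ 0
  lo : ∀ n, x n < c → x (n + 1) = a1 * x n + b1
  hi : ∀ n, ¬ x n < c → x (n + 1) = a2 * x n + b2

theorem val_affine_low (p : ℕ) [Fact p.Prime] (a b y : ℚ) (ha : a ≠ 0) (E : ℤ)
    (hE : padicValRat p a ≤ E) (hE0 : 0 ≤ E)
    (h0 : padicValRat p y + E < 0) (hb : padicValRat p y + E < padicValRat p b) :
    padicValRat p (a * y + b) = padicValRat p y + padicValRat p a := by
  have hy : y ≠ 0 := by
    rintro rfl
    simp at h0
    omega
  have hay : padicValRat p (a * y) = padicValRat p a + padicValRat p y := padicValRat.mul ha hy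
  by_cases hb0 : b = 0
  · rw [hb0, add_zero, hay, add_comm]
  · have hne : a * y + b ≠ 0 := by
      intro h
      have : a * y = - b := by linarith
      rw [this, padicValRat.neg] at hay
      omega
    rw [padicValRat.add_eq_of_lt hne (mul_ne_zero ha hy) hb0 (by omega), hay, add_comm]

theorem val_affine_ge (p : ℕ) [Fact p.Prime] (a b y : ℚ) (ha : a ≠ 0) (E T : ℤ)
    (hE : -E ≤ padicValRat p a) (hE0 : 0 ≤ E) (hT0 : T ≤ 0) (hTb : T ≤ padicValRat p b)
    (h : T ≤ padicValRat p y) : T - E ≤ padicValRat p (a * y + b) := by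
  by_cases hne : a * y + b = 0
  · rw [hne]; simp; omega
  by_cases hy : y = 0
  · rw [hy]; simp; omega
  have hay : padicValRat p (a * y) = padicValRat p a + padicValRat p y := padicValRat.mul ha hy
  have := padicValRat.min_le_padicValRat_add (p := p) hne
  rw [hay] at this
  omega

namespace PamOrbit

variable {a1 b1 a2 b2 c : ℚ} {x : ℕ → ℚ}

/-- exact evolution of the valuation along a block where it is very negative -/
theorem val_block (O : PamOrbit a1 b1 a2 b2 c x) (p : ℕ) [Fact p.Prime] (E : ℤ)
    (hE : E = |padicValRat p a1| + |padicValRat p a2|) (s n : ℕ)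
    (h : ∀ i < n, padicValRat p (x (s + i)) + E < 0 ∧
      padicValRat p (x (s + i)) + E < padicValRat p b1 ∧
      padicValRat p (x (s + i)) + E < padicValRat p b2) :
    padicValRat p (x (s + n)) = padicValRat p (x s) + (n * padicValRat p a1 +
      cnt (fun n => x n < c) s n * (padicValRat p a2 - padicValRat p a1)) := by
  induction n with
  | zero => simp [cnt]
  | succ n ih =>
    have ih := ih (fun i hi => h i (by omega))
    obtain ⟨e1, e2, e3⟩ := h n (by omega)
    have q1 := le_abs_self (padicValRat p a1)
    have q2 := le_abs_self (padicValRat p a2)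
    have q3 := abs_nonneg (padicValRat p a1)
    have q4 := abs_nonneg (padicValRat p a2)
    rw [← add_assoc]
    simp only [cnt]
    rcases CircleOrbit.chi_cases (fun n => x n < c) (s + n) with ⟨hn, e⟩ | ⟨hn, e⟩
    · rw [e, O.lo _ hn, val_affine_low p a1 b1 _ O.ha1 E (by omega) (by omega) e1 e2, ih]
      push_cast; ring
    · rw [e, O.hi _ hn, val_affine_low p a2 b2 _ O.ha2 E (by omega) (by omega) e1 e3, ih]
      push_cast; ring

theorem cnt_bounds (P : ℕ → Prop) (s n : ℕ) : 0 ≤ cnt P s n ∧ cnt P s n ≤ n := by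
  induction n with
  | zero => simp [cnt]
  | succ n ih =>
    simp only [cnt]
    rcases CircleOrbit.chi_cases P (s + n) with ⟨hn, e⟩ | ⟨hn, e⟩ <;> push_cast <;> omega

theorem block_le (v1 v2 J n E : ℤ) (h0 : 0 ≤ J) (h1 : J ≤ n) (hE : E = |v1| + |v2|) :
    n * v1 + J * (v2 - v1) ≤ n * E := by
  have q1 := le_abs_self v1
  have q2 := le_abs_self v2
  have q3 := abs_nonneg v1
  have q4 := abs_nonneg v2
  have e1 : (n - J) * v1 ≤ (n - J) * E := mul_le_mul_of_nonneg_left (by omega) (by omega)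
  have e2 : J * v2 ≤ J * E := mul_le_mul_of_nonneg_left (by omega) (by omega)
  linarith

theorem abs_diff_mul (J J' d : ℤ) (h1 : J ≤ J' + 1) (h2 : J' ≤ J + 1) :
    J * d ≤ J' * d + |d| := by
  have : |(J - J') * d| ≤ 1 * |d| := by
    rw [abs_mul]
    exact mul_le_mul_of_nonneg_right (abs_le.2 ⟨by omega, by omega⟩) (abs_nonneg _)
  have := le_abs_self ((J - J') * d)
  linarith

theorem certB_sound (O : PamOrbit a1 b1 a2 b2 c x) (C : CircleOrbit x (fun n => x n < c))
    (p : ℕ) [Fact p.Prime] (t : ℚ) (n N : ℕ) (E : ℤ)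
    (hE : E = |padicValRat p a1| + |padicValRat p a2|)
    (hn : n * padicValRat p a1 + cnt (fun n => x n < c) 0 n * (padicValRat p a2 - padicValRat p a1)
      + |padicValRat p a2 - padicValRat p a1| < 0)
    (h0 : padicValRat p (x N) + n * E + E < 0)
    (h1 : padicValRat p (x N) + n * E + E < padicValRat p b1)
    (h2 : padicValRat p (x N) + n * E + E < padicValRat p b2)
    (ht : padicValRat p (x N) + n * E + E < padicValRat p t) (k : ℕ) : x (N + k) ≠ t := by
  have hE0 : 0 ≤ E := by
    have q3 := abs_nonneg (padicValRat p a1)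
    have q4 := abs_nonneg (padicValRat p a2)
    omega
  have hn0 : 0 < n := by
    rcases Nat.eq_zero_or_pos n with h | h
    · subst h
      simp [cnt] at hn
      exact absurd hn (not_lt.2 (abs_nonneg _))
    · exact h
  have inner : ∀ s, padicValRat p (x s) ≤ padicValRat p (x N) → ∀ i ≤ n,
      padicValRat p (x (s + i)) ≤ padicValRat p (x N) + n * E ∧
      padicValRat p (x (s + i)) = padicValRat p (x s) + (i * padicValRat p a1 +
      cnt (fun n => x n < c) s i * (padicValRat p a2 - padicValRat p a1)) := by
    intro s hs i
    induction i using Nat.strong_induction_on with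
    | _ i ih =>
      intro hi
      have := O.val_block p E hE s i (fun j hj => by
        have := (ih j hj (by omega)).1
        refine ⟨?_, ?_, ?_⟩ <;> omega)
      refine ⟨?_, this⟩
      rw [this]
      have hb := cnt_bounds (fun n => x n < c) s i
      have := block_le (padicValRat p a1) (padicValRat p a2) _ i E hb.1 hb.2 hE
      have h3 : (i : ℤ) * E ≤ n * E := mul_le_mul_of_nonneg_right (by exact_mod_cast hi) hE0
      linarith
  have outer : ∀ m, padicValRat p (x (N + n * m)) ≤ padicValRat p (x N) := by
    intro m
    induction m with
    | zero => simp
    | succ m ih =>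
      have := (inner _ ih n le_rfl).2
      rw [mul_add, mul_one, ← add_assoc, this]
      have := abs_diff_mul _ _ (padicValRat p a2 - padicValRat p a1)
        (C.cnt_le (N + n * m) 0 n) (C.cnt_le 0 (N + n * m) n)
      linarith
  have := (inner _ (outer (k / n)) (k % n) (Nat.mod_lt _ hn0).le).1
  rw [add_assoc, Nat.div_add_mod] at this
  intro heq
  rw [heq] at this
  omega

theorem bdd_below (O : PamOrbit a1 b1 a2 b2 c x)
    (p : ℕ) [Fact p.Prime] (n : ℕ) (hn0 : 0 < n)
    (hn : ∀ s, 0 ≤ n * padicValRat p a1 +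
      cnt (fun n => x n < c) s n * (padicValRat p a2 - padicValRat p a1)) :
    ∃ B : ℤ, ∀ k, B ≤ padicValRat p (x k) := by
  obtain ⟨E, hE⟩ : ∃ E, E = |padicValRat p a1| + |padicValRat p a2| := ⟨_, rfl⟩
  have q1 := le_abs_self (padicValRat p a1)
  have q2 := le_abs_self (padicValRat p a2)
  have q1' := neg_abs_le (padicValRat p a1)
  have q2' := neg_abs_le (padicValRat p a2)
  have q3 := abs_nonneg (padicValRat p a1)
  have q4 := abs_nonneg (padicValRat p a2)
  obtain ⟨T, hT⟩ : ∃ T, T = min 0 (min (padicValRat p b1) (padicValRat p b2)) - E := ⟨_, rfl⟩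
  obtain ⟨u, hu⟩ : ∃ u : ℕ → ℤ, ∀ k, u k = min (padicValRat p (x k)) T := ⟨_, fun _ => rfl⟩
  have hlow : ∀ k, padicValRat p (x k) < T → padicValRat p (x k) + E < 0 ∧
      padicValRat p (x k) + E < padicValRat p b1 ∧ padicValRat p (x k) + E < padicValRat p b2 := by
    intro k hk; omega
  have hstep : ∀ k, u k - E ≤ u (k + 1) := by
    intro k
    by_cases hk : padicValRat p (x k) < T
    · obtain ⟨e1, e2, e3⟩ := hlow k hk
      have : padicValRat p (x k) - E ≤ padicValRat p (x (k + 1)) := by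
        by_cases hc : x k < c
        · rw [O.lo _ hc, val_affine_low p a1 b1 _ O.ha1 E (by omega) (by omega) e1 e2]; omega
        · rw [O.hi _ hc, val_affine_low p a2 b2 _ O.ha2 E (by omega) (by omega) e1 e3]; omega
      rw [hu, hu]; omega
    · have : T - E ≤ padicValRat p (x (k + 1)) := by
        by_cases hc : x k < c
        · rw [O.lo _ hc]
          exact val_affine_ge p a1 b1 _ O.ha1 E T (by omega) (by omega) (by omega) (by omega)
            (by omega)
        · rw [O.hi _ hc]
          exact val_affine_ge p a2 b2 _ O.ha2 E T (by omega) (by omega) (by omega) (by omega)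
            (by omega)
      rw [hu, hu]; omega
  have hE0 : 0 ≤ E := by omega
  have hlip : ∀ k i, u k - i * E ≤ u (k + i) := by
    intro k i
    induction i with
    | zero => simp
    | succ i ih =>
      have := hstep (k + i)
      rw [← add_assoc]; push_cast; linarith
  have hlip' : ∀ k i, i ≤ n → u k - n * E ≤ u (k + i) := by
    intro k i hi
    have h3 : (i : ℤ) * E ≤ n * E := mul_le_mul_of_nonneg_right (by exact_mod_cast hi) hE0
    linarith [hlip k i]
  have hu0 : ∀ k, u k ≤ T := fun k => by rw [hu]; omega
  refine ⟨u 0 - n * E, fun k => ?_⟩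
  have main : ∀ k, u 0 - n * E ≤ u k := by
    intro k
    induction k using Nat.strong_induction_on with
    | _ k ih =>
      rcases lt_or_ge k n with hk | hk
      · have := hlip' 0 k hk.le
        rwa [zero_add] at this
      · obtain ⟨s, rfl⟩ := Nat.exists_eq_add_of_le' hk
        by_cases hall : ∀ i < n, padicValRat p (x (s + i)) < T
        · have h1 := O.val_block p E hE s n (fun i hi => hlow _ (hall i hi))
          have h2 := hn s
          have h3 := ih s (by omega)
          have h4 : u s ≤ u (s + n) := by rw [hu, hu, h1]; omega
          linarith
        · push Not at hall
          obtain ⟨i, hi, hT'⟩ := hall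
          have h1 := hlip' (s + i) (n - i) (by omega)
          rw [show s + i + (n - i) = s + n by omega] at h1
          have h2 : u (s + i) = T := by rw [hu]; omega
          have h3 := hu0 0
          linarith
  have := main k
  rw [hu k] at this
  omega

end PamOrbit

namespace PamOrbit

variable {a1 b1 a2 b2 c : ℚ} {x : ℕ → ℚ}

theorem affine_den (a b y : ℚ) : (a * y + b).den ∣ a.den * y.den * b.den :=
  (Rat.add_den_dvd _ _).trans (Nat.mul_dvd_mul_right (Rat.mul_den_dvd _ _) _)

theorem exists_prime (O : PamOrbit a1 b1 a2 b2 c x) (hinj : Function.Injective x) :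
    ∃ p : ℕ, p.Prime ∧ ∀ B : ℤ, ∃ k, padicValRat p (x k) < B := by
  by_contra hcon
  push Not at hcon
  choose! B hB using hcon
  obtain ⟨K, hK⟩ : ∃ K, K = a1.den * b1.den * a2.den * b2.den * (x 0).den := ⟨_, rfl⟩
  have hK0 : K ≠ 0 := by rw [hK]; simp
  have hpK : ∀ p : ℕ, p.Prime → ∀ n, p ∣ (x n).den → p ∣ K := by
    intro p hp n
    induction n with
    | zero => intro h; rw [hK]; exact h.mul_left _
    | succ n ih =>
      intro h
      have d1 : a1.den ∣ K := ⟨b1.den * a2.den * b2.den * (x 0).den, by rw [hK]; ring⟩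
      have d2 : b1.den ∣ K := ⟨a1.den * a2.den * b2.den * (x 0).den, by rw [hK]; ring⟩
      have d3 : a2.den ∣ K := ⟨a1.den * b1.den * b2.den * (x 0).den, by rw [hK]; ring⟩
      have d4 : b2.den ∣ K := ⟨a1.den * b1.den * a2.den * (x 0).den, by rw [hK]; ring⟩
      by_cases hc : x n < c
      · rw [O.lo n hc] at h
        have := h.trans (affine_den _ _ _)
        rw [hp.dvd_mul, hp.dvd_mul] at this
        rcases this with (h | h) | h
        · exact h.trans d1
        · exact ih h
        · exact h.trans d2
      · rw [O.hi n hc] at h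
        have := h.trans (affine_den _ _ _)
        rw [hp.dvd_mul, hp.dvd_mul] at this
        rcases this with (h | h) | h
        · exact h.trans d3
        · exact ih h
        · exact h.trans d4
  obtain ⟨M, hM⟩ : ∃ M, M = ∏ p ∈ K.primeFactors, p ^ (B p).natAbs := ⟨_, rfl⟩
  have hM0 : M ≠ 0 := by
    rw [hM, Finset.prod_ne_zero_iff]
    intro p hp
    exact pow_ne_zero _ (Nat.prime_of_mem_primeFactors hp).ne_zero
  have hden : ∀ n, (x n).den ∣ M := by
    intro n
    have h0 : (x n).den ≠ 0 := (x n).den_nz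
    have e : (x n).den = ∏ p ∈ (x n).den.primeFactors, p ^ (x n).den.factorization p := by
      conv_lhs => rw [← Nat.prod_factorization_pow_eq_self h0]
      rfl
    rw [e, hM]
    refine (Finset.prod_dvd_prod_of_dvd _ (fun p => p ^ (B p).natAbs) ?_).trans
      (Finset.prod_dvd_prod_of_subset _ _ _ ?_)
    · intro p hp
      have hpp := Nat.prime_of_mem_primeFactors hp
      have hd := Nat.dvd_of_mem_primeFactors hp
      apply pow_dvd_pow
      haveI := Fact.mk hpp
      have h1 := hB p hpp n
      have h2 : ¬ (p : ℤ) ∣ (x n).num := by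
        intro h
        have h' : p ∣ (x n).num.natAbs := Int.natCast_dvd.1 h
        exact Nat.not_coprime_of_dvd_of_dvd hpp.one_lt h' hd (x n).reduced
      have h3 : padicValRat p (x n) = - (padicValNat p (x n).den : ℤ) := by
        rw [padicValRat, padicValInt.eq_zero_of_not_dvd h2]; simp
      rw [Nat.factorization_def _ hpp]
      omega
    · intro p hp
      have hpp := Nat.prime_of_mem_primeFactors hp
      exact Nat.mem_primeFactors.2 ⟨hpp, hpK p hpp n (Nat.dvd_of_mem_primeFactors hp), hK0⟩
  have hsub : Set.range x ⊆ ((Finset.range M).image (fun k : ℕ => (k : ℚ) / M) : Finset ℚ) := by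
    rintro _ ⟨n, rfl⟩
    obtain ⟨d, hd⟩ := hden n
    have hnum : 0 ≤ (x n).num := Rat.num_nonneg.2 (O.nonneg n)
    have hd0 : d ≠ 0 := by rintro rfl; simp at hd; exact hM0 hd
    have hx : x n = (((x n).num.toNat * d : ℕ) : ℚ) / M := by
      have h1 : (((x n).num.toNat : ℕ) : ℚ) = (x n).num := by
        have : (((x n).num.toNat : ℕ) : ℤ) = (x n).num := Int.toNat_of_nonneg hnum
        exact_mod_cast this
      have h2 : (d : ℚ) ≠ 0 := by exact_mod_cast hd0
      rw [hd]
      push_cast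
      rw [h1, mul_div_mul_right _ _ h2]
      exact (Rat.num_div_den _).symm
    simp only [Finset.coe_image, Set.mem_image, Finset.coe_range, Set.mem_Iio]
    refine ⟨(x n).num.toNat * d, ?_, hx.symm⟩
    have h1 := O.lt_one n
    rw [hx, div_lt_one (by positivity)] at h1
    exact_mod_cast h1
  exact (Set.infinite_range_of_injective hinj) ((Finset.finite_toSet _).subset hsub)

theorem certB_complete (O : PamOrbit a1 b1 a2 b2 c x) (C : CircleOrbit x (fun n => x n < c))
    (hinj : Function.Injective x) (hper : ¬ EvPer (fun n => x n < c)) (t : ℚ) :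
    ∃ p n N : ℕ, p.Prime ∧ ∀ E : ℤ, E = |padicValRat p a1| + |padicValRat p a2| →
      n * padicValRat p a1 + cnt (fun n => x n < c) 0 n * (padicValRat p a2 - padicValRat p a1)
      + |padicValRat p a2 - padicValRat p a1| < 0 ∧
      padicValRat p (x N) + n * E + E < 0 ∧
      padicValRat p (x N) + n * E + E < padicValRat p b1 ∧
      padicValRat p (x N) + n * E + E < padicValRat p b2 ∧
      padicValRat p (x N) + n * E + E < padicValRat p t := by
  obtain ⟨p, hp, hunb⟩ := O.exists_prime hinj
  haveI := Fact.mk hp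
  by_cases h1 : ∃ n : ℕ, n * padicValRat p a1 +
      cnt (fun n => x n < c) 0 n * (padicValRat p a2 - padicValRat p a1)
      + |padicValRat p a2 - padicValRat p a1| < 0
  · obtain ⟨n, hn⟩ := h1
    obtain ⟨N, hN⟩ := hunb (min (min 0 (padicValRat p b1)) (min (padicValRat p b2) (padicValRat p t))
      - n * (|padicValRat p a1| + |padicValRat p a2|) - (|padicValRat p a1| + |padicValRat p a2|))
    refine ⟨p, n, N, hp, ?_⟩
    rintro E rfl
    refine ⟨hn, ?_, ?_, ?_, ?_⟩ <;> omega
  push Not at h1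
  exfalso
  by_cases h2 : ∃ n : ℕ, 0 < n ∧ 0 ≤ n * padicValRat p a1 +
      cnt (fun n => x n < c) 0 n * (padicValRat p a2 - padicValRat p a1)
      - |padicValRat p a2 - padicValRat p a1|
  · obtain ⟨n, hn0, hn⟩ := h2
    obtain ⟨B, hB⟩ := O.bdd_below p n hn0 (fun s => by
      have := abs_diff_mul _ _ (padicValRat p a2 - padicValRat p a1)
        (C.cnt_le 0 s n) (C.cnt_le s 0 n)
      linarith)
    obtain ⟨k, hk⟩ := hunb B
    exact absurd (hB k) (not_le.2 hk)
  push Not at h2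
  apply hper
  generalize padicValRat p a2 - padicValRat p a1 = δ at h1 h2
  generalize padicValRat p a1 = v1 at h1 h2
  have hδ : δ ≠ 0 := by
    rintro rfl
    have e1 := h1 1
    have e2 := h2 1 one_pos
    simp at e1 e2
    omega
  have hδ' : 0 < δ.natAbs := by omega
  refine C.evPer δ.natAbs hδ' (- v1 * δ.sign) (fun n => ?_)
  have e1 := h1 (δ.natAbs * n)
  have hs : δ.sign * δ = |δ| := by rw [mul_comm]; exact Int.mul_sign_self δ ▸ Int.natCast_natAbs δ
  have habs : ((δ.natAbs : ℕ) : ℤ) = |δ| := Int.natCast_natAbs δ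
  have e2 : (↑(δ.natAbs * n) : ℤ) * v1 + cnt (fun n => x n < c) 0 (δ.natAbs * n) * δ ≤ |δ| := by
    rcases Nat.eq_zero_or_pos n with rfl | hn
    · simp [cnt]
    · have := h2 (δ.natAbs * n) (by positivity)
      linarith
  generalize cnt (fun n => x n < c) 0 (δ.natAbs * n) = J at *
  push_cast at e1 e2
  have hpos : 0 < |δ| := abs_pos.2 hδ
  have key : |(J - -v1 * δ.sign * n) * δ| ≤ |δ| := by
    have : (J - -v1 * δ.sign * n) * δ = J * δ + v1 * (δ.sign * δ) * n := by ring
    rw [this, hs, abs_le]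
    constructor <;> linarith
  rw [abs_mul] at key
  by_contra hlt
  push Not at hlt
  have : 2 * |δ| ≤ |J - -v1 * δ.sign * n| * |δ| :=
    mul_le_mul_of_nonneg_right (by omega) hpos.le
  linarith

end PamOrbit

/-- Shadow orbit of `y` following the itinerary of `x` from time `N`. -/
def shad (a1 b1 a2 b2 c : ℚ) (x : ℕ → ℚ) (N : ℕ) (y : ℚ) : ℕ → ℚ
  | 0 => y
  | k + 1 => if x (N + k) < c then a1 * shad a1 b1 a2 b2 c x N y k + b1
      else a2 * shad a1 b1 a2 b2 c x N y k + b2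

/-- Certificate of non-reachability through an attracting cycle. -/
def CertA (a1 b1 a2 b2 c : ℚ) (x : ℕ → ℚ) (t : ℚ) (N q : ℕ) (y : ℚ) : Prop :=
  0 < q ∧ shad a1 b1 a2 b2 c x N y q = y ∧
  (∀ k < q, (x (N + k) < c → 0 ≤ shad a1 b1 a2 b2 c x N y k ∧ shad a1 b1 a2 b2 c x N y k ≤ c) ∧
    (¬ x (N + k) < c → c ≤ shad a1 b1 a2 b2 c x N y k ∧ shad a1 b1 a2 b2 c x N y k ≤ 1) ∧
    ((t = shad a1 b1 a2 b2 c x N y k ∧ x (N + k) ≠ shad a1 b1 a2 b2 c x N y k) ∨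
      |x (N + k) - shad a1 b1 a2 b2 c x N y k| < |t - shad a1 b1 a2 b2 c x N y k|)) ∧
  ((0 < x (N + q) - y ∧ x (N + q) - y < x N - y) ∨
    (0 < y - x (N + q) ∧ y - x (N + q) < y - x N) ∨ x N = y)

namespace PamOrbit

variable {a1 b1 a2 b2 c : ℚ} {x : ℕ → ℚ}

theorem certA_sound (O : PamOrbit a1 b1 a2 b2 c x) (t : ℚ) (N q : ℕ) (y : ℚ)
    (h : CertA a1 b1 a2 b2 c x t N q y) (k : ℕ) : x (N + k) ≠ t := by
  obtain ⟨hq, hcyc, hk, hend⟩ := h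
  set Y := shad a1 b1 a2 b2 c x N y with hY
  have hYs : ∀ k, Y (k + 1) = if x (N + k) < c then a1 * Y k + b1 else a2 * Y k + b2 :=
    fun k => rfl
  have hY0 : Y 0 = y := rfl
  have inner : ∀ s (w : ℚ), 0 < w → w ≤ 1 → x s - y = w * (x N - y) → ∀ k ≤ q,
      x (s + k) - Y k = w * (x (N + k) - Y k) := by
    intro s w hw hw1 hs k
    induction k with
    | zero => intro _; simpa [hY0] using hs
    | succ k ih =>
      intro hkq
      have ih := ih (by omega)
      obtain ⟨p1, p2, -⟩ := hk k (by omega)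
      have e : x (s + k) = (1 - w) * Y k + w * x (N + k) := by linarith
      rw [hYs, ← add_assoc, ← add_assoc]
      by_cases hc : x (N + k) < c
      · have hc' : x (s + k) < c := by
          rw [e]
          have := (p1 hc).2
          nlinarith [mul_le_mul_of_nonneg_left this (show 0 ≤ 1 - w by linarith),
            mul_lt_mul_of_pos_left hc hw]
        rw [if_pos hc, O.lo _ hc, O.lo _ hc']
        linear_combination a1 * ih
      · have hc' : ¬ x (s + k) < c := by
          rw [e]
          have := (p2 hc).1
          push Not at hc ⊢
          nlinarith [mul_le_mul_of_nonneg_left this (show 0 ≤ 1 - w by linarith),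
            mul_le_mul_of_nonneg_left hc hw.le]
        rw [if_neg hc, O.hi _ hc, O.hi _ hc']
        linear_combination a2 * ih
  obtain ⟨α, hα0, hα1, hα⟩ : ∃ α : ℚ, 0 < α ∧ α ≤ 1 ∧ x (N + q) - y = α * (x N - y) := by
    rcases hend with ⟨h1, h2⟩ | ⟨h1, h2⟩ | h1
    · have h3 : 0 < x N - y := by linarith
      refine ⟨(x (N + q) - y) / (x N - y), by positivity, ?_, by field_simp⟩
      rw [div_le_one h3]; exact h2.le
    · have h3 : 0 < y - x N := by linarith
      refine ⟨(y - x (N + q)) / (y - x N), by positivity, ?_, by field_simp; ring⟩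
      rw [div_le_one h3]; exact h2.le
    · refine ⟨1, one_pos, le_rfl, ?_⟩
      have := inner N 1 one_pos le_rfl (by ring) q le_rfl
      have key : ∀ k ≤ q, x (N + k) = Y k := by
        intro k
        induction k with
        | zero => intro _; exact h1
        | succ k ih =>
          intro hk'
          have ih := ih (by omega)
          rw [hYs, ← add_assoc]
          by_cases hc : x (N + k) < c
          · rw [if_pos hc, O.lo _ hc, ih]
          · rw [if_neg hc, O.hi _ hc, ih]
      rw [key q le_rfl, hcyc, h1]; ring
  have outer : ∀ m, ∃ w : ℚ, 0 < w ∧ w ≤ 1 ∧ x (N + q * m) - y = w * (x N - y) := by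
    intro m
    induction m with
    | zero => exact ⟨1, one_pos, le_rfl, by simp⟩
    | succ m ih =>
      obtain ⟨w, hw, hw1, e⟩ := ih
      refine ⟨w * α, by positivity, mul_le_one₀ hw1 hα0.le hα1, ?_⟩
      have := inner _ w hw hw1 e q le_rfl
      rw [hcyc, hα] at this
      rw [mul_add, mul_one, ← add_assoc, this]; ring
  obtain ⟨w, hw, hw1, e⟩ := outer (k / q)
  have hlt := Nat.mod_lt k hq
  have h1 := inner _ w hw hw1 e (k % q) hlt.le
  rw [add_assoc, Nat.div_add_mod] at h1
  obtain ⟨-, -, h3⟩ := hk (k % q) hlt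
  intro heq
  rw [heq] at h1
  rcases h3 with ⟨h3, h4⟩ | h3
  · rw [h3, sub_self] at h1
    rcases mul_eq_zero.1 h1.symm with h | h
    · exact hw.ne' h
    · exact h4 (sub_eq_zero.1 h)
  · rw [h1, abs_mul, abs_of_pos hw] at h3
    have := mul_le_mul_of_nonneg_right hw1 (abs_nonneg (x (N + k % q) - Y (k % q)))
    linarith

theorem shad_affine (O : PamOrbit a1 b1 a2 b2 c x) (N k : ℕ) : ∃ α β : ℚ, α ≠ 0 ∧
    ∀ y, shad a1 b1 a2 b2 c x N y k = α * y + β := by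
  induction k with
  | zero => exact ⟨1, 0, one_ne_zero, fun y => by simp [shad]⟩
  | succ k ih =>
    obtain ⟨α, β, h0, h⟩ := ih
    by_cases hc : x (N + k) < c
    · refine ⟨a1 * α, a1 * β + b1, mul_ne_zero O.ha1 h0, fun y => ?_⟩
      rw [shad, if_pos hc, h]; ring
    · refine ⟨a2 * α, a2 * β + b2, mul_ne_zero O.ha2 h0, fun y => ?_⟩
      rw [shad, if_neg hc, h]; ring

theorem shad_self (O : PamOrbit a1 b1 a2 b2 c x) (N k : ℕ) :
    shad a1 b1 a2 b2 c x N (x N) k = x (N + k) := by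
  induction k with
  | zero => rfl
  | succ k ih =>
    rw [shad, ih, ← add_assoc]
    by_cases hc : x (N + k) < c
    · rw [if_pos hc, O.lo _ hc]
    · rw [if_neg hc, O.hi _ hc]

theorem shad_congr (N N' : ℕ) (y : ℚ) (k : ℕ)
    (h : ∀ i < k, (x (N' + i) < c ↔ x (N + i) < c)) :
    shad a1 b1 a2 b2 c x N' y k = shad a1 b1 a2 b2 c x N y k := by
  induction k with
  | zero => rfl
  | succ k ih =>
    have ih := ih (fun i hi => h i (by omega))
    simp only [shad]
    rw [ih]
    by_cases hc : x (N + k) < c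
    · rw [if_pos hc, if_pos ((h k (by omega)).2 hc)]
    · rw [if_neg hc, if_neg (fun h' => hc ((h k (by omega)).1 h'))]

/-- certificate in the periodic case -/
theorem certA_periodic (O : PamOrbit a1 b1 a2 b2 c x) (hc0 : 0 < c) (hc1 : c < 1) (t : ℚ)
    (ht : ∀ n, x n ≠ t) (N q : ℕ) (hq : 0 < q) (h : x (N + q) = x N) :
    CertA a1 b1 a2 b2 c x t N q (x N) := by
  refine ⟨hq, by rw [O.shad_self, h], fun k hk => ?_, Or.inr (Or.inr rfl)⟩
  rw [O.shad_self]
  refine ⟨fun hc => ⟨O.nonneg _, hc.le⟩, fun hc => ⟨not_lt.1 hc, (O.lt_one _).le⟩, Or.inr ?_⟩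
  rw [sub_self, abs_zero, abs_pos]
  exact sub_ne_zero.2 (ht _).symm

theorem unbdd_pow (α d : ℚ) (hα : 1 < α) (hd : ∀ m : ℕ, |α ^ m * d| ≤ 1) : d = 0 := by
  by_contra hne
  have hpos : 0 < |d| := abs_pos.2 hne
  obtain ⟨m, hm⟩ := pow_unbounded_of_one_lt (1 / |d|) hα
  have := hd m
  rw [abs_mul, abs_of_pos (by positivity)] at this
  rw [div_lt_iff₀ hpos] at hm
  linarith

theorem small_pow (α D e : ℚ) (hα0 : 0 < α) (hα : α < 1) (he : 0 < e) :
    ∀ᶠ m : ℕ in Filter.atTop, α ^ m * |D| < e := by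
  obtain ⟨n, hn⟩ := exists_pow_lt_of_lt_one (show 0 < e / (|D| + 1) by positivity) hα
  refine Filter.eventually_atTop.2 ⟨n, fun m hm => ?_⟩
  have h1 : α ^ m ≤ α ^ n := pow_le_pow_of_le_one hα0.le hα.le hm
  rw [lt_div_iff₀ (by positivity)] at hn
  have h2 : α ^ m * |D| ≤ α ^ n * |D| := mul_le_mul_of_nonneg_right h1 (abs_nonneg _)
  have : 0 < α ^ n := by positivity
  nlinarith

theorem certA_complete (O : PamOrbit a1 b1 a2 b2 c x) (hc0 : 0 < c) (hc1 : c < 1) (t : ℚ)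
    (ht : ∀ n, x n ≠ t) (hper : EvPer (fun n => x n < c)) :
    ∃ N q y, CertA a1 b1 a2 b2 c x t N q y := by
  obtain ⟨N, q, hq, hP⟩ := hper
  -- the itinerary is invariant under shifts by multiples of q
  have hP' : ∀ m n, N ≤ n → (x (n + q * m) < c ↔ x n < c) := by
    intro m n hn
    induction m with
    | zero => simp
    | succ m ih =>
      rw [← ih, mul_add, mul_one, ← add_assoc]
      exact hP _ (by omega)
  obtain ⟨α, β, hα0, hα⟩ := O.shad_affine N (2 * q)
  obtain ⟨α', β', hα0', hα'⟩ := O.shad_affine N q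
  have hshift : ∀ m y k, shad a1 b1 a2 b2 c x (N + q * m) y k = shad a1 b1 a2 b2 c x N y k := by
    intro m y k
    apply shad_congr
    intro i _
    rw [show N + q * m + i = N + i + q * m by ring]
    exact hP' m _ (by omega)
  have hadd : ∀ y k, shad a1 b1 a2 b2 c x N y (q + k) =
      shad a1 b1 a2 b2 c x (N + q) (shad a1 b1 a2 b2 c x N y q) k := by
    intro y k
    induction k with
    | zero => rfl
    | succ k ih => rw [← add_assoc, shad, ih, shad, add_assoc N q k]
  have hαpos : 0 < α := by
    have h1 : ∀ y, α * y + β = α' * (α' * y + β') + β' := by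
      intro y
      rw [← hα, two_mul, hadd, ← hα', ← hα']
      have := hshift 1 (shad a1 b1 a2 b2 c x N y q) q
      rwa [mul_one] at this
    have h2 := h1 0
    have h3 := h1 1
    have : α = α' * α' := by linarith
    rw [this]; exact mul_self_pos.2 hα0'
  obtain ⟨Q, hQ⟩ : ∃ Q, Q = 2 * q := ⟨_, rfl⟩
  have hQ0 : 0 < Q := by omega
  rw [← hQ] at hα
  have hPQ : ∀ m n, N ≤ n → (x (n + Q * m) < c ↔ x n < c) := by
    intro m n hn
    have := hP' (2 * m) n hn
    rwa [show q * (2 * m) = Q * m by rw [hQ]; ring] at this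
  have hshiftQ : ∀ m y k, shad a1 b1 a2 b2 c x (N + Q * m) y k = shad a1 b1 a2 b2 c x N y k := by
    intro m y k
    have := hshift (2 * m) y k
    rwa [show q * (2 * m) = Q * m by rw [hQ]; ring] at this
  have hrec : ∀ m, x (N + Q * (m + 1)) = α * x (N + Q * m) + β := by
    intro m
    rw [← hα, ← hshiftQ m, shad_self O, mul_add, mul_one, add_assoc]
  have hb : ∀ n m, |x n - x m| ≤ 1 := by
    intro n m
    rw [abs_le]
    constructor <;> linarith [O.nonneg n, O.nonneg m, O.lt_one n, O.lt_one m]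
  by_cases hα1 : α = 1
  · -- translation
    have hx : ∀ m : ℕ, x (N + Q * m) = x N + m * β := by
      intro m
      induction m with
      | zero => simp
      | succ m ih => rw [hrec, ih, hα1]; push_cast; ring
    have hβ : β = 0 := by
      by_contra hne
      have hpos : 0 < |β| := abs_pos.2 hne
      obtain ⟨m, hm⟩ := exists_nat_gt (1 / |β|)
      rw [div_lt_iff₀ hpos] at hm
      have h1 := hb (N + Q * m) N
      rw [hx, add_sub_cancel_left, abs_mul, Nat.abs_cast] at h1
      linarith
    refine ⟨N, Q, x N, O.certA_periodic hc0 hc1 t ht N Q hQ0 ?_⟩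
    have := hrec 0
    simpa [hα1, hβ] using this
  obtain ⟨L, hL⟩ : ∃ L, L = α * L + β := by
    refine ⟨β / (1 - α), ?_⟩
    have : 1 - α ≠ 0 := fun h => hα1 (by linarith)
    field_simp
    ring
  have hpow : ∀ m, x (N + Q * m) - L = α ^ m * (x N - L) := by
    intro m
    induction m with
    | zero => simp
    | succ m ih => rw [hrec, pow_succ]; linear_combination α * ih - hL
  by_cases hxL : x N = L
  · refine ⟨N, Q, x N, O.certA_periodic hc0 hc1 t ht N Q hQ0 ?_⟩
    have := hrec 0
    simp only [zero_add, mul_one, mul_zero, add_zero] at this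
    rw [this, hxL, ← hL]
  have hαlt : α < 1 := by
    by_contra hge
    have hgt : 1 < α := lt_of_le_of_ne (not_lt.1 hge) (Ne.symm hα1)
    apply hxL
    have hd : ∀ m, x (N + Q * (m + 1)) - x (N + Q * m) = α ^ m * ((α - 1) * (x N - L)) := by
      intro m
      have e1 := hpow (m + 1)
      have e2 := hpow m
      rw [pow_succ] at e1
      linear_combination e1 - e2
    have := unbdd_pow α ((α - 1) * (x N - L)) hgt (fun m => by rw [← hd]; exact hb _ _)
    rcases mul_eq_zero.1 this with h | h
    · exact absurd (by linarith) hα1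
    · linarith
  -- contracting case
  set Y := shad a1 b1 a2 b2 c x N L with hY
  have hdiff : ∀ k, x (N + k) - Y k ≠ 0 ∧ ∀ m, x (N + Q * m + k) - Y k = α ^ m * (x (N + k) - Y k) := by
    intro k
    obtain ⟨γ, ε, hγ, he⟩ := O.shad_affine N k
    have h1 : ∀ m, x (N + Q * m + k) - Y k = γ * (x (N + Q * m) - L) := by
      intro m
      rw [hY, he, ← O.shad_self (N + Q * m) k, hshiftQ, he]; ring
    have h0 := h1 0
    simp only [mul_zero, add_zero] at h0
    refine ⟨?_, fun m => ?_⟩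
    · rw [h0]; exact mul_ne_zero hγ (sub_ne_zero.2 hxL)
    · rw [h1, h0, hpow]; ring
  have hlim : ∀ k, ∀ e > 0, ∃ m, |x (N + Q * m + k) - Y k| < e := by
    intro k e he
    obtain ⟨m, hm⟩ := (small_pow α (x (N + k) - Y k) e hαpos hαlt he).exists
    refine ⟨m, ?_⟩
    rw [(hdiff k).2, abs_mul, abs_of_pos (by positivity)]
    exact hm
  have hge : ∀ k z, (∀ m, z ≤ x (N + Q * m + k)) → z ≤ Y k := by
    intro k z hz
    by_contra hlt
    push Not at hlt
    obtain ⟨m, hm⟩ := hlim k (z - Y k) (by linarith)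
    have := (abs_lt.1 hm).2
    linarith [hz m]
  have hle : ∀ k z, (∀ m, x (N + Q * m + k) ≤ z) → Y k ≤ z := by
    intro k z hz
    by_contra hlt
    push Not at hlt
    obtain ⟨m, hm⟩ := hlim k (Y k - z) (by linarith)
    have := (abs_lt.1 hm).1
    linarith [hz m]
  have hpiece : ∀ k m, (x (N + Q * m + k) < c ↔ x (N + k) < c) := by
    intro k m
    rw [show N + Q * m + k = N + k + Q * m by ring]
    exact hPQ m _ (by omega)
  have hev : ∀ᶠ m : ℕ in Filter.atTop, ∀ k ∈ Finset.range Q, t ≠ Y k →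
      α ^ m * |x (N + k) - Y k| < |t - Y k| := by
    rw [Filter.eventually_all_finset]
    intro k _
    by_cases htk : t = Y k
    · exact Filter.Eventually.of_forall (fun m h => absurd htk h)
    · filter_upwards [small_pow α (x (N + k) - Y k) (|t - Y k|) hαpos hαlt
        (abs_pos.2 (sub_ne_zero.2 htk))] with m hm _
      exact hm
  obtain ⟨m, hm⟩ := hev.exists
  refine ⟨N + Q * m, Q, L, hQ0, ?_, fun k hk => ?_, ?_⟩
  · rw [hshiftQ, hα, ← hL]
  · rw [hshiftQ, ← hY]
    refine ⟨fun hc => ⟨hge k 0 (fun m => O.nonneg _), hle k c (fun m' => ?_)⟩,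
      fun hc => ⟨hge k c (fun m' => ?_), hle k 1 (fun m => (O.lt_one _).le)⟩, ?_⟩
    · exact ((hpiece k m').2 ((hpiece k m).1 hc)).le
    · exact not_lt.1 (fun h => hc ((hpiece k m).2 ((hpiece k m').1 h)))
    · have hpos : 0 < α ^ m := by positivity
      by_cases htk : t = Y k
      · refine Or.inl ⟨htk, ?_⟩
        rw [← sub_ne_zero, (hdiff k).2]
        exact mul_ne_zero hpos.ne' (hdiff k).1
      · right
        rw [(hdiff k).2, abs_mul, abs_of_pos hpos]
        exact hm k (Finset.mem_range.2 hk) htk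
  · have hpos : 0 < α ^ m := by positivity
    have e1 := hpow (m + 1)
    rw [mul_add, mul_one, ← add_assoc] at e1
    have e2 := hpow m
    rw [pow_succ] at e1
    have e3 : x (N + Q * m + Q) - L = α * (x (N + Q * m) - L) := by rw [e1, e2]; ring
    have hne : x (N + Q * m) - L ≠ 0 := by rw [e2]; exact mul_ne_zero hpos.ne' (sub_ne_zero.2 hxL)
    rcases lt_or_gt_of_ne hne with h | h
    · right; left
      constructor <;> nlinarith
    · left
      constructor <;> nlinarith

end PamOrbit

/-- The promise on the parameters of a two-interval map. -/
structure GoodPam (a1 b1 a2 b2 c : ℚ) : Prop where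
  c0 : 0 < c
  c1 : c < 1
  maps : ∀ x ∈ Set.Ico (0 : ℚ) 1, pam2 a1 b1 a2 b2 c x ∈ Set.Ico (0 : ℚ) 1
  inj : Set.InjOn (pam2 a1 b1 a2 b2 c) (Set.Ico (0 : ℚ) 1)

namespace GoodPam

variable {a1 b1 a2 b2 c : ℚ}

theorem f_lo {u : ℚ} (h0 : 0 ≤ u) (h1 : u < c) : pam2 a1 b1 a2 b2 c u = a1 * u + b1 := by
  simp [pam2, h0, h1]

theorem f_hi {u : ℚ} (h0 : c ≤ u) (h1 : u < 1) : pam2 a1 b1 a2 b2 c u = a2 * u + b2 := by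
  simp [pam2, h0, h1, not_lt.2 h0]

theorem ne_a1 (G : GoodPam a1 b1 a2 b2 c) : a1 ≠ 0 := by
  rintro rfl
  have h0 := G.c0
  have h1 := G.c1
  have := G.inj (x₁ := 0) (x₂ := c / 2) ⟨le_rfl, by norm_num⟩ ⟨by linarith, by linarith⟩
    (by rw [f_lo le_rfl h0, f_lo (by linarith) (by linarith)]; ring)
  linarith

theorem ne_a2 (G : GoodPam a1 b1 a2 b2 c) : a2 ≠ 0 := by
  rintro rfl
  have h0 := G.c0
  have h1 := G.c1
  have := G.inj (x₁ := c) (x₂ := (c + 1) / 2) ⟨h0.le, h1⟩ ⟨by linarith, by linarith⟩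
    (by rw [f_hi le_rfl h1, f_hi (by linarith) (by linarith)]; ring)
  linarith

theorem ne_lo_hi (G : GoodPam a1 b1 a2 b2 c) {u w : ℚ} (hu0 : 0 ≤ u) (hu : u < c) (hw : c ≤ w)
    (hw1 : w < 1) : a1 * u + b1 ≠ a2 * w + b2 := by
  intro h
  have := G.inj (x₁ := u) (x₂ := w) ⟨hu0, hu.trans G.c1⟩ ⟨G.c0.le.trans hw, hw1⟩
    (by rw [f_lo hu0 hu, f_hi hw hw1, h])
  linarith

theorem dich (G : GoodPam a1 b1 a2 b2 c) {u w u' w' : ℚ} (hu0 : 0 ≤ u) (hu : u < c) (hw : c ≤ w)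
    (hw1 : w < 1) (hu0' : 0 ≤ u') (hu' : u' < c) (hw' : c ≤ w') (hw1' : w' < 1)
    (h : a1 * u + b1 < a2 * w + b2) : a1 * u' + b1 < a2 * w' + b2 := by
  by_contra hcon
  have hne := G.ne_lo_hi hu0' hu' hw' hw1'
  have h2 : a2 * w' + b2 < a1 * u' + b1 := lt_of_le_of_ne (not_lt.1 hcon) hne.symm
  obtain ⟨d0, hd0⟩ : ∃ d, d = a2 * w + b2 - (a1 * u + b1) := ⟨_, rfl⟩
  obtain ⟨d1, hd1⟩ : ∃ d, d = a1 * u' + b1 - (a2 * w' + b2) := ⟨_, rfl⟩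
  have p0 : 0 < d0 := by linarith
  have p1 : 0 < d1 := by linarith
  obtain ⟨s, hs⟩ : ∃ s, s = d0 / (d0 + d1) := ⟨_, rfl⟩
  have hsm : s * (d0 + d1) = d0 := by rw [hs]; field_simp
  have s0 : 0 < s := by rw [hs]; positivity
  have s1 : 0 < 1 - s := by
    have : (1 - s) * (d0 + d1) = d1 := by linarith
    by_contra hh
    nlinarith
  refine G.ne_lo_hi (u := (1 - s) * u + s * u') (w := (1 - s) * w + s * w')
    (by positivity) ?_ ?_ ?_ ?_
  · nlinarith [mul_lt_mul_of_pos_left hu s1, mul_lt_mul_of_pos_left hu' s0]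
  · nlinarith [mul_le_mul_of_nonneg_left hw s1.le, mul_le_mul_of_nonneg_left hw' s0.le]
  · nlinarith [mul_lt_mul_of_pos_left hw1 s1, mul_lt_mul_of_pos_left hw1' s0]
  · subst hd0 hd1
    linear_combination hsm

variable {x0 : ℚ}

theorem orbit_mem (G : GoodPam a1 b1 a2 b2 c) (hx : x0 ∈ Set.Ico (0 : ℚ) 1) (n : ℕ) :
    (pam2 a1 b1 a2 b2 c)^[n] x0 ∈ Set.Ico (0 : ℚ) 1 := by
  induction n with
  | zero => exact hx
  | succ n ih => rw [Function.iterate_succ_apply']; exact G.maps _ ih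

theorem pamOrbit (G : GoodPam a1 b1 a2 b2 c) (hx : x0 ∈ Set.Ico (0 : ℚ) 1) :
    PamOrbit a1 b1 a2 b2 c (fun n => (pam2 a1 b1 a2 b2 c)^[n] x0) where
  nonneg n := (G.orbit_mem hx n).1
  lt_one n := (G.orbit_mem hx n).2
  ha1 := G.ne_a1
  ha2 := G.ne_a2
  lo n h := by
    simp only [Function.iterate_succ_apply']
    exact f_lo (G.orbit_mem hx n).1 h
  hi n h := by
    simp only [Function.iterate_succ_apply']
    exact f_hi (not_lt.1 h) (G.orbit_mem hx n).2

theorem circle (G : GoodPam a1 b1 a2 b2 c) (hx : x0 ∈ Set.Ico (0 : ℚ) 1) (h1 : 0 < a1)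
    (h2 : 0 < a2) (hb : a2 * c + b2 < b1) :
    CircleOrbit (fun n => (pam2 a1 b1 a2 b2 c)^[n] x0)
      (fun n => (pam2 a1 b1 a2 b2 c)^[n] x0 < c) := by
  have O := G.pamOrbit hx
  have hd : ∀ {u w : ℚ}, 0 ≤ u → u < c → c ≤ w → w < 1 → a2 * w + b2 < a1 * u + b1 := by
    intro u w hu0 hu hw hw1
    by_contra hcon
    have h3 := lt_of_le_of_ne (not_lt.1 hcon) (G.ne_lo_hi hu0 hu hw hw1)
    have := G.dich hu0 hu hw hw1 le_rfl G.c0 le_rfl G.c1 h3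
    linarith
  refine ⟨O.nonneg, O.lt_one, ?_, ?_, ?_, ?_⟩
  · intro n m hn hm
    exact lt_of_lt_of_le hn (not_lt.1 hm)
  · intro n m hnm hlt
    by_cases hn : (pam2 a1 b1 a2 b2 c)^[n] x0 < c
    · have e1 := O.lo n hn
      have e2 := O.lo m (hnm.1 hn)
      rw [e1, e2]
      nlinarith [mul_lt_mul_of_pos_left hlt h1]
    · have e1 := O.hi n hn
      have e2 := O.hi m (fun h => hn (hnm.2 h))
      rw [e1, e2]
      nlinarith [mul_lt_mul_of_pos_left hlt h2]
  · intro n m hn hm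
    have e1 := O.lo n hn
    have e2 := O.hi m hm
    rw [e1, e2]
    exact hd (O.nonneg n) hn (not_lt.1 hm) (O.lt_one m)
  · intro n m h
    simp only [Function.iterate_succ_apply'] at h ⊢
    rw [h]

theorem evPer_not {P : ℕ → Prop} (h : EvPer fun n => ¬ P n) : EvPer P := by
  obtain ⟨N, q, hq, h⟩ := h
  exact ⟨N, q, hq, fun n hn => not_iff_not.1 (h n hn)⟩

theorem classify (G : GoodPam a1 b1 a2 b2 c) (hx : x0 ∈ Set.Ico (0 : ℚ) 1) :
    EvPer (fun n => (pam2 a1 b1 a2 b2 c)^[n] x0 < c) ∨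
    (0 < a1 ∧ 0 < a2 ∧ a2 * c + b2 < b1 ∧
      Function.Injective (fun n => (pam2 a1 b1 a2 b2 c)^[n] x0)) := by
  have O := G.pamOrbit hx
  have hstep : ∀ n m, (pam2 a1 b1 a2 b2 c)^[n] x0 = (pam2 a1 b1 a2 b2 c)^[m] x0 →
      (pam2 a1 b1 a2 b2 c)^[n + 1] x0 = (pam2 a1 b1 a2 b2 c)^[m + 1] x0 := by
    intro n m h
    rw [Function.iterate_succ_apply', Function.iterate_succ_apply', h]
  obtain ⟨x, hxdef⟩ : ∃ x : ℕ → ℚ, x = fun n => (pam2 a1 b1 a2 b2 c)^[n] x0 := ⟨_, rfl⟩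
  have hstep : ∀ n m, x n = x m → x (n + 1) = x (m + 1) := by
    intro n m; rw [hxdef]; exact hstep n m
  rw [← hxdef] at O ⊢
  have hP : (fun n => (pam2 a1 b1 a2 b2 c)^[n] x0 < c) = fun n => x n < c := by rw [hxdef]
  rw [hP]
  clear hP
  have h1 : ∀ n m, x n < c → ¬ x m < c → x n < x m := fun n m hn hm =>
    lt_of_lt_of_le hn (not_lt.1 hm)
  have lolo : 0 < a1 → ∀ n m, x n < c → x m < c → x n < x m → x (n+1) < x (m+1) := by
    intro ha n m hn hm h
    rw [O.lo n hn, O.lo m hm]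
    nlinarith [mul_lt_mul_of_pos_left h ha]
  have hihi : 0 < a2 → ∀ n m, ¬ x n < c → ¬ x m < c → x n < x m → x (n+1) < x (m+1) := by
    intro ha n m hn hm h
    rw [O.hi n hn, O.hi m hm]
    nlinarith [mul_lt_mul_of_pos_left h ha]
  have lolo' : a1 < 0 → ∀ n m, x n < c → x m < c → x n < x m → x (m+1) < x (n+1) := by
    intro ha n m hn hm h
    rw [O.lo n hn, O.lo m hm]
    nlinarith [mul_lt_mul_of_neg_left h ha]
  have hihi' : a2 < 0 → ∀ n m, ¬ x n < c → ¬ x m < c → x n < x m → x (m+1) < x (n+1) := by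
    intro ha n m hn hm h
    rw [O.hi n hn, O.hi m hm]
    nlinarith [mul_lt_mul_of_neg_left h ha]
  by_cases hinj : Function.Injective x
  swap
  · left
    have hx' : ∃ n m, n < m ∧ x n = x m := by
      rw [Function.Injective] at hinj
      push Not at hinj
      obtain ⟨n, m, h, hne⟩ := hinj
      rcases lt_or_gt_of_ne hne with hh | hh
      · exact ⟨n, m, hh, h⟩
      · exact ⟨m, n, hh, h.symm⟩
    obtain ⟨n, m, hnm, h⟩ := hx'
    have key : ∀ k, x (n + k) = x (m + k) := by
      intro k
      induction k with
      | zero => exact h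
      | succ k ih => exact hstep _ _ ih
    refine ⟨n, m - n, by omega, fun k hk => ?_⟩
    have := key (k - n)
    rw [show n + (k - n) = k by omega, show m + (k - n) = k + (m - n) by omega] at this
    dsimp only
    rw [this]
  rcases lt_or_gt_of_ne (G.ne_lo_hi le_rfl G.c0 le_rfl G.c1) with hlt | hgt
  · left
    refine evPer_lt x _ h1 ?_
    intro n m hn hm
    rw [O.lo n hn, O.hi m hm]
    exact G.dich le_rfl G.c0 le_rfl G.c1 (O.nonneg n) hn (not_lt.1 hm) (O.lt_one m) hlt
  · have cross : ∀ n m, x n < c → ¬ x m < c → x (m + 1) < x (n + 1) := by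
      intro n m hn hm
      rw [O.lo n hn, O.hi m hm]
      by_contra hcon
      have h3 := lt_of_le_of_ne (not_lt.1 hcon)
        (G.ne_lo_hi (O.nonneg n) hn (not_lt.1 hm) (O.lt_one m))
      have := G.dich (O.nonneg n) hn (not_lt.1 hm) (O.lt_one m) le_rfl G.c0 le_rfl G.c1 h3
      linarith
    rcases lt_or_gt_of_ne G.ne_a1 with s1 | s1 <;> rcases lt_or_gt_of_ne G.ne_a2 with s2 | s2
    · left
      refine evPer_anti x _ h1 ?_ (fun n m h => (hstep n m h).symm)
      intro n m h
      by_cases hn : x n < c <;> by_cases hm : x m < c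
      · exact lolo' s1 n m hn hm h
      · exact cross n m hn hm
      · exact absurd (h1 m n hm hn) (not_lt.2 h.le)
      · exact hihi' s2 n m hn hm h
    · left
      apply evPer_not
      refine evPer_flip (α := ℚᵒᵈ) (fun n => OrderDual.toDual (x n)) _ ?_ ?_ ?_ ?_
      · intro n m hn hm
        exact h1 m n (not_not.1 hm) hn
      · intro n m hn hm h
        exact hihi s2 m n hm hn h
      · intro n m hn hm h
        exact lolo' s1 m n (not_not.1 hm) (not_not.1 hn) h
      · intro n m hn hm
        exact cross m n (not_not.1 hm) hn
    · left
      exact evPer_flip x _ h1 (lolo s1) (hihi' s2) cross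
    · right
      exact ⟨s1, s2, by linarith, hinj⟩

/-- Certificate of non-reachability through a p-adic divergence. -/
def _root_.CertB (a1 b1 a2 b2 c : ℚ) (x : ℕ → ℚ) (t : ℚ) (N n p : ℕ) : Prop :=
  0 < a1 ∧ 0 < a2 ∧ a2 * c + b2 < b1 ∧ p.Prime ∧
  (n : ℤ) * padicValRat p a1 + cnt (fun n => x n < c) 0 n * (padicValRat p a2 - padicValRat p a1)
    + |padicValRat p a2 - padicValRat p a1| < 0 ∧
  padicValRat p (x N) + n * (|padicValRat p a1| + |padicValRat p a2|)
    + (|padicValRat p a1| + |padicValRat p a2|) < 0 ∧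
  padicValRat p (x N) + n * (|padicValRat p a1| + |padicValRat p a2|)
    + (|padicValRat p a1| + |padicValRat p a2|) < padicValRat p b1 ∧
  padicValRat p (x N) + n * (|padicValRat p a1| + |padicValRat p a2|)
    + (|padicValRat p a1| + |padicValRat p a2|) < padicValRat p b2 ∧
  padicValRat p (x N) + n * (|padicValRat p a1| + |padicValRat p a2|)
    + (|padicValRat p a1| + |padicValRat p a2|) < padicValRat p t

theorem cert_complete (G : GoodPam a1 b1 a2 b2 c) (hx : x0 ∈ Set.Ico (0 : ℚ) 1) (t : ℚ)
    (ht : ∀ n, (pam2 a1 b1 a2 b2 c)^[n] x0 ≠ t) :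
    (∃ N q y, CertA a1 b1 a2 b2 c (fun n => (pam2 a1 b1 a2 b2 c)^[n] x0) t N q y) ∨
    (∃ N n p, CertB a1 b1 a2 b2 c (fun n => (pam2 a1 b1 a2 b2 c)^[n] x0) t N n p) := by
  have O := G.pamOrbit hx
  by_cases hper : EvPer (fun n => (pam2 a1 b1 a2 b2 c)^[n] x0 < c)
  · left
    exact O.certA_complete G.c0 G.c1 t ht hper
  · right
    obtain ⟨h1, h2, h3, h4⟩ := (G.classify hx).resolve_left hper
    obtain ⟨p, n, N, hp, h⟩ := O.certB_complete (G.circle hx h1 h2 h3) h4 hper t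
    exact ⟨N, n, p, h1, h2, h3, hp, h _ rfl⟩

theorem certB_sound (G : GoodPam a1 b1 a2 b2 c) (hx : x0 ∈ Set.Ico (0 : ℚ) 1) (t : ℚ)
    (N n p : ℕ) (h : CertB a1 b1 a2 b2 c (fun n => (pam2 a1 b1 a2 b2 c)^[n] x0) t N n p)
    (k : ℕ) : (pam2 a1 b1 a2 b2 c)^[N + k] x0 ≠ t := by
  obtain ⟨h1, h2, h3, hp, h4, h5, h6, h7, h8⟩ := h
  have : Fact p.Prime := ⟨hp⟩
  exact (G.pamOrbit hx).certB_sound (G.circle hx h1 h2 h3) p t n N _ rfl h4 h5 h6 h7 h8 k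

end GoodPam

/-- A predicate with a computable characteristic function. -/
def CP {α : Type*} [Primcodable α] (p : α → Prop) : Prop :=
  ∃ f : α → Bool, Computable f ∧ ∀ a, f a = true ↔ p a

section comp

variable {α β γ σ : Type*} [Primcodable α] [Primcodable β] [Primcodable γ] [Primcodable σ]

theorem Computable.cond_ite {c : α → Prop} {inst : DecidablePred c} {f g : α → σ} (hc : CP c)
    (hf : Computable f) (hg : Computable g) : Computable fun a => if c a then f a else g a := by
  obtain ⟨b, hb, h⟩ := hc
  refine (Computable.cond hb hf hg).of_eq fun a => ?_
  by_cases hh : c a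
  · rw [if_pos hh, (h a).2 hh]; rfl
  · have : b a = false := by
      rw [← Bool.not_eq_true]
      exact fun h' => hh ((h a).1 h')
    rw [if_neg hh, this]; rfl

theorem CP.of_iff {p q : α → Prop} (hp : CP p) (h : ∀ a, p a ↔ q a) : CP q := by
  obtain ⟨f, hf, hh⟩ := hp
  exact ⟨f, hf, fun a => (hh a).trans (h a)⟩

theorem CP.comp {p : β → Prop} (hp : CP p) {g : α → β} (hg : Computable g) :
    CP fun a => p (g a) := by
  obtain ⟨f, hf, hh⟩ := hp
  exact ⟨fun a => f (g a), hf.comp hg, fun a => hh _⟩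

theorem CP.not {p : α → Prop} (hp : CP p) : CP fun a => ¬ p a := by
  obtain ⟨f, hf, hh⟩ := hp
  refine ⟨fun a => !(f a), (Primrec.not.to_comp).comp hf, fun a => ?_⟩
  dsimp only
  rw [← hh a]; simp

theorem CP.and {p q : α → Prop} (hp : CP p) (hq : CP q) : CP fun a => p a ∧ q a := by
  obtain ⟨f, hf, hh⟩ := hp
  obtain ⟨g, hg, hh'⟩ := hq
  refine ⟨fun a => f a && g a, (Primrec.and.to_comp).comp hf hg, fun a => ?_⟩
  dsimp only
  rw [← hh a, ← hh' a]; simp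

theorem CP.or {p q : α → Prop} (hp : CP p) (hq : CP q) : CP fun a => p a ∨ q a := by
  obtain ⟨f, hf, hh⟩ := hp
  obtain ⟨g, hg, hh'⟩ := hq
  refine ⟨fun a => f a || g a, (Primrec.or.to_comp).comp hf hg, fun a => ?_⟩
  dsimp only
  rw [← hh a, ← hh' a]; simp

theorem CP.imp {p q : α → Prop} (hp : CP p) (hq : CP q) : CP fun a => p a → q a :=
  (hp.not.or hq).of_iff fun a => by tauto

theorem CP.nat_lt {f g : α → ℕ} (hf : Computable f) (hg : Computable g) :
    CP fun a => f a < g a := by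
  obtain ⟨_, h⟩ := Primrec.nat_lt
  exact ⟨fun a => decide (f a < g a),
    ((h.to_comp).comp (hf.pair hg)).of_eq fun a => by simp, fun a => by simp⟩

theorem CP.nat_le {f g : α → ℕ} (hf : Computable f) (hg : Computable g) :
    CP fun a => f a ≤ g a :=
  (CP.nat_lt hg hf).not.of_iff fun _ => not_lt

theorem CP.nat_eq {f g : α → ℕ} (hf : Computable f) (hg : Computable g) :
    CP fun a => f a = g a :=
  ((CP.nat_le hf hg).and (CP.nat_le hg hf)).of_iff fun a => by omega

theorem CP.eq {f g : α → σ} (hf : Computable f) (hg : Computable g) :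
    CP fun a => f a = g a :=
  (CP.nat_eq (Computable.encode.comp hf) (Computable.encode.comp hg)).of_iff fun _ =>
    Encodable.encode_injective.eq_iff

theorem CP.forall_lt {P : α → ℕ → Prop} (hP : CP fun p : α × ℕ => P p.1 p.2) {f : α → ℕ}
    (hf : Computable f) : CP fun a => ∀ k < f a, P a k := by
  obtain ⟨b, hb, h⟩ := hP
  refine ⟨fun a => Nat.rec (motive := fun _ => Bool) true (fun k r => r && b (a, k)) (f a),
    Computable.nat_rec (h := fun a p => p.2 && b (a, p.1)) hf (Computable.const true) ?_,
    fun a => ?_⟩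
  · refine (Primrec.and.to_comp).comp
      (g := fun r : α × (ℕ × Bool) => r.2.2) (h := fun r : α × (ℕ × Bool) => b (r.1, r.2.1))
      (Computable.snd.comp Computable.snd) ?_
    exact hb.comp (Computable.fst.pair (Computable.fst.comp Computable.snd))
  · dsimp only
    generalize f a = n
    induction n with
    | zero => simp
    | succ n ih =>
      simp only [Bool.and_eq_true, ih, h]
      constructor
      · rintro ⟨h1, h2⟩ k hk
        rcases Nat.lt_succ_iff_lt_or_eq.1 hk with hh | rfl
        · exact h1 k hh
        · exact h2
      · intro h1
        exact ⟨fun k hk => h1 k (by omega), h1 n (by omega)⟩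

theorem Computable.least {R : α → ℕ → Prop} (hR : CP fun p : α × ℕ => R p.1 p.2) {g : α → ℕ}
    (h1 : ∀ a, R a (g a)) (h2 : ∀ a n, R a n → g a ≤ n) : Computable g := by
  obtain ⟨b, hb, h⟩ := hR
  have hp : Partrec₂ fun (a : α) (n : ℕ) => (Part.some (b (a, n)) : Part Bool) :=
    (Computable.partrec hb).to₂
  refine (Partrec.rfind hp).of_eq_tot fun a => ?_
  refine Nat.mem_rfind.2 ⟨?_, fun {m} hm => ?_⟩
  · exact Part.mem_some_iff.2 ((h (a, g a)).2 (h1 a)).symm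
  · refine Part.mem_some_iff.2 ?_
    rw [eq_comm, ← Bool.not_eq_true]
    intro hh
    have := h2 a m ((h (a, m)).1 hh)
    omega

theorem Computable.search {R : α → β → Prop} (hR : CP fun p : α × β => R p.1 p.2) {g : α → β}
    (h1 : ∀ a, R a (g a)) (h2 : ∀ a b, R a b → b = g a) : Computable g := by
  obtain ⟨b, hb, h⟩ := hR
  have hp : Computable₂ fun (a : α) (n : ℕ) =>
      (Encodable.decode (α := β) n).bind fun y => bif b (a, y) then some y else none := by
    refine Computable.option_bind (f := fun p : α × ℕ => Encodable.decode (α := β) p.2)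
      (g := fun p y => bif b (p.1, y) then some y else none)
      (Computable.decode.comp Computable.snd) ?_
    refine Computable.cond ?_ (Computable.option_some.comp Computable.snd) (Computable.const none)
    exact hb.comp ((Computable.fst.comp Computable.fst).pair Computable.snd)
  refine (Partrec.rfindOpt hp).of_eq_tot fun a => ?_
  have hdom : (Nat.rfindOpt fun n => (Encodable.decode (α := β) n).bind
      fun y => bif b (a, y) then some y else none).Dom := by
    rw [Nat.rfindOpt_dom]
    refine ⟨Encodable.encode (g a), g a, ?_⟩
    simp [(h (a, g a)).2 (h1 a)]
  obtain ⟨y, hy⟩ := Part.dom_iff_mem.1 hdom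
  obtain ⟨n, hn⟩ := Nat.rfindOpt_spec hy
  have : y = g a := by
    rw [Option.mem_def, Option.bind_eq_some_iff] at hn
    obtain ⟨z, -, hz⟩ := hn
    cases hbz : b (a, z) with
    | false => rw [hbz] at hz; simp at hz
    | true =>
      rw [hbz] at hz
      simp at hz
      subst hz
      exact h2 a _ ((h (a, z)).1 hbz)
  rwa [← this]

theorem separation {P : α → β → Prop} {Q : α → γ → Prop} (hP : CP fun p : α × β => P p.1 p.2)
    (hQ : CP fun p : α × γ => Q p.1 p.2) (h : ∀ a, (∃ c, P a c) ∨ ∃ d, Q a d) :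
    ∃ F : α → Bool, Computable F ∧ ∀ a, (F a = true → ∃ c, P a c) ∧ (F a = false → ∃ d, Q a d) := by
  obtain ⟨pp, hp, hp'⟩ := hP
  obtain ⟨q, hq, hq'⟩ := hQ
  have hf : Computable₂ fun (a : α) (n : ℕ) =>
      (Encodable.decode (α := β ⊕ γ) n).bind fun y =>
        (Sum.casesOn (motive := fun _ => Option Bool) y
          (fun c => bif pp (a, c) then some true else none)
          (fun d => bif q (a, d) then some false else none) : Option Bool) := by
    refine Computable.option_bind (f := fun p : α × ℕ => Encodable.decode (α := β ⊕ γ) p.2)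
      (g := fun p y => (Sum.casesOn (motive := fun _ => Option Bool) y
          (fun c => bif pp (p.1, c) then some true else none)
          (fun d => bif q (p.1, d) then some false else none) : Option Bool))
      (Computable.decode.comp Computable.snd) ?_
    refine Computable.sumCasesOn (f := fun r : (α × ℕ) × (β ⊕ γ) => r.2)
      (g := fun r c => bif pp (r.1.1, c) then some true else none)
      (h := fun r d => bif q (r.1.1, d) then some false else none) Computable.snd ?_ ?_
    · refine Computable.cond ?_ (Computable.const _) (Computable.const _)
      exact hp.comp ((Computable.fst.comp (Computable.fst.comp Computable.fst)).pair Computable.snd)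
    · refine Computable.cond ?_ (Computable.const _) (Computable.const _)
      exact hq.comp ((Computable.fst.comp (Computable.fst.comp Computable.fst)).pair Computable.snd)
  obtain ⟨G, hG⟩ : ∃ G : α → ℕ → Option Bool, G = fun (a : α) (n : ℕ) =>
      (Encodable.decode (α := β ⊕ γ) n).bind fun y =>
        (Sum.casesOn (motive := fun _ => Option Bool) y
          (fun c => bif pp (a, c) then some true else none)
          (fun d => bif q (a, d) then some false else none) : Option Bool) := ⟨_, rfl⟩
  rw [← hG] at hf
  have hdom : ∀ a, ∃ r, r ∈ Nat.rfindOpt (G a) := by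
    intro a
    rw [← Part.dom_iff_mem, Nat.rfindOpt_dom]
    rcases h a with ⟨c, hc⟩ | ⟨d, hd⟩
    · refine ⟨Encodable.encode (Sum.inl c : β ⊕ γ), true, ?_⟩
      rw [hG]
      dsimp only
      rw [Encodable.encodek]
      simp [(hp' (a, c)).2 hc]
    · refine ⟨Encodable.encode (Sum.inr d : β ⊕ γ), false, ?_⟩
      rw [hG]
      dsimp only
      rw [Encodable.encodek]
      simp [(hq' (a, d)).2 hd]
  choose F hF using hdom
  refine ⟨F, (Partrec.rfindOpt hf).of_eq_tot hF, fun a => ?_⟩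
  obtain ⟨n, hn⟩ := Nat.rfindOpt_spec (hF a)
  rw [hG, Option.mem_def, Option.bind_eq_some_iff] at hn
  obtain ⟨z, -, hz⟩ := hn
  rcases z with c | d
  · cases hb : pp (a, c) with
    | false => simp [hb] at hz
    | true =>
      simp only [hb, cond_true, Option.some.injEq] at hz
      rw [← hz]
      exact ⟨fun _ => ⟨c, (hp' (a, c)).1 hb⟩, fun h => by simp at h⟩
  · cases hb : q (a, d) with
    | false => simp [hb] at hz
    | true =>
      simp only [hb, cond_true, Option.some.injEq] at hz
      rw [← hz]
      exact ⟨fun h => by simp at h, fun _ => ⟨d, (hq' (a, d)).1 hb⟩⟩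

theorem Computable.c_fst {f : α → β × γ} (hf : Computable f) : Computable fun a => (f a).1 :=
  Computable.fst.comp hf

theorem Computable.c_snd {f : α → β × γ} (hf : Computable f) : Computable fun a => (f a).2 :=
  Computable.snd.comp hf

theorem Computable.c_id : Computable fun a : α => a := Computable.id

theorem Computable.c_nadd {f g : α → ℕ} (hf : Computable f) (hg : Computable g) :
    Computable fun a => f a + g a := (Primrec.nat_add.to_comp).comp hf hg

theorem Computable.c_nmul {f g : α → ℕ} (hf : Computable f) (hg : Computable g) :
    Computable fun a => f a * g a := (Primrec.nat_mul.to_comp).comp hf hg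

theorem Computable.c_nmod {f g : α → ℕ} (hf : Computable f) (hg : Computable g) :
    Computable fun a => f a % g a := (Primrec.nat_mod.to_comp).comp hf hg

theorem Computable.c_ndiv {f g : α → ℕ} (hf : Computable f) (hg : Computable g) :
    Computable fun a => f a / g a := (Primrec.nat_div.to_comp).comp hf hg

theorem CP.nat_dvd {f g : α → ℕ} (hf : Computable f) (hg : Computable g) :
    CP fun a => f a ∣ g a :=
  (CP.nat_eq (Computable.c_nmod hg hf) (Computable.const 0)).of_iff fun _ =>
    (Nat.dvd_iff_mod_eq_zero).symm

end comp

/-- The raw code of a rational: numerator and denominator. -/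
def ecode (q : ℚ) : ℕ := Nat.pair (Equiv.intEquivNat q.num) q.den

theorem ecode_eq (q : ℚ) : ecode q = @Encodable.encode ℚ Rat.instEncodable q := rfl

/-- The rational with given index. -/
noncomputable def ratOf (n : ℕ) : ℚ := Denumerable.ofNat ℚ n

theorem ecode_ratOf_spec : (∀ q, ecode (ratOf 0) ≤ ecode q) ∧
    ∀ n, ecode (ratOf n) < ecode (ratOf (n + 1)) ∧
      ∀ q, ecode (ratOf n) < ecode q → ecode (ratOf (n + 1)) ≤ ecode q := by
  let I1 : DecidablePred (· ∈ Set.range (@Encodable.encode ℚ Rat.instEncodable)) :=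
    @Encodable.decidableRangeEncode ℚ Rat.instEncodable
  have I2 : Infinite (Set.range (@Encodable.encode ℚ Rat.instEncodable)) :=
    Infinite.of_injective _
      (Equiv.ofInjective _ (@Encodable.encode_injective ℚ Rat.instEncodable)).injective
  let D := Nat.Subtype.denumerable (Set.range (@Encodable.encode ℚ Rat.instEncodable))
  have key : ∀ n, ecode (ratOf n) =
      (Nat.Subtype.ofNat (Set.range (@Encodable.encode ℚ Rat.instEncodable)) n : ℕ) := by
    intro n
    have h2 : ratOf n = (@Encodable.equivRangeEncode ℚ Rat.instEncodable).symm
        (Denumerable.ofNat (Set.range (@Encodable.encode ℚ Rat.instEncodable)) n) :=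
      @Denumerable.ofEquiv_ofNat _ ℚ D (@Encodable.equivRangeEncode ℚ Rat.instEncodable) n
    have h3 : Denumerable.ofNat (Set.range (@Encodable.encode ℚ Rat.instEncodable)) n =
        Nat.Subtype.ofNat (Set.range (@Encodable.encode ℚ Rat.instEncodable)) n := rfl
    rw [h2, h3]
    exact congrArg Subtype.val ((@Encodable.equivRangeEncode ℚ Rat.instEncodable).apply_symm_apply
      (Nat.Subtype.ofNat (Set.range (@Encodable.encode ℚ Rat.instEncodable)) n))
  refine ⟨fun q => ?_, fun n => ⟨?_, fun q hq => ?_⟩⟩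
  · rw [key]
    have : (⊥ : Set.range (@Encodable.encode ℚ Rat.instEncodable)) ≤ ⟨ecode q, q, rfl⟩ := bot_le
    exact this
  · rw [key, key]
    exact Nat.Subtype.lt_succ_self _
  · rw [key] at hq ⊢
    have : Nat.Subtype.ofNat (Set.range (@Encodable.encode ℚ Rat.instEncodable)) n <
      ⟨ecode q, q, rfl⟩ := hq
    exact Nat.Subtype.succ_le_of_lt this

theorem intEquivNat_spec (z : ℤ) : (Equiv.intEquivNat z + 1) / 2 = z.natAbs ∧
    (z = ((if Equiv.intEquivNat z % 2 = 0 then Equiv.intEquivNat z / 2 else 0 : ℕ) : ℤ)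
      - ((if Equiv.intEquivNat z % 2 = 0 then 0 else (Equiv.intEquivNat z + 1) / 2 : ℕ) : ℤ)) := by
  rcases z with k | k
  · have : Equiv.intEquivNat (Int.ofNat k) = 2 * k := rfl
    rw [this, if_pos (by omega), if_pos (by omega)]
    constructor
    · simp; omega
    · simp
  · have : Equiv.intEquivNat (Int.negSucc k) = 2 * k + 1 := rfl
    rw [this, if_neg (by omega), if_neg (by omega)]
    constructor
    · simp; omega
    · simp; omega

/-- Valid raw codes. -/
def ECode (m : ℕ) : Prop := 0 < m.unpair.2 ∧
  ∀ e < m.unpair.2 + 1, e ∣ m.unpair.2 → e ∣ (m.unpair.1 + 1) / 2 → e = 1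

theorem eCode_iff (m : ℕ) : ECode m ↔ ∃ q, ecode q = m := by
  constructor
  · rintro ⟨h1, h2⟩
    have hcop : ((Equiv.intEquivNat.symm m.unpair.1).natAbs).Coprime m.unpair.2 := by
      rw [← (intEquivNat_spec _).1, Equiv.apply_symm_apply]
      apply h2
      · exact Nat.lt_succ_of_le (Nat.le_of_dvd h1 (Nat.gcd_dvd_right _ _))
      · exact Nat.gcd_dvd_right _ _
      · exact Nat.gcd_dvd_left _ _
    refine ⟨⟨Equiv.intEquivNat.symm m.unpair.1, m.unpair.2, by omega, hcop⟩, ?_⟩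
    simp [ecode]
  · rintro ⟨q, rfl⟩
    unfold ECode ecode
    simp only [Nat.unpair_pair]
    refine ⟨q.pos, fun e _ h1 h2 => ?_⟩
    rw [(intEquivNat_spec _).1] at h2
    exact Nat.eq_one_of_dvd_coprimes q.reduced h2 h1

theorem cp_eCode : CP ECode := by
  have hu : Computable fun a : ℕ => a.unpair := Computable.unpair
  refine CP.and (CP.nat_lt (Computable.const 0) hu.c_snd) ?_
  refine CP.forall_lt (P := fun m e => e ∣ m.unpair.2 → e ∣ (m.unpair.1 + 1) / 2 → e = 1) ?_
    (Computable.c_nadd hu.c_snd (Computable.const 1))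
  have hv : Computable fun a : ℕ × ℕ => a.1.unpair := Computable.unpair.comp Computable.fst
  refine CP.imp (CP.nat_dvd Computable.snd hv.c_snd) (CP.imp (CP.nat_dvd Computable.snd ?_)
    (CP.nat_eq Computable.snd (Computable.const 1)))
  exact Computable.c_ndiv (Computable.c_nadd hv.c_fst (Computable.const 1)) (Computable.const 2)

theorem exists_next (m : ℕ) : ∃ k, m ≤ k ∧ ECode k := by
  refine ⟨Nat.pair (Equiv.intEquivNat (m : ℚ).num) (m : ℚ).den, ?_, (eCode_iff _).2 ⟨m, rfl⟩⟩
  refine le_trans ?_ (Nat.left_le_pair _ _)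
  have : Equiv.intEquivNat (m : ℤ) = 2 * m := rfl
  rw [Rat.num_natCast, this]
  omega

open Classical in
/-- Least valid code at least `m`. -/
noncomputable def nextCode (m : ℕ) : ℕ := Nat.find (exists_next m)

theorem computable_nextCode : Computable nextCode := by
  classical
  refine Computable.least (R := fun m k => m ≤ k ∧ ECode k) ?_ (fun m => ?_) (fun m n h => ?_)
  · exact CP.and (CP.nat_le Computable.fst Computable.snd) (cp_eCode.comp Computable.snd)
  · exact Nat.find_spec (exists_next m)
  · exact Nat.find_min' (exists_next m) h

theorem nextCode_eq {m k : ℕ} (h : m ≤ k) (hk : ECode k) (h2 : ∀ l, m ≤ l → ECode l → k ≤ l) :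
    nextCode m = k := by
  classical
  apply le_antisymm
  · exact Nat.find_min' (exists_next m) ⟨h, hk⟩
  · have := Nat.find_spec (exists_next m)
    exact h2 _ this.1 this.2

theorem ecode_ratOf (n : ℕ) : ecode (ratOf n) =
    Nat.rec (motive := fun _ => ℕ) (nextCode 0) (fun _ r => nextCode (r + 1)) n := by
  induction n with
  | zero =>
    symm
    refine nextCode_eq (Nat.zero_le _) ((eCode_iff _).2 ⟨_, rfl⟩) ?_
    intro l _ hl
    obtain ⟨q, rfl⟩ := (eCode_iff _).1 hl
    exact ecode_ratOf_spec.1 q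
  | succ n ih =>
    dsimp only
    rw [← ih]
    symm
    refine nextCode_eq (ecode_ratOf_spec.2 n).1 ((eCode_iff _).2 ⟨_, rfl⟩) ?_
    intro l h hl
    obtain ⟨q, rfl⟩ := (eCode_iff _).1 hl
    exact (ecode_ratOf_spec.2 n).2 q h

theorem computable_ecode : Computable ecode := by
  have h : Computable fun n => ecode (ratOf n) := by
    refine Computable.of_eq ?_ fun n => (ecode_ratOf n).symm
    refine Computable.nat_rec (f := fun n : ℕ => n) (g := fun _ => nextCode 0)
      (h := fun _ p => nextCode (p.2 + 1)) Computable.id (Computable.const _) ?_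
    exact computable_nextCode.comp (g := fun r : ℕ × (ℕ × ℕ) => r.2.2 + 1)
      (Computable.c_nadd Computable.snd.c_snd (Computable.const 1))
  have h2 : ∀ q : ℚ, ratOf (@Encodable.encode ℚ Primcodable.toEncodable q) = q :=
    fun q => Denumerable.ofNat_encode q
  have h3 : Computable fun q : ℚ => @Encodable.encode ℚ Primcodable.toEncodable q :=
    Computable.encode
  exact (h.comp h3).of_eq fun q => congrArg ecode (h2 q)

/-- Positive part of the numerator. -/
def rpos (q : ℚ) : ℕ :=
  if (ecode q).unpair.1 % 2 = 0 then (ecode q).unpair.1 / 2 else 0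

/-- Negative part of the numerator. -/
def rneg (q : ℚ) : ℕ :=
  if (ecode q).unpair.1 % 2 = 0 then 0 else ((ecode q).unpair.1 + 1) / 2

theorem num_eq (q : ℚ) : q.num = (rpos q : ℤ) - (rneg q : ℤ) := by
  unfold rpos rneg ecode
  simp only [Nat.unpair_pair]
  exact (intEquivNat_spec q.num).2

theorem natAbs_num (q : ℚ) : q.num.natAbs = ((ecode q).unpair.1 + 1) / 2 := by
  unfold ecode
  simp only [Nat.unpair_pair]
  exact (intEquivNat_spec q.num).1.symm

theorem computable_den : Computable fun q : ℚ => q.den :=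
  (Computable.c_snd (Computable.unpair.comp computable_ecode)).of_eq fun q => by simp [ecode]

theorem computable_ecode1 : Computable fun q : ℚ => (ecode q).unpair.1 :=
  Computable.c_fst (Computable.unpair.comp computable_ecode)

theorem computable_natAbs_num : Computable fun q : ℚ => q.num.natAbs :=
  (Computable.c_ndiv (Computable.c_nadd computable_ecode1 (Computable.const 1))
    (Computable.const 2)).of_eq fun q => (natAbs_num q).symm

theorem computable_rpos : Computable rpos :=
  Computable.cond_ite (CP.nat_eq (Computable.c_nmod computable_ecode1 (Computable.const 2))
    (Computable.const 0)) (Computable.c_ndiv computable_ecode1 (Computable.const 2))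
    (Computable.const 0)

theorem computable_rneg : Computable rneg :=
  Computable.cond_ite (CP.nat_eq (Computable.c_nmod computable_ecode1 (Computable.const 2))
    (Computable.const 0)) (Computable.const 0)
    (Computable.c_ndiv (Computable.c_nadd computable_ecode1 (Computable.const 1))
    (Computable.const 2))

theorem rat_eq (q : ℚ) : q * q.den = rpos q - rneg q := by
  have h := Rat.mul_den_eq_num q
  rw [h, num_eq q]
  push_cast
  rfl

/-- Rational from a difference of naturals and a denominator. -/
def mkq (p : ℕ × ℕ × ℕ) : ℚ := ((p.1 : ℚ) - p.2.1) / p.2.2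

theorem computable_mkq : Computable mkq := by
  refine Computable.search (R := fun (p : ℕ × ℕ × ℕ) (s : ℚ) => (p.2.2 = 0 ∧ s = 0) ∨
    (0 < p.2.2 ∧ p.1 * s.den + rneg s * p.2.2 = rpos s * p.2.2 + p.2.1 * s.den)) ?_ ?_ ?_
  · have h1 : Computable fun r : (ℕ × ℕ × ℕ) × ℚ => r.1.1 := Computable.fst.c_fst
    have h2 : Computable fun r : (ℕ × ℕ × ℕ) × ℚ => r.1.2.1 := Computable.fst.c_snd.c_fst
    have h3 : Computable fun r : (ℕ × ℕ × ℕ) × ℚ => r.1.2.2 := Computable.fst.c_snd.c_snd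
    have h4 : Computable fun r : (ℕ × ℕ × ℕ) × ℚ => r.2 := Computable.snd
    have h5 := computable_den.comp h4
    have h6 := computable_rpos.comp h4
    have h7 := computable_rneg.comp h4
    exact CP.or (CP.and (CP.nat_eq h3 (Computable.const 0)) (CP.eq h4 (Computable.const 0)))
      (CP.and (CP.nat_lt (Computable.const 0) h3)
        (CP.nat_eq (Computable.c_nadd (Computable.c_nmul h1 h5) (Computable.c_nmul h7 h3))
          (Computable.c_nadd (Computable.c_nmul h6 h3) (Computable.c_nmul h2 h5))))
  · rintro ⟨a, b, d⟩
    rcases Nat.eq_zero_or_pos d with rfl | hd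
    · left; simp [mkq]
    · right
      refine ⟨hd, ?_⟩
      have h := rat_eq (mkq (a, b, d))
      have hm : mkq (a, b, d) * d = a - b := by
        have : (d : ℚ) ≠ 0 := by positivity
        simp only [mkq]; field_simp
      have : ((a * (mkq (a, b, d)).den + rneg (mkq (a, b, d)) * d : ℕ) : ℚ) =
          ((rpos (mkq (a, b, d)) * d + b * (mkq (a, b, d)).den : ℕ) : ℚ) := by
        push_cast
        linear_combination d * h - (mkq (a, b, d)).den * hm
      exact_mod_cast this
  · rintro ⟨a, b, d⟩ s (⟨h1, h2⟩ | ⟨h1, h2⟩)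
    · simp only at h1
      subst h1
      rw [h2]; simp [mkq]
    · simp only at h1 h2
      have h := rat_eq s
      have h2 : ((a * s.den + rneg s * d : ℕ) : ℚ) = ((rpos s * d + b * s.den : ℕ) : ℚ) := by
        rw [h2]
      push_cast at h2
      have hs : (s.den : ℚ) ≠ 0 := by exact_mod_cast s.den_nz
      have hd : (d : ℚ) ≠ 0 := by positivity
      simp only [mkq]
      rw [eq_div_iff hd]
      apply mul_right_cancel₀ hs
      linear_combination d * h - h2

section ratops

variable {α : Type*} [Primcodable α] {f g : α → ℚ}

theorem eq_mkq (q : ℚ) {a b d : ℕ} (hd : 0 < d) (h : q * d = a - b) : q = mkq (a, b, d) := by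
  have : (d : ℚ) ≠ 0 := by positivity
  simp only [mkq]
  rw [eq_div_iff this, h]

theorem Computable.c_add (hf : Computable f) (hg : Computable g) :
    Computable fun a => f a + g a := by
  have h1 := computable_rpos.comp hf
  have h2 := computable_rneg.comp hf
  have h3 := computable_den.comp hf
  have h4 := computable_rpos.comp hg
  have h5 := computable_rneg.comp hg
  have h6 := computable_den.comp hg
  refine (computable_mkq.comp ((Computable.c_nadd (Computable.c_nmul h1 h6)
    (Computable.c_nmul h4 h3)).pair ((Computable.c_nadd (Computable.c_nmul h2 h6)
    (Computable.c_nmul h5 h3)).pair (Computable.c_nmul h3 h6)))).of_eq fun a => ?_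
  symm
  apply eq_mkq
  · exact Nat.mul_pos (f a).pos (g a).pos
  · push_cast
    linear_combination (g a).den * rat_eq (f a) + (f a).den * rat_eq (g a)

theorem Computable.c_mul (hf : Computable f) (hg : Computable g) :
    Computable fun a => f a * g a := by
  have h1 := computable_rpos.comp hf
  have h2 := computable_rneg.comp hf
  have h3 := computable_den.comp hf
  have h4 := computable_rpos.comp hg
  have h5 := computable_rneg.comp hg
  have h6 := computable_den.comp hg
  refine (computable_mkq.comp ((Computable.c_nadd (Computable.c_nmul h1 h4)
    (Computable.c_nmul h2 h5)).pair ((Computable.c_nadd (Computable.c_nmul h1 h5)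
    (Computable.c_nmul h2 h4)).pair (Computable.c_nmul h3 h6)))).of_eq fun a => ?_
  symm
  apply eq_mkq
  · exact Nat.mul_pos (f a).pos (g a).pos
  · push_cast
    linear_combination (g a) * (g a).den * rat_eq (f a) +
      ((rpos (f a) : ℚ) - rneg (f a)) * rat_eq (g a)

theorem Computable.c_neg (hf : Computable f) : Computable fun a => - f a := by
  refine (Computable.c_mul (Computable.const (-1)) hf).of_eq fun a => by ring

theorem Computable.c_sub (hf : Computable f) (hg : Computable g) :
    Computable fun a => f a - g a :=
  (Computable.c_add hf (Computable.c_neg hg)).of_eq fun a => by ring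

theorem Computable.c_cast {n : α → ℕ} (hn : Computable n) : Computable fun a => (n a : ℚ) :=
  (computable_mkq.comp (hn.pair ((Computable.const 0).pair (Computable.const 1)))).of_eq fun a => by
    simp [mkq]

theorem CP.le (hf : Computable f) (hg : Computable g) : CP fun a => f a ≤ g a := by
  have h1 := computable_rpos.comp hf
  have h2 := computable_rneg.comp hf
  have h3 := computable_den.comp hf
  have h4 := computable_rpos.comp hg
  have h5 := computable_rneg.comp hg
  have h6 := computable_den.comp hg
  refine (CP.nat_le (Computable.c_nadd (Computable.c_nmul h1 h6) (Computable.c_nmul h5 h3))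
    (Computable.c_nadd (Computable.c_nmul h4 h3) (Computable.c_nmul h2 h6))).of_iff fun a => ?_
  have e1 := rat_eq (f a)
  have e2 := rat_eq (g a)
  have p1 : (0 : ℚ) < (f a).den := by exact_mod_cast (f a).pos
  have p2 : (0 : ℚ) < (g a).den := by exact_mod_cast (g a).pos
  have e3 : ((rpos (f a) : ℚ) * (g a).den + rneg (g a) * (f a).den ≤
      rpos (g a) * (f a).den + rneg (f a) * (g a).den) ↔
      f a * ((f a).den * (g a).den) ≤ g a * ((f a).den * (g a).den) := by
    have : rpos (g a) * ((f a).den : ℚ) + rneg (f a) * (g a).den -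
        ((rpos (f a) : ℚ) * (g a).den + rneg (g a) * (f a).den) =
        g a * ((f a).den * (g a).den) - f a * ((f a).den * (g a).den) := by
      linear_combination (g a).den * e1 - (f a).den * e2
    constructor <;> intro h <;> linarith
  rw [mul_le_mul_iff_left₀ (by positivity)] at e3
  rw [← e3]
  exact_mod_cast Iff.rfl

theorem CP.lt (hf : Computable f) (hg : Computable g) : CP fun a => f a < g a :=
  (CP.le hg hf).not.of_iff fun _ => not_le

theorem Computable.c_abs (hf : Computable f) : Computable fun a => |f a| := by
  refine (Computable.cond_ite (inst := fun _ => inferInstance) (CP.le (Computable.const 0) hf) hf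
    (Computable.c_neg hf)).of_eq fun a => ?_
  by_cases h : 0 ≤ f a
  · rw [if_pos h, abs_of_nonneg h]
  · rw [if_neg h, abs_of_neg (not_le.1 h)]

end ratops

theorem computable_padicValNat : Computable fun r : ℕ × ℕ => padicValNat r.1 r.2 := by
  refine Computable.least (R := fun (r : ℕ × ℕ) (e : ℕ) => r.1 = 1 ∨ r.2 = 0 ∨ ¬ r.1 ^ (e + 1) ∣ r.2)
    ?_ ?_ ?_
  · have h1 : Computable fun s : (ℕ × ℕ) × ℕ => s.1.1 := Computable.fst.c_fst
    have h2 : Computable fun s : (ℕ × ℕ) × ℕ => s.1.2 := Computable.fst.c_snd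
    have hp : Computable fun s : (ℕ × ℕ) × ℕ => s.1.1 ^ (s.2 + 1) := by
      have : Computable fun s : (ℕ × ℕ) × ℕ => Nat.rec (motive := fun _ => ℕ) 1
          (fun _ r => r * s.1.1) (s.2 + 1) := by
        refine Computable.nat_rec (f := fun s : (ℕ × ℕ) × ℕ => s.2 + 1) (g := fun _ => 1)
          (h := fun s p => p.2 * s.1.1) (Computable.succ.comp Computable.snd)
          (Computable.const 1) ?_
        exact Computable.c_nmul (f := fun u : ((ℕ × ℕ) × ℕ) × (ℕ × ℕ) => u.2.2)
          (g := fun u => u.1.1.1) Computable.snd.c_snd Computable.fst.c_fst.c_fst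
      refine this.of_eq fun s => ?_
      generalize s.2 + 1 = n
      induction n with
      | zero => simp
      | succ n ih => rw [pow_succ, ← ih]
    exact CP.or (CP.nat_eq h1 (Computable.const 1)) (CP.or (CP.nat_eq h2 (Computable.const 0))
      (CP.not (CP.nat_dvd hp h2)))
  · rintro ⟨p, n⟩
    dsimp only
    by_cases h1 : p = 1
    · exact Or.inl h1
    by_cases h2 : n = 0
    · exact Or.inr (Or.inl h2)
    right; right
    rw [padicValNat_dvd_iff_le_of_ne_one h1 h2]
    omega
  · rintro ⟨p, n⟩ e
    dsimp only
    rintro (rfl | rfl | h)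
    · simp
    · simp
    · by_cases h1 : p = 1
      · subst h1; simp
      by_cases h2 : n = 0
      · subst h2; simp
      rw [padicValNat_dvd_iff_le_of_ne_one h1 h2] at h
      omega

theorem Computable.c_padic {α : Type*} [Primcodable α] {p : α → ℕ} {f : α → ℚ}
    (hp : Computable p) (hf : Computable f) :
    Computable fun a => ((padicValRat (p a) (f a) : ℤ) : ℚ) := by
  refine (Computable.c_sub
    (Computable.c_cast (computable_padicValNat.comp (hp.pair (computable_natAbs_num.comp hf))))
    (Computable.c_cast (computable_padicValNat.comp (hp.pair (computable_den.comp hf))))).of_eq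
    fun a => ?_
  simp [padicValRat, padicValInt]

theorem CP.prime {α : Type*} [Primcodable α] {p : α → ℕ} (hp : Computable p) :
    CP fun a => (p a).Prime := by
  have h : CP Nat.Prime := by
    refine CP.of_iff (p := fun n => 2 ≤ n ∧ ∀ m < n, m < 2 ∨ ¬ m ∣ n) ?_ fun n => ?_
    · refine CP.and (CP.nat_le (Computable.const 2) Computable.c_id) ?_
      refine CP.forall_lt (P := fun n m => m < 2 ∨ ¬ m ∣ n) ?_ Computable.c_id
      exact CP.or (CP.nat_lt Computable.snd (Computable.const 2))
        (CP.not (CP.nat_dvd Computable.snd Computable.fst))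
    · rw [Nat.prime_def_lt']
      refine and_congr_right fun _ => forall_congr' fun m => ?_
      constructor
      · intro h h1 h2
        exact (h h2).resolve_left (by omega)
      · intro h h1
        by_cases hm : m < 2
        · exact Or.inl hm
        · exact Or.inr (h (by omega) h1)
  exact h.comp hp

/-- Parameters `(a1, b1, a2, b2, c, x0, t)`. -/
abbrev Par := ℚ × ℚ × ℚ × ℚ × ℚ × ℚ × ℚ

namespace Par

/-- The map attached to the parameters. -/
def map (s : Par) (y : ℚ) : ℚ := pam2 s.1 s.2.1 s.2.2.1 s.2.2.2.1 s.2.2.2.2.1 y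

/-- The orbit attached to the parameters. -/
def orb (s : Par) (n : ℕ) : ℚ := (pam2 s.1 s.2.1 s.2.2.1 s.2.2.2.1 s.2.2.2.2.1)^[n] s.2.2.2.2.2.1

/-- The shadow orbit attached to the parameters. -/
def sh (s : Par) (N : ℕ) (y : ℚ) (k : ℕ) : ℚ :=
  shad s.1 s.2.1 s.2.2.1 s.2.2.2.1 s.2.2.2.2.1 s.orb N y k

variable {α : Type*} [Primcodable α]

theorem c1 {s : α → Par} (h : Computable s) : Computable fun a => (s a).1 := h.c_fst
theorem c2 {s : α → Par} (h : Computable s) : Computable fun a => (s a).2.1 := h.c_snd.c_fst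
theorem c3 {s : α → Par} (h : Computable s) : Computable fun a => (s a).2.2.1 :=
  h.c_snd.c_snd.c_fst
theorem c4 {s : α → Par} (h : Computable s) : Computable fun a => (s a).2.2.2.1 :=
  h.c_snd.c_snd.c_snd.c_fst
theorem c5 {s : α → Par} (h : Computable s) : Computable fun a => (s a).2.2.2.2.1 :=
  h.c_snd.c_snd.c_snd.c_snd.c_fst
theorem c6 {s : α → Par} (h : Computable s) : Computable fun a => (s a).2.2.2.2.2.1 :=
  h.c_snd.c_snd.c_snd.c_snd.c_snd.c_fst
theorem c7 {s : α → Par} (h : Computable s) : Computable fun a => (s a).2.2.2.2.2.2 :=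
  h.c_snd.c_snd.c_snd.c_snd.c_snd.c_snd

theorem c_map {s : α → Par} (hs : Computable s) {y : α → ℚ} (hy : Computable y) :
    Computable fun a => (s a).map (y a) := by
  unfold map pam2
  refine Computable.cond_ite (CP.and (CP.le (Computable.const 0) hy) (CP.lt hy (c5 hs))) ?_
    (Computable.cond_ite (CP.and (CP.le (c5 hs) hy) (CP.lt hy (Computable.const 1))) ?_
      (Computable.const 0))
  · exact Computable.c_add (Computable.c_mul (c1 hs) hy) (c2 hs)
  · exact Computable.c_add (Computable.c_mul (c3 hs) hy) (c4 hs)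

theorem c_rec {σ : Type*} [Primcodable σ] {n : α → ℕ} {g : α → σ} {h : α × ℕ × σ → σ}
    {G : α → ℕ → σ} (hn : Computable n) (hg : Computable g) (hh : Computable h)
    (h0 : ∀ a, G a 0 = g a) (h1 : ∀ a k, G a (k + 1) = h (a, k, G a k)) :
    Computable fun a => G a (n a) := by
  have h2 : Computable₂ fun (a : α) (p : ℕ × σ) => h (a, p) := hh.to₂
  refine (Computable.nat_rec hn hg h2).of_eq fun a => ?_
  generalize n a = m
  induction m with
  | zero => exact (h0 a).symm
  | succ m ih => rw [h1, ← ih]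

theorem c_orb {s : α → Par} (hs : Computable s) {n : α → ℕ} (hn : Computable n) :
    Computable fun a => (s a).orb (n a) := by
  have hs' : Computable fun u : α × ℕ × ℚ => s u.1 := hs.comp Computable.fst
  refine c_rec (G := fun a k => (s a).orb k) hn (c6 hs)
    (c_map hs' Computable.snd.c_snd) (fun a => rfl) (fun a k => ?_)
  exact Function.iterate_succ_apply' _ _ _

theorem c_sh {s : α → Par} (hs : Computable s) {N : α → ℕ} (hN : Computable N) {y : α → ℚ}
    (hy : Computable y) {k : α → ℕ} (hk : Computable k) :
    Computable fun a => (s a).sh (N a) (y a) (k a) := by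
  have hs' : Computable fun u : α × ℕ × ℚ => s u.1 := hs.comp Computable.fst
  have hN' : Computable fun u : α × ℕ × ℚ => N u.1 := hN.comp Computable.fst
  have hp1 : Computable fun u : α × ℕ × ℚ => u.2.1 := Computable.snd.c_fst
  have hp2 : Computable fun u : α × ℕ × ℚ => u.2.2 := Computable.snd.c_snd
  have hh := Computable.cond_ite (inst := fun _ => inferInstance)
    (CP.lt (c_orb hs' (Computable.c_nadd hN' hp1)) (c5 hs'))
    (Computable.c_add (Computable.c_mul (c1 hs') hp2) (c2 hs'))
    (Computable.c_add (Computable.c_mul (c3 hs') hp2) (c4 hs'))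
  exact c_rec (G := fun a k => (s a).sh (N a) (y a) k) hk hy hh (fun a => rfl) (fun a k => rfl)

theorem c_cnt {s : α → Par} (hs : Computable s) {n : α → ℕ} (hn : Computable n) :
    Computable fun a => ((cnt (fun m => (s a).orb m < (s a).2.2.2.2.1) 0 (n a) : ℤ) : ℚ) := by
  have hs' : Computable fun u : α × ℕ × ℚ => s u.1 := hs.comp Computable.fst
  have hp1 : Computable fun u : α × ℕ × ℚ => u.2.1 := Computable.snd.c_fst
  have hp2 : Computable fun u : α × ℕ × ℚ => u.2.2 := Computable.snd.c_snd
  have hh := Computable.c_add hp2 (Computable.cond_ite (inst := fun _ => inferInstance)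
    (CP.lt (c_orb hs' hp1) (c5 hs')) (Computable.const (0 : ℚ)) (Computable.const 1))
  refine c_rec (G := fun a k =>
    ((cnt (fun m => (s a).orb m < (s a).2.2.2.2.1) 0 k : ℤ) : ℚ)) hn (Computable.const 0) hh
    (fun a => by simp [cnt]) (fun a k => ?_)
  dsimp only
  rw [cnt, zero_add]
  push_cast
  congr 1
  unfold chi
  split_ifs <;> simp

theorem cp_certA {s : α → Par} (hs : Computable s) {N q : α → ℕ} (hN : Computable N)
    (hq : Computable q) {y : α → ℚ} (hy : Computable y) :
    CP fun a => CertA (s a).1 (s a).2.1 (s a).2.2.1 (s a).2.2.2.1 (s a).2.2.2.2.1 (s a).orb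
      (s a).2.2.2.2.2.2 (N a) (q a) (y a) := by
  have hx1 := c_orb hs hN
  have hx2 := c_orb hs (Computable.c_nadd hN hq)
  refine CP.and (CP.nat_lt (Computable.const 0) hq) (CP.and (CP.eq (c_sh hs hN hy hq) hy)
    (CP.and ?_ ?_))
  · refine CP.forall_lt (P := fun a k => ((s a).orb (N a + k) < (s a).2.2.2.2.1 →
        0 ≤ (s a).sh (N a) (y a) k ∧ (s a).sh (N a) (y a) k ≤ (s a).2.2.2.2.1) ∧
      (¬ (s a).orb (N a + k) < (s a).2.2.2.2.1 →
        (s a).2.2.2.2.1 ≤ (s a).sh (N a) (y a) k ∧ (s a).sh (N a) (y a) k ≤ 1) ∧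
      (((s a).2.2.2.2.2.2 = (s a).sh (N a) (y a) k ∧
          (s a).orb (N a + k) ≠ (s a).sh (N a) (y a) k) ∨
        |(s a).orb (N a + k) - (s a).sh (N a) (y a) k| <
          |(s a).2.2.2.2.2.2 - (s a).sh (N a) (y a) k|)) ?_ hq
    have hk : Computable fun r : α × ℕ => r.2 := Computable.snd
    have hs' : Computable fun r : α × ℕ => s r.1 := hs.comp Computable.fst
    have hN' : Computable fun r : α × ℕ => N r.1 := hN.comp Computable.fst
    have hy' : Computable fun r : α × ℕ => y r.1 := hy.comp Computable.fst
    have ho := c_orb hs' (Computable.c_nadd hN' hk)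
    have hh := c_sh hs' hN' hy' hk
    have hc := c5 hs'
    have ht := c7 hs'
    exact CP.and (CP.imp (CP.lt ho hc) (CP.and (CP.le (Computable.const 0) hh) (CP.le hh hc)))
      (CP.and (CP.imp (CP.not (CP.lt ho hc)) (CP.and (CP.le hc hh) (CP.le hh (Computable.const 1))))
        (CP.or (CP.and (CP.eq ht hh) (CP.not (CP.eq ho hh)))
          (CP.lt (Computable.c_abs (Computable.c_sub ho hh))
            (Computable.c_abs (Computable.c_sub ht hh)))))
  · exact CP.or (CP.and (CP.lt (Computable.const 0) (Computable.c_sub hx2 hy))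
        (CP.lt (Computable.c_sub hx2 hy) (Computable.c_sub hx1 hy)))
      (CP.or (CP.and (CP.lt (Computable.const 0) (Computable.c_sub hy hx2))
        (CP.lt (Computable.c_sub hy hx2) (Computable.c_sub hy hx1))) (CP.eq hx1 hy))

theorem cp_certB {s : α → Par} (hs : Computable s) {N n p : α → ℕ} (hN : Computable N)
    (hn : Computable n) (hp : Computable p) :
    CP fun a => CertB (s a).1 (s a).2.1 (s a).2.2.1 (s a).2.2.2.1 (s a).2.2.2.2.1 (s a).orb
      (s a).2.2.2.2.2.2 (N a) (n a) (p a) := by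
  have v1 := Computable.c_padic hp (c1 hs)
  have v2 := Computable.c_padic hp (c3 hs)
  have vb1 := Computable.c_padic hp (c2 hs)
  have vb2 := Computable.c_padic hp (c4 hs)
  have vt := Computable.c_padic hp (c7 hs)
  have vx := Computable.c_padic hp (c_orb hs hN)
  have hE := Computable.c_add (Computable.c_abs v1) (Computable.c_abs v2)
  have hn' := Computable.c_cast hn
  have hL := Computable.c_add (Computable.c_add vx (Computable.c_mul hn' hE)) hE
  have hd := Computable.c_sub v2 v1
  have hM := Computable.c_add (Computable.c_add (Computable.c_mul hn' v1)
    (Computable.c_mul (c_cnt hs hn) hd)) (Computable.c_abs hd)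
  refine CP.and (CP.lt (Computable.const 0) (c1 hs)) (CP.and (CP.lt (Computable.const 0) (c3 hs))
    (CP.and (CP.lt (Computable.c_add (Computable.c_mul (c3 hs) (c5 hs)) (c4 hs)) (c2 hs))
    (CP.and (CP.prime hp) (CP.and ?_ (CP.and ?_ (CP.and ?_ (CP.and ?_ ?_)))))))
  · exact (CP.lt hM (Computable.const 0)).of_iff fun a => by norm_cast
  · exact (CP.lt hL (Computable.const 0)).of_iff fun a => by norm_cast
  · exact (CP.lt hL vb1).of_iff fun a => by norm_cast
  · exact (CP.lt hL vb2).of_iff fun a => by norm_cast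
  · exact (CP.lt hL vt).of_iff fun a => by norm_cast

/-- A witnessed violation of the promise. -/
def Viol (s : Par) (y z : ℚ) : Prop :=
  ¬ 0 < s.2.2.2.2.1 ∨ ¬ s.2.2.2.2.1 < 1 ∨ ¬ (0 ≤ s.2.2.2.2.2.1 ∧ s.2.2.2.2.2.1 < 1) ∨
  ((0 ≤ y ∧ y < 1) ∧ ¬ (0 ≤ s.map y ∧ s.map y < 1)) ∨
  ((0 ≤ y ∧ y < 1) ∧ (0 ≤ z ∧ z < 1) ∧ s.map y = s.map z ∧ ¬ y = z)

theorem cp_viol {s : α → Par} (hs : Computable s) {y z : α → ℚ} (hy : Computable y)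
    (hz : Computable z) : CP fun a => Viol (s a) (y a) (z a) := by
  have unit : ∀ {f : α → ℚ}, Computable f → CP fun a => 0 ≤ f a ∧ f a < 1 := fun hf =>
    CP.and (CP.le (Computable.const 0) hf) (CP.lt hf (Computable.const 1))
  exact CP.or (CP.not (CP.lt (Computable.const 0) (c5 hs)))
    (CP.or (CP.not (CP.lt (c5 hs) (Computable.const 1))) (CP.or (CP.not (unit (c6 hs)))
    (CP.or (CP.and (unit hy) (CP.not (unit (c_map hs hy))))
    (CP.and (unit hy) (CP.and (unit hz) (CP.and (CP.eq (c_map hs hy) (c_map hs hz))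
      (CP.not (CP.eq hy hz))))))))

theorem viol_iff (s : Par) : (¬ ∃ y z, Viol s y z) ↔
    (GoodPam s.1 s.2.1 s.2.2.1 s.2.2.2.1 s.2.2.2.2.1 ∧ s.2.2.2.2.2.1 ∈ Set.Ico (0 : ℚ) 1) := by
  constructor
  · intro h
    push Not at h
    have h' : ∀ y z, ¬ Viol s y z := h
    unfold Viol at h'
    refine ⟨⟨?_, ?_, ?_, ?_⟩, ?_⟩
    · by_contra hc
      exact h' 0 0 (Or.inl hc)
    · by_contra hc
      exact h' 0 0 (Or.inr (Or.inl hc))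
    · intro y hy
      by_contra hc
      exact h' y 0 (Or.inr (Or.inr (Or.inr (Or.inl ⟨hy, hc⟩))))
    · intro y hy z hz hyz
      by_contra hc
      exact h' y z (Or.inr (Or.inr (Or.inr (Or.inr ⟨hy, hz, hyz, hc⟩))))
    · by_contra hc
      exact h' 0 0 (Or.inr (Or.inr (Or.inl hc)))
  · rintro ⟨G, hx⟩ ⟨y, z, h | h | h | ⟨h1, h2⟩ | ⟨h1, h2, h3, h4⟩⟩
    · exact h G.c0
    · exact h G.c1
    · exact h hx
    · exact h2 (G.maps y h1)
    · exact h4 (G.inj h1 h2 h3)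

/-- Witnesses of non-reachability (or of a violated promise). -/
def Neg (s : Par) (d : ℕ × ℕ × ℕ × ℚ × ℚ) : Prop :=
  Viol s d.2.2.2.1 d.2.2.2.2 ∨ ((∀ k < d.1, ¬ s.orb k = s.2.2.2.2.2.2) ∧
    (CertA s.1 s.2.1 s.2.2.1 s.2.2.2.1 s.2.2.2.2.1 s.orb s.2.2.2.2.2.2 d.1 d.2.1 d.2.2.2.1 ∨
     CertB s.1 s.2.1 s.2.2.1 s.2.2.2.1 s.2.2.2.2.1 s.orb s.2.2.2.2.2.2 d.1 d.2.1 d.2.2.1))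

theorem cp_neg : CP fun r : Par × (ℕ × ℕ × ℕ × ℚ × ℚ) => Neg r.1 r.2 := by
  have hs : Computable fun r : Par × (ℕ × ℕ × ℕ × ℚ × ℚ) => r.1 := Computable.fst
  have hd : Computable fun r : Par × (ℕ × ℕ × ℕ × ℚ × ℚ) => r.2 := Computable.snd
  refine CP.or (cp_viol hs hd.c_snd.c_snd.c_snd.c_fst hd.c_snd.c_snd.c_snd.c_snd) (CP.and ?_
    (CP.or (cp_certA hs hd.c_fst hd.c_snd.c_fst hd.c_snd.c_snd.c_snd.c_fst)
      (cp_certB hs hd.c_fst hd.c_snd.c_fst hd.c_snd.c_snd.c_fst)))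
  refine CP.forall_lt (P := fun (r : Par × (ℕ × ℕ × ℕ × ℚ × ℚ)) k =>
    ¬ r.1.orb k = r.1.2.2.2.2.2.2) ?_ hd.c_fst
  have hs' : Computable fun r : (Par × (ℕ × ℕ × ℕ × ℚ × ℚ)) × ℕ => r.1.1 := Computable.fst.c_fst
  exact CP.not (CP.eq (c_orb hs' Computable.snd) (c7 hs'))

theorem cp_pos : CP fun r : Par × ℕ => r.1.orb r.2 = r.1.2.2.2.2.2.2 :=
  CP.eq (c_orb Computable.fst Computable.snd) (c7 Computable.fst)

theorem total (s : Par) : (∃ n, s.orb n = s.2.2.2.2.2.2) ∨ ∃ d, Neg s d := by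
  by_cases hv : ∃ y z, Viol s y z
  · obtain ⟨y, z, h⟩ := hv
    exact Or.inr ⟨(0, 0, 0, y, z), Or.inl h⟩
  by_cases hr : ∃ n, s.orb n = s.2.2.2.2.2.2
  · exact Or.inl hr
  right
  push Not at hr
  obtain ⟨G, hx⟩ := (viol_iff s).1 hv
  rcases G.cert_complete hx s.2.2.2.2.2.2 hr with ⟨N, q, y, h⟩ | ⟨N, n, p, h⟩
  · exact ⟨(N, q, 0, y, 0), Or.inr ⟨fun k _ => hr k, Or.inl h⟩⟩
  · exact ⟨(N, n, p, 0, 0), Or.inr ⟨fun k _ => hr k, Or.inr h⟩⟩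

theorem sound (s : Par) (G : GoodPam s.1 s.2.1 s.2.2.1 s.2.2.2.1 s.2.2.2.2.1)
    (hx : s.2.2.2.2.2.1 ∈ Set.Ico (0 : ℚ) 1) (h : ∃ d, Neg s d) (n : ℕ) :
    s.orb n ≠ s.2.2.2.2.2.2 := by
  obtain ⟨⟨N, q, p, y, z⟩, h | ⟨h1, h2⟩⟩ := h
  · exact absurd ⟨_, _, h⟩ ((viol_iff s).2 ⟨G, hx⟩)
  · dsimp only at h1 h2
    rcases lt_or_ge n N with hn | hn
    · exact h1 n hn
    · obtain ⟨k, rfl⟩ := Nat.exists_eq_add_of_le hn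
      rcases h2 with h2 | h2
      · exact (G.pamOrbit hx).certA_sound _ N q y h2 k
      · exact G.certB_sound hx _ N q p h2 k

end Par

/-- Reachability is decidable for injective piecewise affine maps with two intervals. -/
theorem injective_pam_reachability_decidable :
    ∃ F : ℚ × ℚ × ℚ × ℚ × ℚ × ℚ × ℚ → Bool, Computable F ∧
      ∀ a1 b1 a2 b2 c x0 t : ℚ,
        0 < c → c < 1 →
        (∀ x ∈ Set.Ico (0 : ℚ) 1, pam2 a1 b1 a2 b2 c x ∈ Set.Ico (0 : ℚ) 1) →
        Set.InjOn (pam2 a1 b1 a2 b2 c) (Set.Ico (0 : ℚ) 1) →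
        x0 ∈ Set.Ico (0 : ℚ) 1 → t ∈ Set.Ico (0 : ℚ) 1 →
        (F (a1, b1, a2, b2, c, x0, t) = true ↔
          ∃ n : ℕ, (pam2 a1 b1 a2 b2 c)^[n] x0 = t) := by
  obtain ⟨F, hF, h⟩ := separation (P := fun (s : Par) n => s.orb n = s.2.2.2.2.2.2)
    (Q := Par.Neg) Par.cp_pos Par.cp_neg Par.total
  refine ⟨F, hF, ?_⟩
  intro a1 b1 a2 b2 c x0 t hc0 hc1 hmaps hinj hx0 _
  obtain ⟨h1, h2⟩ := h (a1, b1, a2, b2, c, x0, t)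
  refine ⟨h1, ?_⟩
  rintro ⟨n, hn⟩
  by_contra hcon
  rw [Bool.not_eq_true] at hcon
  exact Par.sound (a1, b1, a2, b2, c, x0, t) ⟨hc0, hc1, hmaps, hinj⟩ hx0 (h2 hcon) n hn
end

section
/- There is a computable function F : ℚ × ℚ × ℚ × ℚ → Bool such that for all rationals a, b, x0, t, with g : ℚ → ℚ the affine map g(x) = a*x + b, we have F (a, b, x0, t) = true if and only if there exists n : ℕ with g^[n] x0 = t. -/
/-- raw code of a rational -/
def rawCode (q : ℚ) : ℕ := @Encodable.encode ℚ Rat.instEncodable q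

theorem rawCode_eq (q : ℚ) : rawCode q = Nat.pair (Equiv.intEquivNat q.num) q.den := rfl

theorem intEquivNat_nonneg (n : ℕ) : Equiv.intEquivNat (n : ℤ) = 2 * n := rfl
theorem intEquivNat_neg (n : ℕ) : Equiv.intEquivNat (Int.negSucc n) = 2 * n + 1 := rfl

theorem natAbs_eq_code (z : ℤ) : z.natAbs = (Equiv.intEquivNat z + 1) / 2 := by
  cases z with
  | ofNat n =>
    have := intEquivNat_nonneg n
    simp only [Int.ofNat_eq_natCast, this, Int.natAbs_natCast]; omega
  | negSucc n => rw [intEquivNat_neg, Int.natAbs_negSucc]; omega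

theorem toNat_eq_code (z : ℤ) :
    z.toNat = if Equiv.intEquivNat z % 2 = 0 then (Equiv.intEquivNat z + 1) / 2 else 0 := by
  cases z with
  | ofNat n =>
    have := intEquivNat_nonneg n
    simp only [Int.ofNat_eq_natCast, this, Int.toNat_natCast]; split_ifs <;> omega
  | negSucc n => rw [intEquivNat_neg]; split_ifs <;> [omega; rfl]

theorem toNat_neg_eq_code (z : ℤ) :
    (-z).toNat = if Equiv.intEquivNat z % 2 = 0 then 0 else (Equiv.intEquivNat z + 1) / 2 := by
  cases z with
  | ofNat n =>
    have := intEquivNat_nonneg n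
    simp only [Int.ofNat_eq_natCast, this]; split_ifs <;> omega
  | negSucc n => rw [intEquivNat_neg]; split_ifs <;> simp <;> omega

/-- valid raw codes -/
def GoodCode (n : ℕ) : Prop :=
  0 < n.unpair.2 ∧ ∀ k < n.unpair.2 + 1,
    ¬ (((n.unpair.1 + 1) / 2) % k = 0 ∧ n.unpair.2 % k = 0 ∧ k ≠ 1)

theorem goodCode_iff (n : ℕ) : GoodCode n ↔ n ∈ Set.range rawCode := by
  constructor
  · rintro ⟨h0, h⟩
    have hz := natAbs_eq_code (Equiv.intEquivNat.symm n.unpair.1)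
    rw [Equiv.apply_symm_apply] at hz
    refine ⟨⟨Equiv.intEquivNat.symm n.unpair.1, n.unpair.2, h0.ne', ?_⟩, ?_⟩
    · rw [hz]
      by_contra hc
      refine h _ (Nat.lt_succ_of_le (Nat.gcd_le_right _ h0)) ⟨?_, ?_, hc⟩
      · exact Nat.mod_eq_zero_of_dvd (Nat.gcd_dvd_left _ _)
      · exact Nat.mod_eq_zero_of_dvd (Nat.gcd_dvd_right _ _)
    · rw [rawCode_eq]; simp
  · rintro ⟨q, rfl⟩
    rw [rawCode_eq, GoodCode, Nat.unpair_pair]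
    refine ⟨q.den_pos, fun k _ hk => hk.2.2 ?_⟩
    rw [← natAbs_eq_code] at hk
    exact Nat.eq_one_of_dvd_coprimes q.reduced
      (Nat.dvd_of_mod_eq_zero hk.1) (Nat.dvd_of_mod_eq_zero hk.2.1)

instance : DecidablePred GoodCode := fun n => by unfold GoodCode; infer_instance

/-- the code of a rational used by its `Primcodable` instance -/
def primCode (q : ℚ) : ℕ := @Encodable.encode ℚ Primcodable.toEncodable q

theorem encode_rat (q : ℚ) : primCode q = Nat.count GoodCode (rawCode q) := by
  classical
  have h : primCode q = (List.range (rawCode q)).countP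
    (fun n => @decide (n ∈ Set.range (@Encodable.encode ℚ Rat.instEncodable)) (Encodable.decidableRangeEncode ℚ n)) := rfl
  rw [h, Nat.count]
  apply List.countP_congr
  intro x _
  simp only [decide_eq_true_eq, goodCode_iff]
  rfl

open Primrec in
theorem goodCode_primrec : PrimrecPred GoodCode := by
  have hu1 : Primrec fun n : ℕ => n.unpair.1 := fst.comp unpair
  have hu2 : Primrec fun n : ℕ => n.unpair.2 := snd.comp unpair
  have hR : PrimrecRel fun (k n : ℕ) =>
      ¬ (((n.unpair.1 + 1) / 2) % k = 0 ∧ n.unpair.2 % k = 0 ∧ k ≠ 1) := by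
    refine PrimrecPred.not (PrimrecPred.and ?_ (PrimrecPred.and ?_ (PrimrecPred.not ?_)))
    · exact Primrec.eq.comp (nat_mod.comp (nat_div.comp (succ.comp (hu1.comp snd)) (const 2)) fst) (const 0)
    · exact Primrec.eq.comp (nat_mod.comp (hu2.comp snd) fst) (const 0)
    · exact Primrec.eq.comp fst (const 1)
  exact PrimrecPred.and (nat_lt.comp (const 0) hu2)
    (hR.forall_lt.comp (succ.comp hu2) Primrec.id)

open Primrec in
theorem count_primrec : Primrec (Nat.count GoodCode) := by
  have : Primrec fun n : ℕ =>
      Nat.rec (motive := fun _ => ℕ) 0 (fun k c => c + if GoodCode k then 1 else 0) n := by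
    refine nat_rec₁ 0 ?_
    exact nat_add.comp snd (ite (goodCode_primrec.comp fst) (const 1) (const 0))
  refine this.of_eq fun n => ?_
  induction n with
  | zero => simp
  | succ n ih => rw [Nat.count_succ, ← ih]

theorem rawCode_computable : Computable rawCode := by
  have hp : Primrec₂ fun (q : ℚ) (m : ℕ) =>
      decide (GoodCode m ∧ Nat.count GoodCode m = primCode q) := by
    apply PrimrecPred.decide
    exact PrimrecPred.and (goodCode_primrec.comp Primrec.snd)
      (Primrec.eq.comp (count_primrec.comp Primrec.snd) (Primrec.encode.comp Primrec.fst))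
  have := Partrec.rfind hp.to_comp.partrec₂
  refine this.of_eq_tot fun q => ?_
  have hg : GoodCode (rawCode q) := (goodCode_iff _).2 ⟨q, rfl⟩
  rw [Nat.mem_rfind]
  refine ⟨?_, fun {m} hm => ?_⟩
  · simp [hg, encode_rat]
  · simp only [PFun.coe_val, Part.mem_some_iff]
    symm
    rw [decide_eq_false_iff_not]
    rintro ⟨h1, h2⟩
    rw [encode_rat] at h2
    exact hm.ne (Nat.count_injective h1 hg h2)

/-- positive part, negative part, denominator -/
def ratData (q : ℚ) : ℕ × ℕ × ℕ := (q.num.toNat, (-q.num).toNat, q.den)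

open Primrec in
theorem ratData_computable : Computable ratData := by
  have hu1 : Primrec fun n : ℕ => n.unpair.1 := fst.comp unpair
  have hu2 : Primrec fun n : ℕ => n.unpair.2 := snd.comp unpair
  have hc : PrimrecPred fun n : ℕ => n.unpair.1 % 2 = 0 :=
    Primrec.eq.comp (nat_mod.comp hu1 (const 2)) (const 0)
  have hv : Primrec fun n : ℕ => (n.unpair.1 + 1) / 2 :=
    nat_div.comp (succ.comp hu1) (const 2)
  have := (Primrec.pair (ite hc hv (const 0)) (Primrec.pair (ite hc (const 0) hv) hu2)).to_comp.comp
    rawCode_computable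
  refine this.of_eq fun q => ?_
  rw [rawCode_eq, Nat.unpair_pair, ratData, toNat_eq_code, toNat_neg_eq_code]

theorem pow_bound_aux (a : ℚ) (h0 : a ≠ 0) (h1 : a ≠ 1) (h2 : a ≠ -1) (U V : ℤ) (hV : V ≠ 0)
    (n : ℕ) (h : a ^ n * V = U) : n ≤ max U.natAbs V.natAbs := by
  have hU : U ≠ 0 := by
    rintro rfl
    have : a ^ n * (V : ℚ) ≠ 0 := mul_ne_zero (pow_ne_zero _ h0) (by exact_mod_cast hV)
    exact this (by simpa using h)
  have hd : (a.den : ℚ) ≠ 0 := by exact_mod_cast a.den_nz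
  have key : a.num ^ n * V = (a.den : ℤ) ^ n * U := by
    have : (a.num : ℚ) ^ n * V = (a.den : ℚ) ^ n * U := by
      rw [← h, ← mul_assoc, ← mul_pow, mul_comm (a.den : ℚ) a, Rat.mul_den_eq_num]
    exact_mod_cast this
  have hc : IsCoprime a.num (a.den : ℤ) := by
    rw [Int.isCoprime_iff_gcd_eq_one]; exact a.reduced
  have hdU : a.num ^ n ∣ U := (hc.pow).dvd_of_dvd_mul_left (Dvd.intro _ key)
  have hdV : (a.den : ℤ) ^ n ∣ V := (hc.symm.pow).dvd_of_dvd_mul_left (Dvd.intro _ key.symm)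
  have hdU' : a.num.natAbs ^ n ≤ U.natAbs := by
    rw [← Int.natAbs_pow]
    exact Nat.le_of_dvd (Int.natAbs_pos.2 hU) (Int.natAbs_dvd_natAbs.2 hdU)
  have hdV' : a.den ^ n ≤ V.natAbs := by
    have := Nat.le_of_dvd (Int.natAbs_pos.2 hV) (Int.natAbs_dvd_natAbs.2 hdV)
    simpa [Int.natAbs_pow] using this
  by_cases hp : 2 ≤ a.num.natAbs
  · exact le_max_of_le_left (((Nat.lt_pow_self hp).le).trans hdU')
  · have hn0 : a.num ≠ 0 := Rat.num_ne_zero.2 h0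
    have hq : 2 ≤ a.den := by
      by_contra hq
      have hd1 : a.den = 1 := by have := a.den_pos; omega
      have ha : (a.num : ℚ) = a := Rat.coe_int_num_of_den_eq_one hd1
      have : a.num = 1 ∨ a.num = -1 := by omega
      rcases this with h | h
      · exact h1 (by rw [← ha, h]; simp)
      · exact h2 (by rw [← ha, h]; simp)
    exact le_max_of_le_right (((Nat.lt_pow_self hq).le).trans hdV')

/-- sum of heights -/
def htSum (a b x t : ℚ) : ℕ :=
  a.num.natAbs + a.den + (b.num.natAbs + b.den) + (x.num.natAbs + x.den) + (t.num.natAbs + t.den)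

theorem mono_bound (S p q r s : ℕ) (hp : p ≤ S) (hq : q ≤ S) (hr : r ≤ S) (hs : s ≤ S) :
    p * q * r * s ≤ S ^ 4 := by
  calc p * q * r * s ≤ S * S * S * S := by gcongr
    _ = S ^ 4 := by ring

theorem natAbs_bound (S : ℕ) (u v w y a b x : ℤ)
  (h1 : u.natAbs ≤ S) (h2 : v.natAbs ≤ S) (h3 : w.natAbs ≤ S) (h4 : y.natAbs ≤ S)
  (h5 : a.natAbs ≤ S) (h6 : b.natAbs ≤ S) (h7 : x.natAbs ≤ S) :
    ((u * (v - w) * y - a * b * v) * x).natAbs ≤ 3 * S ^ 4 := by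
  have e : (u * (v - w) * y - a * b * v) * x = u * v * y * x - u * w * y * x - a * b * v * x := by
    ring
  rw [e]
  have k1 := mono_bound S _ _ _ _ h1 h2 h4 h7
  have k2 := mono_bound S _ _ _ _ h1 h3 h4 h7
  have k3 := mono_bound S _ _ _ _ h5 h6 h2 h7
  rw [← Int.natAbs_mul, ← Int.natAbs_mul, ← Int.natAbs_mul] at k1 k2 k3
  omega

theorem iter_identity (a b x : ℚ) (n : ℕ) :
    ((fun x => a * x + b)^[n] x) * (1 - a) - b = a ^ n * (x * (1 - a) - b) := by
  induction n with
  | zero => simp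
  | succ n ih => rw [Function.iterate_succ_apply', pow_succ]; linear_combination a * ih

theorem iter_one (b x : ℚ) (n : ℕ) : (fun x => 1 * x + b)^[n] x = x + n * b := by
  induction n with
  | zero => simp
  | succ n ih => rw [Function.iterate_succ_apply', ih]; push_cast; ring

theorem iter_two (a b x : ℚ) (h : a = 0 ∨ a = -1) (n : ℕ) :
    (fun x => a * x + b)^[n] x = x ∨ (fun x => a * x + b)^[n] x = a * x + b := by
  induction n with
  | zero => simp
  | succ n ih =>
    rw [Function.iterate_succ_apply']
    rcases ih with ih | ih <;> rw [ih] <;> rcases h with rfl | rfl <;> simp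

theorem reach_bound (a b x t : ℚ) (n : ℕ) (h : (fun x => a * x + b)^[n] x = t) :
    ∃ m < 3 * htSum a b x t ^ 4 + 1, (fun x => a * x + b)^[m] x = t := by
  have pa := a.den_pos
  have pb := b.den_pos
  have px := x.den_pos
  have pt := t.den_pos
  have hS : 1 ≤ htSum a b x t := by unfold htSum; omega
  have hS4 : 1 ≤ htSum a b x t ^ 4 := Nat.one_le_pow _ _ hS
  have ea := Rat.mul_den_eq_num a
  have eb := Rat.mul_den_eq_num b
  have ex := Rat.mul_den_eq_num x
  have et := Rat.mul_den_eq_num t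
  by_cases h01 : a = 0 ∨ a = -1
  · rcases iter_two a b x h01 n with h' | h'
    · exact ⟨0, by omega, by rw [← h, h']; rfl⟩
    · exact ⟨1, by omega, by rw [← h, h']; rfl⟩
  push Not at h01
  by_cases h1 : a = 1
  · subst h1
    by_cases hb : b = 0
    · exact ⟨0, by omega, by rw [iter_one, hb] at h; simpa using h⟩
    refine ⟨n, ?_, h⟩
    rw [iter_one] at h
    have key : (n : ℤ) * (b.num * t.den * x.den) =
        (t.num * (1 - 0) * x.den - x.num * t.den * 1) * b.den := by
      have : (n : ℚ) * (b.num * t.den * x.den) =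
        (t.num * (1 - 0) * x.den - x.num * t.den * 1) * b.den := by
        rw [← eb, ← ex, ← et]
        linear_combination (t.den * x.den * b.den : ℚ) * h
      exact_mod_cast this
    have hbd := natAbs_bound (htSum 1 b x t) t.num 1 0 x.den x.num t.den b.den
      (by unfold htSum; omega) (by simpa using hS) (by simp) (by unfold htSum; omega)
      (by unfold htSum; omega) (by unfold htSum; omega) (by unfold htSum; omega)
    rw [← key, Int.natAbs_mul, Int.natAbs_natCast] at hbd
    have hpos : 0 < (b.num * t.den * x.den).natAbs := by
      apply Int.natAbs_pos.2
      have := Rat.num_ne_zero.2 hb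
      positivity
    have := Nat.le_mul_of_pos_right n hpos
    omega
  by_cases hV : x * (1 - a) - b = 0
  · refine ⟨0, by omega, ?_⟩
    have k := iter_identity a b x n
    rw [h, hV, mul_zero, ← hV] at k
    have : (x - t) * (1 - a) = 0 := by linear_combination - k
    have h3 : (1 - a) ≠ 0 := sub_ne_zero.2 (Ne.symm h1)
    have := (mul_eq_zero.1 this).resolve_right h3
    exact sub_eq_zero.1 this
  refine ⟨n, ?_, h⟩
  have k := iter_identity a b x n
  rw [h] at k
  set U : ℤ := (t.num * (a.den - a.num) * b.den - b.num * t.den * a.den) * x.den with hU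
  set V : ℤ := (x.num * (a.den - a.num) * b.den - b.num * x.den * a.den) * t.den with hV'
  have eU : (U : ℚ) = (t * (1 - a) - b) * (a.den * b.den * x.den * t.den) := by
    rw [hU]; push_cast; rw [← ea, ← eb, ← et]; ring
  have eV : (V : ℚ) = (x * (1 - a) - b) * (a.den * b.den * x.den * t.den) := by
    rw [hV']; push_cast; rw [← ea, ← eb, ← ex]; ring
  have hV0 : V ≠ 0 := by
    have : (V : ℚ) ≠ 0 := by
      rw [eV]
      exact mul_ne_zero hV (by positivity)
    exact_mod_cast this
  have := pow_bound_aux a h01.1 h1 h01.2 U V hV0 n (by rw [eU, eV, k]; ring)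
  have bU : U.natAbs ≤ 3 * htSum a b x t ^ 4 := by
    apply natAbs_bound _ _ _ _ _ _ _ _ <;> unfold htSum <;> omega
  have bV : V.natAbs ≤ 3 * htSum a b x t ^ 4 := by
    apply natAbs_bound _ _ _ _ _ _ _ _ <;> unfold htSum <;> omega
  have := max_le bU bV
  omega

/-- one step of the affine map on unreduced fractions `(P - M) / Q` -/
def stepFrac (a b s : ℕ × ℕ × ℕ) : ℕ × ℕ × ℕ :=
  ((a.1 * s.1 + a.2.1 * s.2.1) * b.2.2 + b.1 * s.2.2 * a.2.2,
   (a.1 * s.2.1 + a.2.1 * s.1) * b.2.2 + b.2.1 * s.2.2 * a.2.2,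
   a.2.2 * b.2.2 * s.2.2)

/-- value of an unreduced fraction -/
def fracVal (s : ℕ × ℕ × ℕ) : ℚ := ((s.1 : ℚ) - s.2.1) / s.2.2

theorem fracVal_ratData (q : ℚ) : fracVal (ratData q) = q := by
  have h : ((q.num.toNat : ℤ) - ((-q.num).toNat : ℤ)) = q.num := by omega
  have h' : ((q.num.toNat : ℚ) - ((-q.num).toNat : ℚ)) = q.num := by exact_mod_cast h
  simp only [fracVal, ratData, h', Rat.num_div_den]

theorem stepFrac_den (a b s : ℕ × ℕ × ℕ) (ha : a.2.2 ≠ 0) (hb : b.2.2 ≠ 0) (hs : s.2.2 ≠ 0) :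
    (stepFrac a b s).2.2 ≠ 0 := mul_ne_zero (mul_ne_zero ha hb) hs

theorem fracVal_step (a b s : ℕ × ℕ × ℕ) (ha : a.2.2 ≠ 0) (hb : b.2.2 ≠ 0) (hs : s.2.2 ≠ 0) :
    fracVal (stepFrac a b s) = fracVal a * fracVal s + fracVal b := by
  have ha' : (a.2.2 : ℚ) ≠ 0 := by exact_mod_cast ha
  have hb' : (b.2.2 : ℚ) ≠ 0 := by exact_mod_cast hb
  have hs' : (s.2.2 : ℚ) ≠ 0 := by exact_mod_cast hs
  simp only [fracVal, stepFrac]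
  push_cast
  field_simp
  ring

theorem iter_step (a b s : ℕ × ℕ × ℕ) (ha : a.2.2 ≠ 0) (hb : b.2.2 ≠ 0) (hs : s.2.2 ≠ 0) (n : ℕ) :
    ((stepFrac a b)^[n] s).2.2 ≠ 0 ∧
    fracVal ((stepFrac a b)^[n] s) = (fun x => fracVal a * x + fracVal b)^[n] (fracVal s) := by
  induction n with
  | zero => exact ⟨hs, rfl⟩
  | succ n ih =>
    rw [Function.iterate_succ_apply', Function.iterate_succ_apply']
    exact ⟨stepFrac_den _ _ _ ha hb ih.1, by rw [fracVal_step _ _ _ ha hb ih.1, ih.2]⟩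

/-- cross-multiplied equality of unreduced fractions -/
def fracEq (s t : ℕ × ℕ × ℕ) : Prop :=
  s.1 * t.2.2 + t.2.1 * s.2.2 = t.1 * s.2.2 + s.2.1 * t.2.2

theorem fracEq_iff (s t : ℕ × ℕ × ℕ) (hs : s.2.2 ≠ 0) (ht : t.2.2 ≠ 0) :
    fracEq s t ↔ fracVal s = fracVal t := by
  have hs' : (s.2.2 : ℚ) ≠ 0 := by exact_mod_cast hs
  have ht' : (t.2.2 : ℚ) ≠ 0 := by exact_mod_cast ht
  rw [fracVal, fracVal, div_eq_div_iff hs' ht', fracEq, ← Nat.cast_inj (R := ℚ)]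
  push_cast
  constructor <;> intro h <;> linear_combination h

/-- quadruples of unreduced fractions -/
abbrev Quad := (ℕ × ℕ × ℕ) × (ℕ × ℕ × ℕ) × (ℕ × ℕ × ℕ) × (ℕ × ℕ × ℕ)

/-- height of an unreduced fraction -/
def fracHt (s : ℕ × ℕ × ℕ) : ℕ := s.1 + s.2.1 + s.2.2

/-- search bound -/
def quadBound (p : Quad) : ℕ :=
  let S := fracHt p.1 + fracHt p.2.1 + fracHt p.2.2.1 + fracHt p.2.2.2
  3 * (S * S * S * S) + 1

theorem fracHt_ratData (q : ℚ) : fracHt (ratData q) = q.num.natAbs + q.den := by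
  simp only [fracHt, ratData]; omega

theorem quadBound_eq (a b x t : ℚ) :
    quadBound (ratData a, ratData b, ratData x, ratData t) = 3 * htSum a b x t ^ 4 + 1 := by
  simp only [quadBound, fracHt_ratData, htSum]; ring

open Primrec in
theorem fracHt_primrec : Primrec fracHt :=
  nat_add.comp (nat_add.comp fst (fst.comp snd)) (snd.comp snd)

open Primrec in
theorem quadBound_primrec : Primrec quadBound := by
  have hS : Primrec fun p : Quad =>
      fracHt p.1 + fracHt p.2.1 + fracHt p.2.2.1 + fracHt p.2.2.2 :=
    nat_add.comp (nat_add.comp (nat_add.comp (fracHt_primrec.comp fst)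
      (fracHt_primrec.comp (fst.comp snd)))
      (fracHt_primrec.comp (fst.comp (snd.comp snd))))
      (fracHt_primrec.comp (snd.comp (snd.comp snd)))
  exact succ.comp (nat_mul.comp (const 3)
    (nat_mul.comp (nat_mul.comp (nat_mul.comp hS hS) hS) hS))

open Primrec in
theorem stepFrac_primrec {α : Type*} [Primcodable α] {f g h : α → ℕ × ℕ × ℕ}
    (hf : Primrec f) (hg : Primrec g) (hh : Primrec h) :
    Primrec fun x => stepFrac (f x) (g x) (h x) := by
  have f1 := fst.comp hf
  have f2 := fst.comp (snd.comp hf)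
  have f3 := snd.comp (snd.comp hf)
  have g1 := fst.comp hg
  have g2 := fst.comp (snd.comp hg)
  have g3 := snd.comp (snd.comp hg)
  have h1 := fst.comp hh
  have h2 := fst.comp (snd.comp hh)
  have h3 := snd.comp (snd.comp hh)
  refine Primrec.pair ?_ (Primrec.pair ?_ ?_)
  · exact nat_add.comp (nat_mul.comp (nat_add.comp (nat_mul.comp f1 h1) (nat_mul.comp f2 h2)) g3)
      (nat_mul.comp (nat_mul.comp g1 h3) f3)
  · exact nat_add.comp (nat_mul.comp (nat_add.comp (nat_mul.comp f1 h2) (nat_mul.comp f2 h1)) g3)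
      (nat_mul.comp (nat_mul.comp g2 h3) f3)
  · exact nat_mul.comp (nat_mul.comp f3 g3) h3

open Primrec in
theorem fracEq_primrec : PrimrecRel fracEq := by
  have f1 : Primrec fun p : (ℕ × ℕ × ℕ) × (ℕ × ℕ × ℕ) => p.1.1 := fst.comp fst
  have f2 : Primrec fun p : (ℕ × ℕ × ℕ) × (ℕ × ℕ × ℕ) => p.1.2.1 := fst.comp (snd.comp fst)
  have f3 : Primrec fun p : (ℕ × ℕ × ℕ) × (ℕ × ℕ × ℕ) => p.1.2.2 := snd.comp (snd.comp fst)
  have g1 : Primrec fun p : (ℕ × ℕ × ℕ) × (ℕ × ℕ × ℕ) => p.2.1 := fst.comp snd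
  have g2 : Primrec fun p : (ℕ × ℕ × ℕ) × (ℕ × ℕ × ℕ) => p.2.2.1 := fst.comp (snd.comp snd)
  have g3 : Primrec fun p : (ℕ × ℕ × ℕ) × (ℕ × ℕ × ℕ) => p.2.2.2 := snd.comp (snd.comp snd)
  exact Primrec.eq.comp (nat_add.comp (nat_mul.comp f1 g3) (nat_mul.comp g2 f3))
    (nat_add.comp (nat_mul.comp g1 f3) (nat_mul.comp f2 g3))

/-- the bounded search predicate -/
def quadReach (p : Quad) : Prop :=
  ∃ n < quadBound p, fracEq ((stepFrac p.1 p.2.1)^[n] p.2.2.1) p.2.2.2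

open Primrec in
theorem quadIter_primrec : Primrec fun x : ℕ × Quad =>
    (stepFrac x.2.1 x.2.2.1)^[x.1] x.2.2.2.1 := by
  have p1 : Primrec fun x : ℕ × Quad => x.2.1 := fst.comp snd
  have p2 : Primrec fun x : ℕ × Quad => x.2.2.1 := fst.comp (snd.comp snd)
  have p3 : Primrec fun x : ℕ × Quad => x.2.2.2.1 := fst.comp (snd.comp (snd.comp snd))
  have hs : Primrec₂ fun (x : ℕ × Quad) (s : ℕ × ℕ × ℕ) => stepFrac x.2.1 x.2.2.1 s :=
    stepFrac_primrec (p1.comp fst) (p2.comp fst) snd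
  exact nat_iterate fst p3 hs

/-- the relation searched for -/
def quadRel (n : ℕ) (p : Quad) : Prop :=
  fracEq ((stepFrac p.1 p.2.1)^[n] p.2.2.1) p.2.2.2

open Primrec in
theorem quadRel_primrec : PrimrecRel quadRel := by
  have p4 : Primrec fun x : ℕ × Quad => x.2.2.2.2 := snd.comp (snd.comp (snd.comp snd))
  exact fracEq_primrec.comp quadIter_primrec p4

theorem quadReach_primrec : PrimrecPred quadReach := by
  have h : PrimrecRel fun (n : ℕ) (p : Quad) => ∃ x < n, quadRel x p :=
    (quadRel_primrec.exists_mem_list.comp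
      (Primrec.list_range.comp Primrec.fst) Primrec.snd).of_eq (by simp)
  have h2 : PrimrecPred fun p : Quad => ∃ x < quadBound p, quadRel x p :=
    h.comp quadBound_primrec Primrec.id
  exact h2.of_eq fun p => Iff.rfl

theorem quadReach_iff (a b x t : ℚ) :
    quadReach (ratData a, ratData b, ratData x, ratData t) ↔
      ∃ n : ℕ, (fun x => a * x + b)^[n] x = t := by
  have hd : ∀ q : ℚ, (ratData q).2.2 ≠ 0 := fun q => q.den_nz
  have key : ∀ n : ℕ, fracEq ((stepFrac (ratData a) (ratData b))^[n] (ratData x)) (ratData t) ↔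
      (fun x => a * x + b)^[n] x = t := by
    intro n
    obtain ⟨h1, h2⟩ := iter_step _ _ _ (hd a) (hd b) (hd x) n
    rw [fracEq_iff _ _ h1 (hd t), h2]
    simp only [fracVal_ratData]
  simp only [quadReach, quadBound_eq, key]
  constructor
  · rintro ⟨n, _, h⟩
    exact ⟨n, h⟩
  · rintro ⟨n, h⟩
    exact reach_bound a b x t n h

/-- Point-to-point reachability is decidable for a single affine map over the rationals. -/
theorem affine_reachability_decidable :
    ∃ F : ℚ × ℚ × ℚ × ℚ → Bool, Computable F ∧
      ∀ a b x0 t : ℚ,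
        (F (a, b, x0, t) = true ↔ ∃ n : ℕ, (fun x => a * x + b)^[n] x0 = t) := by
  classical
  have hD : Computable fun p : ℚ × ℚ × ℚ × ℚ =>
      ((ratData p.1, ratData p.2.1, ratData p.2.2.1, ratData p.2.2.2) : Quad) :=
    Computable.pair (ratData_computable.comp Computable.fst)
      (Computable.pair (ratData_computable.comp (Computable.fst.comp Computable.snd))
        (Computable.pair
          (ratData_computable.comp (Computable.fst.comp (Computable.snd.comp Computable.snd)))
          (ratData_computable.comp (Computable.snd.comp (Computable.snd.comp Computable.snd)))))
  refine ⟨fun p => decide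
    (quadReach (ratData p.1, ratData p.2.1, ratData p.2.2.1, ratData p.2.2.2)), ?_, ?_⟩
  · exact quadReach_primrec.decide.to_comp.comp hD
  · intro a b x0 t
    rw [decide_eq_true_eq, quadReach_iff]
end

section
/- There is a computable function F : ℚ × ℚ × ℚ × ℚ × ℚ → Bool such that for all rationals a, b, x0, u, v, with g : ℚ → ℚ the affine map g(x) = a*x + b, we have F (a, b, x0, u, v) = true if and only if there exists n : ℕ with u ≤ g^[n] x0 and g^[n] x0 < v. -/
open Encodable

namespace AffReach

/-- raw code of a rational -/
def raw (q : ℚ) : ℕ := @encode ℚ Rat.instEncodable q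

instance dR : DecidablePred (· ∈ Set.range raw) := decidableRangeEncode ℚ

/-- the code used by computability theory -/
def pe (q : ℚ) : ℕ := @encode ℚ Primcodable.toEncodable q

theorem enc_eq (q : ℚ) : pe q = (List.range (raw q)).countP (· ∈ Set.range raw) := rfl

theorem raw_eq (q : ℚ) : raw q = Nat.pair (encode q.num) q.den := rfl

theorem raw_inj {p q : ℚ} (h : raw p = raw q) : p = q :=
  @encode_injective ℚ Rat.instEncodable _ _ h

theorem enc_int (n : ℕ) : encode (Int.ofNat n) = 2 * n := rfl
theorem enc_int' (n : ℕ) : encode (Int.negSucc n) = 2 * n + 1 := rfl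

/-- positive part from the code of an integer -/
def cpos (c : ℕ) : ℕ := bif c.bodd then 0 else c.div2
/-- negative part from the code of an integer -/
def cneg (c : ℕ) : ℕ := bif c.bodd then c.div2 + 1 else 0

theorem cpos_enc (z : ℤ) : cpos (encode z) = z.toNat := by
  cases z with
  | ofNat n => rw [enc_int]; simp [cpos, Nat.div2_val]
  | negSucc n => rw [enc_int']; simp [cpos]

theorem cneg_enc (z : ℤ) : cneg (encode z) = (-z).toNat := by
  cases z with
  | ofNat n => rw [enc_int]; simp [cneg]
  | negSucc n => rw [enc_int']; simp [cneg, Nat.div2_val]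

theorem cpos_prim : Primrec cpos :=
  Primrec.cond Primrec.nat_bodd (Primrec.const 0) Primrec.nat_div2
theorem cneg_prim : Primrec cneg :=
  Primrec.cond Primrec.nat_bodd (Primrec.succ.comp Primrec.nat_div2) (Primrec.const 0)

theorem gcd_prim : Primrec₂ Nat.gcd := by
  have h : PrimrecRel (fun (p : ℕ × ℕ) (k : ℕ) => p.1 % k = 0 ∧ p.2 % k = 0) := by
    have h1 : PrimrecPred (fun x : (ℕ × ℕ) × ℕ => x.1.1 % x.2 = 0) :=
      Primrec.eq.comp (Primrec.nat_mod.comp (Primrec.fst.comp Primrec.fst) Primrec.snd)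
        (Primrec.const 0)
    have h2 : PrimrecPred (fun x : (ℕ × ℕ) × ℕ => x.1.2 % x.2 = 0) :=
      Primrec.eq.comp (Primrec.nat_mod.comp (Primrec.snd.comp Primrec.fst) Primrec.snd)
        (Primrec.const 0)
    exact h1.and h2
  have h3 : Primrec (fun p : ℕ × ℕ => p.1 + p.2) := Primrec.nat_add
  refine (Primrec.nat_findGreatest h3 h).of_eq ?_
  rintro ⟨a, b⟩
  rw [Nat.findGreatest_eq_iff]
  dsimp only
  refine ⟨?_, fun _ => ⟨Nat.mod_eq_zero_of_dvd (Nat.gcd_dvd_left a b),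
    Nat.mod_eq_zero_of_dvd (Nat.gcd_dvd_right a b)⟩, ?_⟩
  · rcases Nat.eq_zero_or_pos a with rfl | ha
    · simp
    · exact (Nat.gcd_le_left b ha).trans (by omega)
  · rintro k hk hk2 ⟨h1, h2⟩
    have := Nat.dvd_gcd (Nat.dvd_of_mod_eq_zero h1) (Nat.dvd_of_mod_eq_zero h2)
    rcases Nat.eq_zero_or_pos (Nat.gcd a b) with h0 | h0
    · rw [Nat.gcd_eq_zero_iff] at h0; omega
    · exact absurd (Nat.le_of_dvd h0 this) (by omega)

theorem mem_range_raw (m : ℕ) : m ∈ Set.range raw ↔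
    (0 < m.unpair.2 ∧ Nat.gcd (cpos m.unpair.1 + cneg m.unpair.1) m.unpair.2 = 1) := by
  have key : ∀ z : ℤ, cpos (encode z) + cneg (encode z) = z.natAbs := by
    intro z; rw [cpos_enc, cneg_enc]; omega
  constructor
  · rintro ⟨q, rfl⟩
    rw [raw_eq]
    simp only [Nat.unpair_pair]
    rw [key]
    exact ⟨q.den_pos, q.reduced⟩
  · rintro ⟨h1, h2⟩
    obtain ⟨z, hz⟩ : ∃ z : ℤ, encode z = m.unpair.1 := ⟨Equiv.intEquivNat.symm m.unpair.1,
      Equiv.intEquivNat.apply_symm_apply _⟩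
    rw [← hz, key] at h2
    refine ⟨⟨z, m.unpair.2, h1.ne', h2⟩, ?_⟩
    rw [raw_eq]
    simp only [hz, Nat.pair_unpair]

theorem range_prim : PrimrecPred (fun m => m ∈ Set.range raw) := by
  have u1 : Primrec (fun m : ℕ => m.unpair.1) := Primrec.fst.comp Primrec.unpair
  have u2 : Primrec (fun m : ℕ => m.unpair.2) := Primrec.snd.comp Primrec.unpair
  have h1 : PrimrecPred (fun m : ℕ => 0 < m.unpair.2) :=
    Primrec.nat_lt.comp (Primrec.const 0) u2
  have h2 : PrimrecPred (fun m : ℕ =>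
      Nat.gcd (cpos m.unpair.1 + cneg m.unpair.1) m.unpair.2 = 1) :=
    Primrec.eq.comp (gcd_prim.comp (Primrec.nat_add.comp (cpos_prim.comp u1) (cneg_prim.comp u1))
      u2) (Primrec.const 1)
  exact (h1.and h2).of_eq fun m => (mem_range_raw m).symm

/-- counting valid codes -/
def cnt (m : ℕ) : ℕ := (List.range m).countP (· ∈ Set.range raw)

theorem cnt_prim : Primrec cnt := by
  have h : Primrec₂ (fun (m c : ℕ) => if m ∈ Set.range raw then c + 1 else c) :=
    Primrec.ite (range_prim.comp Primrec.fst) (Primrec.succ.comp Primrec.snd) Primrec.snd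
  refine (Primrec.nat_rec₁ 0 h).of_eq ?_
  intro n
  induction n with
  | zero => rfl
  | succ n ih =>
    simp only [ih]
    unfold cnt
    rw [List.range_succ, List.countP_append, List.countP_singleton]
    by_cases hn : n ∈ Set.range raw <;> simp [hn]

theorem raw_comp : Computable raw := by
  have h : Primrec₂ (fun (q : ℚ) (m : ℕ) => decide (m ∈ Set.range raw ∧ cnt m = pe q)) := by
    have h1 : PrimrecPred (fun x : ℚ × ℕ => x.2 ∈ Set.range raw) := range_prim.comp Primrec.snd
    have h2 : PrimrecPred (fun x : ℚ × ℕ => cnt x.2 = pe x.1) :=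
      Primrec.eq.comp (cnt_prim.comp Primrec.snd) (Primrec.encode.comp Primrec.fst)
    exact (h1.and h2).decide
  refine (Partrec.rfind h.to_comp.partrec₂).of_eq_tot ?_
  intro q
  have hs : ∀ m, (m ∈ Set.range raw ∧ cnt m = pe q) ↔ m = raw q := by
    intro m
    constructor
    · rintro ⟨⟨p, rfl⟩, hp⟩
      exact congrArg raw (@encode_injective ℚ Primcodable.toEncodable _ _ ((enc_eq p).trans hp))
    · rintro rfl
      exact ⟨⟨q, rfl⟩, (enc_eq q).symm⟩
  simp only [hs]
  rw [Nat.mem_rfind]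
  refine ⟨by simp, ?_⟩
  intro m hm
  simp [hm.ne]

/-- positive part of numerator -/
def P (q : ℚ) : ℕ := q.num.toNat
/-- negative part of numerator -/
def N (q : ℚ) : ℕ := (-q.num).toNat
/-- denominator -/
def D (q : ℚ) : ℕ := q.den

theorem P_comp : Computable P :=
  (cpos_prim.to_comp.comp (Computable.fst.comp (Computable.unpair.comp raw_comp))).of_eq
    fun q => by rw [raw_eq, Nat.unpair_pair, cpos_enc]; rfl
theorem N_comp : Computable N :=
  (cneg_prim.to_comp.comp (Computable.fst.comp (Computable.unpair.comp raw_comp))).of_eq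
    fun q => by rw [raw_eq, Nat.unpair_pair, cneg_enc]; rfl
theorem D_comp : Computable D :=
  (Computable.snd.comp (Computable.unpair.comp raw_comp)).of_eq
    fun q => by rw [raw_eq, Nat.unpair_pair]; rfl

theorem D_pos (q : ℚ) : (0 : ℚ) < D q := by exact_mod_cast q.den_pos
theorem rat_eq (q : ℚ) : q = ((P q : ℚ) - N q) / D q := by
  have h : (q.num : ℚ) = (P q : ℚ) - N q := by
    have : q.num = (P q : ℤ) - N q := by unfold P N; omega
    exact_mod_cast this
  rw [← h]; exact (Rat.num_div_den q).symm

theorem add_c : Computable₂ ((· + ·) : ℕ → ℕ → ℕ) := Primrec.nat_add.to_comp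
theorem mul_c : Computable₂ ((· * ·) : ℕ → ℕ → ℕ) := Primrec.nat_mul.to_comp
theorem eq_c : Computable₂ (fun a b : ℕ => decide (a = b)) := Primrec.eq.decide.to_comp
theorem le_c : Computable₂ (fun a b : ℕ => decide (a ≤ b)) := Primrec.nat_le.decide.to_comp

variable {α : Type*} [Primcodable α]

theorem of_frac {p n d : α → ℕ} (hp : Computable p) (hn : Computable n) (hd : Computable d)
    {f : α → ℚ} (h0 : ∀ a, 0 < d a) (hf : ∀ a, f a = ((p a : ℚ) - n a) / d a) :
    Computable f := by
  have hr : Computable (fun x : α × ℕ => Denumerable.ofNat ℚ x.2) :=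
    (Computable.ofNat ℚ).comp Computable.snd
  have hp' : Computable (fun x : α × ℕ => p x.1) := hp.comp Computable.fst
  have hn' : Computable (fun x : α × ℕ => n x.1) := hn.comp Computable.fst
  have hd' : Computable (fun x : α × ℕ => d x.1) := hd.comp Computable.fst
  have h : Computable₂ (fun (a : α) (m : ℕ) =>
      decide (P (Denumerable.ofNat ℚ m) * d a + n a * D (Denumerable.ofNat ℚ m)
        = p a * D (Denumerable.ofNat ℚ m) + N (Denumerable.ofNat ℚ m) * d a)) :=
    eq_c.comp (add_c.comp (mul_c.comp (P_comp.comp hr) hd') (mul_c.comp hn' (D_comp.comp hr)))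
      (add_c.comp (mul_c.comp hp' (D_comp.comp hr)) (mul_c.comp (N_comp.comp hr) hd'))
  have hs : ∀ a (r : ℚ), (P r * d a + n a * D r = p a * D r + N r * d a) ↔ r = f a := by
    intro a r
    have h1 := D_pos r
    have h2 : (0 : ℚ) < d a := by exact_mod_cast h0 a
    rw [hf a]
    conv_rhs => rw [rat_eq r]
    rw [div_eq_div_iff h1.ne' h2.ne', ← Nat.cast_inj (R := ℚ)]
    push_cast
    constructor <;> intro h <;> linarith
  rw [← Computable.encode_iff]
  refine (Partrec.rfind h.partrec₂).of_eq_tot ?_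
  intro a
  simp only [hs]
  rw [Nat.mem_rfind]
  have hof : Denumerable.ofNat ℚ (@encode ℚ Primcodable.toEncodable (f a)) = f a :=
    Denumerable.ofNat_encode _
  refine ⟨Part.mem_some_iff.2 (decide_eq_true hof).symm, ?_⟩
  intro m hm
  have : Denumerable.ofNat ℚ m ≠ f a := by
    rintro h
    rw [← h] at hm
    exact absurd (Denumerable.encode_ofNat (α := ℚ) m) hm.ne'
  exact Part.mem_some_iff.2 (decide_eq_false this).symm

theorem add_comp {f g : α → ℚ} (hf : Computable f) (hg : Computable g) :
    Computable (fun a => f a + g a) := by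
  refine of_frac
    (p := fun a => P (f a) * D (g a) + P (g a) * D (f a))
    (n := fun a => N (f a) * D (g a) + N (g a) * D (f a))
    (d := fun a => D (f a) * D (g a)) ?_ ?_ ?_ ?_ ?_
  · exact add_c.comp (mul_c.comp (P_comp.comp hf) (D_comp.comp hg))
      (mul_c.comp (P_comp.comp hg) (D_comp.comp hf))
  · exact add_c.comp (mul_c.comp (N_comp.comp hf) (D_comp.comp hg))
      (mul_c.comp (N_comp.comp hg) (D_comp.comp hf))
  · exact mul_c.comp (D_comp.comp hf) (D_comp.comp hg)
  · intro a; exact Nat.mul_pos (f a).den_pos (g a).den_pos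
  · intro a
    have h1 := (D_pos (f a)).ne'
    have h2 := (D_pos (g a)).ne'
    conv_lhs => rw [rat_eq (f a), rat_eq (g a)]
    push_cast
    field_simp
    ring

theorem mul_comp {f g : α → ℚ} (hf : Computable f) (hg : Computable g) :
    Computable (fun a => f a * g a) := by
  refine of_frac
    (p := fun a => P (f a) * P (g a) + N (f a) * N (g a))
    (n := fun a => P (f a) * N (g a) + N (f a) * P (g a))
    (d := fun a => D (f a) * D (g a)) ?_ ?_ ?_ ?_ ?_
  · exact add_c.comp (mul_c.comp (P_comp.comp hf) (P_comp.comp hg))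
      (mul_c.comp (N_comp.comp hf) (N_comp.comp hg))
  · exact add_c.comp (mul_c.comp (P_comp.comp hf) (N_comp.comp hg))
      (mul_c.comp (N_comp.comp hf) (P_comp.comp hg))
  · exact mul_c.comp (D_comp.comp hf) (D_comp.comp hg)
  · intro a; exact Nat.mul_pos (f a).den_pos (g a).den_pos
  · intro a
    have h1 := (D_pos (f a)).ne'
    have h2 := (D_pos (g a)).ne'
    conv_lhs => rw [rat_eq (f a), rat_eq (g a)]
    push_cast
    field_simp
    ring

theorem le_comp {f g : α → ℚ} (hf : Computable f) (hg : Computable g) :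
    Computable (fun a => decide (f a ≤ g a)) := by
  have h : Computable (fun a => decide (P (f a) * D (g a) + N (g a) * D (f a)
      ≤ P (g a) * D (f a) + N (f a) * D (g a))) :=
    le_c.comp (add_c.comp (mul_c.comp (P_comp.comp hf) (D_comp.comp hg))
      (mul_c.comp (N_comp.comp hg) (D_comp.comp hf)))
      (add_c.comp (mul_c.comp (P_comp.comp hg) (D_comp.comp hf))
      (mul_c.comp (N_comp.comp hf) (D_comp.comp hg)))
  refine h.of_eq fun a => ?_
  rw [decide_eq_decide]
  conv_rhs => rw [rat_eq (f a), rat_eq (g a)]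
  rw [div_le_div_iff₀ (D_pos _) (D_pos _), ← Nat.cast_le (α := ℚ)]
  push_cast
  constructor <;> intro h <;> linarith

theorem and_comp {p q : α → Prop} [DecidablePred p] [DecidablePred q]
    (hp : Computable fun a => decide (p a)) (hq : Computable fun a => decide (q a)) :
    Computable (fun a => decide (p a ∧ q a)) :=
  ((Primrec.and.to_comp).comp hp hq).of_eq fun a => by simp

theorem or_comp {p q : α → Prop} [DecidablePred p] [DecidablePred q]
    (hp : Computable fun a => decide (p a)) (hq : Computable fun a => decide (q a)) :
    Computable (fun a => decide (p a ∨ q a)) :=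
  ((Primrec.or.to_comp).comp hp hq).of_eq fun a => by simp

theorem lt_comp {f g : α → ℚ} (hf : Computable f) (hg : Computable g) :
    Computable (fun a => decide (f a < g a)) :=
  ((Primrec.not.to_comp).comp (le_comp hg hf)).of_eq fun a => by
    rw [← decide_not, decide_eq_decide, not_le]

/-- orbit -/
def orb (a b x : ℚ) (n : ℕ) : ℚ := (fun x => a * x + b)^[n] x

theorem orb_succ (a b x : ℚ) (n : ℕ) : orb a b x (n + 1) = a * orb a b x n + b :=
  Function.iterate_succ_apply' _ _ _

theorem orb_comp {A B X : α → ℚ} {n : α → ℕ} (hA : Computable A) (hB : Computable B)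
    (hX : Computable X) (hn : Computable n) : Computable (fun a => orb (A a) (B a) (X a) (n a)) := by
  have hs : Computable₂ (fun (a : α) (p : ℕ × ℚ) => A a * p.2 + B a) :=
    add_comp (mul_comp (hA.comp Computable.fst) (Computable.snd.comp Computable.snd))
      (hB.comp Computable.fst)
  refine (Computable.nat_rec hn hX hs).of_eq fun a => ?_
  induction n a with
  | zero => rfl
  | succ k ih => rw [orb_succ, ← ih]

/-- The certificate of non-reachability. -/
def Cert (A B y u v : ℚ) (n : ℕ) : Prop :=
  A < 0 ∨
  (y ≤ A * y + B ∧ (v ≤ y ∨ (orb A B y n < u ∧ v ≤ orb A B y (n + 1)) ∨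
    (y < u ∧ (A * y + B < u ∧ A * u + B ≤ u)) ∨ (y < u ∧ A * y + B ≤ y))) ∨
  (A * y + B ≤ y ∧ (y < u ∨ (v ≤ orb A B y n ∧ orb A B y (n + 1) < u) ∨
    (v ≤ y ∧ v ≤ A * v + B) ∨ (v ≤ y ∧ y ≤ A * y + B)))

instance (A B y u v : ℚ) (n : ℕ) : Decidable (Cert A B y u v n) := by
  unfold Cert; infer_instance

/-- reachability with nonnegative slope -/
def Q (A B y u v : ℚ) : Prop := 0 ≤ A ∧ ∃ n, u ≤ orb A B y n ∧ orb A B y n < v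

theorem orb_mono {A B y : ℚ} (hA : 0 ≤ A) (h : y ≤ A * y + B) : Monotone (orb A B y) := by
  apply monotone_nat_of_le_succ
  intro n
  induction n with
  | zero => exact h
  | succ n ih =>
    rw [orb_succ, orb_succ A B y (n + 1)]
    have := mul_le_mul_of_nonneg_left ih hA
    linarith

theorem orb_anti {A B y : ℚ} (hA : 0 ≤ A) (h : A * y + B ≤ y) : Antitone (orb A B y) := by
  apply antitone_nat_of_succ_le
  intro n
  induction n with
  | zero => exact h
  | succ n ih =>
    rw [orb_succ A B y (n + 1), orb_succ A B y n]
    rw [orb_succ A B y n] at ih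
    have := mul_le_mul_of_nonneg_left ih hA
    linarith

theorem orb_const {A B y : ℚ} (h : A * y + B = y) (n : ℕ) : orb A B y n = y := by
  induction n with
  | zero => rfl
  | succ n ih => rw [orb_succ, ih, h]

theorem sound {A B y u v : ℚ} {n : ℕ} (hc : Cert A B y u v n) : ¬ Q A B y u v := by
  rintro ⟨hA, k, hk1, hk2⟩
  have h0 : orb A B y 0 = y := rfl
  rcases hc with h | ⟨hm, h⟩ | ⟨hm, h⟩
  · linarith
  · have mono := orb_mono hA hm
    rcases h with h | ⟨h1, h2⟩ | ⟨h1, h2, h3⟩ | ⟨h1, h2⟩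
    · have := mono (Nat.zero_le k); linarith
    · rcases Nat.lt_or_ge n k with hh | hh
      · have := mono (show n + 1 ≤ k from hh); linarith
      · have := mono hh; linarith
    · have : ∀ k, orb A B y k < u := by
        intro k
        induction k with
        | zero => exact h1
        | succ k ih =>
          rw [orb_succ]
          rcases hA.eq_or_lt with rfl | hA
          · linarith
          · have := mul_lt_mul_of_pos_left ih hA
            linarith
      linarith [this k]
    · rw [orb_const (le_antisymm h2 hm)] at hk1; linarith
  · have anti := orb_anti hA hm
    rcases h with h | ⟨h1, h2⟩ | ⟨h1, h2⟩ | ⟨h1, h2⟩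
    · have := anti (Nat.zero_le k); linarith
    · rcases Nat.lt_or_ge n k with hh | hh
      · have := anti (show n + 1 ≤ k from hh); linarith
      · have := anti hh; linarith
    · have : ∀ k, v ≤ orb A B y k := by
        intro k
        induction k with
        | zero => exact h1
        | succ k ih =>
          rw [orb_succ]
          have := mul_le_mul_of_nonneg_left ih hA
          linarith
      linarith [this k]
    · rw [orb_const (le_antisymm hm h2)] at hk2; linarith

/-- an affine function bounded below at two points is bounded below in between -/
theorem aff_min {A B p q z δ : ℚ} (h1 : p ≤ z) (h2 : z ≤ q) (hp : δ ≤ A * p + B - p)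
    (hq : δ ≤ A * q + B - q) : δ ≤ A * z + B - z := by
  rcases le_total A 1 with h | h
  · nlinarith
  · nlinarith

theorem aff_max {A B p q z δ : ℚ} (h1 : p ≤ z) (h2 : z ≤ q) (hp : A * p + B - p ≤ δ)
    (hq : A * q + B - q ≤ δ) : A * z + B - z ≤ δ := by
  rcases le_total A 1 with h | h
  · nlinarith
  · nlinarith

theorem complete {A B y u v : ℚ} (hQ : ¬ Q A B y u v) : ∃ n, Cert A B y u v n := by
  rcases lt_or_ge A 0 with hA | hA
  · exact ⟨0, Or.inl hA⟩
  have hno : ∀ k, u ≤ orb A B y k → v ≤ orb A B y k := by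
    intro k hk
    by_contra hh
    exact hQ ⟨hA, k, hk, not_le.1 hh⟩
  have h0 : orb A B y 0 = y := rfl
  rcases le_total y (A * y + B) with hm | hm
  · have mono := orb_mono hA hm
    by_cases hex : ∃ k, u ≤ orb A B y k
    · classical
      have hs := Nat.find_spec hex
      have hmin := fun m => @Nat.find_min _ _ hex m
      rcases hN : Nat.find hex with _ | n
      · rw [hN] at hs
        exact ⟨0, Or.inr (Or.inl ⟨hm, Or.inl (hno _ hs)⟩)⟩
      · rw [hN] at hs hmin
        exact ⟨n, Or.inr (Or.inl ⟨hm, Or.inr (Or.inl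
          ⟨not_le.1 (hmin n (Nat.lt_succ_self n)), hno _ hs⟩)⟩)⟩
    · push Not at hex
      have hy : y < u := hex 0
      have hy1 : A * y + B < u := hex 1
      refine ⟨0, Or.inr (Or.inl ⟨hm, Or.inr (Or.inr ?_)⟩)⟩
      by_contra hcon
      push Not at hcon
      have hu := hcon.1 hy hy1
      have hyy := hcon.2 hy
      have hδ : 0 < min (A * y + B - y) (A * u + B - u) := lt_min (by linarith) (by linarith)
      set δ := min (A * y + B - y) (A * u + B - u) with hδd
      have grow : ∀ n : ℕ, y + n * δ ≤ orb A B y n := by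
        intro n
        induction n with
        | zero => simp [h0]
        | succ n ih =>
          rw [orb_succ]
          have := aff_min (A := A) (B := B) (mono (Nat.zero_le n)) (hex n).le
            (min_le_left _ _) (min_le_right _ _)
          push_cast
          rw [h0, ← hδd] at this
          linarith
      obtain ⟨n, hn⟩ := Archimedean.arch (u - y) hδ
      rw [nsmul_eq_mul] at hn
      linarith [grow n, hex n]
  · have anti := orb_anti hA hm
    by_cases hex : ∃ k, orb A B y k < v
    · classical
      have hs := Nat.find_spec hex
      have hmin := fun m => @Nat.find_min _ _ hex m
      rcases hN : Nat.find hex with _ | n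
      · rw [hN] at hs
        refine ⟨0, Or.inr (Or.inr ⟨hm, Or.inl ?_⟩)⟩
        by_contra hh
        exact absurd (hno 0 (not_lt.1 hh)) (not_le.2 hs)
      · rw [hN] at hs hmin
        refine ⟨n, Or.inr (Or.inr ⟨hm, Or.inr (Or.inl
          ⟨not_lt.1 (hmin n (Nat.lt_succ_self n)), ?_⟩)⟩)⟩
        by_contra hh
        exact absurd (hno _ (not_lt.1 hh)) (not_le.2 hs)
    · push Not at hex
      have hy : v ≤ y := hex 0
      refine ⟨0, Or.inr (Or.inr ⟨hm, Or.inr (Or.inr ?_)⟩)⟩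
      by_contra hcon
      push Not at hcon
      have hu := hcon.1 hy
      have hyy := hcon.2 hy
      have hδ : max (A * y + B - y) (A * v + B - v) < 0 := max_lt (by linarith) (by linarith)
      set δ := max (A * y + B - y) (A * v + B - v) with hδd
      have grow : ∀ n : ℕ, orb A B y n ≤ y + n * δ := by
        intro n
        induction n with
        | zero => simp [h0]
        | succ n ih =>
          rw [orb_succ]
          have := aff_max (hex n) (anti (Nat.zero_le n)) (le_max_right (A * y + B - y) _)
            (le_max_left _ (A * v + B - v))
          push_cast
          rw [← hδd] at this
          linarith
      obtain ⟨n, hn⟩ := Archimedean.arch (y - v + 1) (neg_pos.2 hδ)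
      rw [nsmul_eq_mul] at hn
      linarith [grow n, hex n]

theorem re_of_exists {p : α → ℕ → Prop} [∀ a n, Decidable (p a n)]
    (hp : Computable₂ fun a n => decide (p a n)) : REPred (fun a => ∃ n, p a n) := by
  refine (Partrec.rfind hp.partrec₂).dom_re.of_eq fun a => ?_
  rw [Nat.rfind_dom']
  simp

/-- inputs -/
abbrev I := ℚ × ℚ × ℚ × ℚ × ℚ

theorem Q_comp : ComputablePred (fun x : I => Q x.1 x.2.1 x.2.2.1 x.2.2.2.1 x.2.2.2.2) := by
  have c1 : Computable (fun z : I × ℕ => z.1.1) := Computable.fst.comp Computable.fst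
  have t1 : Computable (fun z : I × ℕ => z.1.2) := Computable.snd.comp Computable.fst
  have c2 : Computable (fun z : I × ℕ => z.1.2.1) := Computable.fst.comp t1
  have t2 : Computable (fun z : I × ℕ => z.1.2.2) := Computable.snd.comp t1
  have c3 : Computable (fun z : I × ℕ => z.1.2.2.1) := Computable.fst.comp t2
  have t3 : Computable (fun z : I × ℕ => z.1.2.2.2) := Computable.snd.comp t2
  have c4 : Computable (fun z : I × ℕ => z.1.2.2.2.1) := Computable.fst.comp t3
  have c5 : Computable (fun z : I × ℕ => z.1.2.2.2.2) := Computable.snd.comp t3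
  have k0 : Computable (fun _ : I × ℕ => (0 : ℚ)) := Computable.const 0
  have o := orb_comp c1 c2 c3 (Computable.snd (α := I) (β := ℕ))
  have o' := orb_comp c1 c2 c3 (Computable.succ.comp (Computable.snd (α := I) (β := ℕ)))
  have ay := add_comp (mul_comp c1 c3) c2
  have au := add_comp (mul_comp c1 c4) c2
  have av := add_comp (mul_comp c1 c5) c2
  rw [ComputablePred.computable_iff_re_compl_re']
  constructor
  · have h : Computable₂ (fun (x : I) (n : ℕ) => decide (0 ≤ x.1 ∧
        (x.2.2.2.1 ≤ orb x.1 x.2.1 x.2.2.1 n ∧ orb x.1 x.2.1 x.2.2.1 n < x.2.2.2.2))) :=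
      and_comp (le_comp k0 c1) (and_comp (le_comp c4 o) (lt_comp o c5))
    refine (re_of_exists h).of_eq fun x => ?_
    simp [Q]
  · have h : Computable₂ (fun (x : I) (n : ℕ) => decide
        (Cert x.1 x.2.1 x.2.2.1 x.2.2.2.1 x.2.2.2.2 n)) := by
      have h1 := or_comp (lt_comp c1 k0) (or_comp
        (and_comp (le_comp c3 ay) (or_comp (le_comp c5 c3) (or_comp
          (and_comp (lt_comp o c4) (le_comp c5 o')) (or_comp
          (and_comp (lt_comp c3 c4) (and_comp (lt_comp ay c4) (le_comp au c4)))
          (and_comp (lt_comp c3 c4) (le_comp ay c3))))))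
        (and_comp (le_comp ay c3) (or_comp (lt_comp c3 c4) (or_comp
          (and_comp (le_comp c5 o) (lt_comp o' c4)) (or_comp
          (and_comp (le_comp c5 c3) (le_comp c5 av))
          (and_comp (le_comp c5 c3) (le_comp c3 ay)))))))
      refine Computable.of_eq h1 fun z => ?_
      rw [decide_eq_decide]
      rfl
    exact (re_of_exists h).of_eq fun x => ⟨fun ⟨_, hn⟩ => sound hn, complete⟩

theorem orb_two (a b x : ℚ) (n : ℕ) : orb a b x (2 * n) = orb (a * a) (a * b + b) x n := by
  induction n with
  | zero => rfl
  | succ n ih =>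
    rw [show 2 * (n + 1) = 2 * n + 1 + 1 by ring, orb_succ, orb_succ, ih, orb_succ]
    ring

theorem orb_shift (a b x : ℚ) (n : ℕ) : orb a b x (n + 1) = orb a b (a * x + b) n :=
  Function.iterate_succ_apply _ _ _

theorem reach_iff (a b x u v : ℚ) :
    (Q (a * a) (a * b + b) x u v ∨ Q (a * a) (a * b + b) (a * x + b) u v) ↔
      ∃ n, u ≤ orb a b x n ∧ orb a b x n < v := by
  constructor
  · rintro (⟨-, n, hn⟩ | ⟨-, n, hn⟩)
    · rw [← orb_two] at hn; exact ⟨_, hn⟩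
    · rw [← orb_two, ← orb_shift] at hn; exact ⟨_, hn⟩
  · rintro ⟨n, hn⟩
    rcases Nat.even_or_odd' n with ⟨k, rfl | rfl⟩
    · rw [orb_two] at hn; exact Or.inl ⟨mul_self_nonneg a, k, hn⟩
    · rw [orb_shift, orb_two] at hn; exact Or.inr ⟨mul_self_nonneg a, k, hn⟩

end AffReach

open AffReach in
/-- Point-to-interval reachability is decidable for a single affine map over the rationals. -/
theorem affine_interval_reachability_decidable :
    ∃ F : ℚ × ℚ × ℚ × ℚ × ℚ → Bool, Computable F ∧
      ∀ a b x0 u v : ℚ,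
        (F (a, b, x0, u, v) = true ↔
          ∃ n : ℕ, u ≤ (fun x => a * x + b)^[n] x0 ∧ (fun x => a * x + b)^[n] x0 < v) := by
  obtain ⟨G, hG, hGe⟩ := ComputablePred.computable_iff.1 Q_comp
  have c1 : Computable (fun z : I => z.1) := Computable.fst
  have t1 : Computable (fun z : I => z.2) := Computable.snd
  have c2 : Computable (fun z : I => z.2.1) := Computable.fst.comp t1
  have t2 : Computable (fun z : I => z.2.2) := Computable.snd.comp t1
  have c3 : Computable (fun z : I => z.2.2.1) := Computable.fst.comp t2
  have t3 : Computable (fun z : I => z.2.2.2) := Computable.snd.comp t2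
  have e : Computable (fun z : I => G (z.1 * z.1, z.1 * z.2.1 + z.2.1, z.2.2.1, z.2.2.2)) :=
    hG.comp ((mul_comp c1 c1).pair ((add_comp (mul_comp c1 c2) c2).pair (c3.pair t3)))
  have e' : Computable (fun z : I =>
      G (z.1 * z.1, z.1 * z.2.1 + z.2.1, z.1 * z.2.2.1 + z.2.1, z.2.2.2)) :=
    hG.comp ((mul_comp c1 c1).pair ((add_comp (mul_comp c1 c2) c2).pair
      ((add_comp (mul_comp c1 c3) c2).pair t3)))
  refine ⟨_, (Primrec.or.to_comp).comp e e', ?_⟩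
  intro a b x0 u v
  rw [Bool.or_eq_true]
  have h1 := congrFun hGe (a * a, a * b + b, x0, u, v)
  have h2 := congrFun hGe (a * a, a * b + b, a * x0 + b, u, v)
  dsimp only at h1 h2 ⊢
  rw [← h1, ← h2]
  exact reach_iff a b x0 u v
end
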